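/- Let (R, 𝔪) be an abstract hypersurface of dimension d ≥ 2, i.e., a noetherian local ring whose 𝔪-adic completion is isomorphic to S/(f) for some regular local ring S and some f in the square of the maximal ideal of S. If the Hilbert–Samuel multiplicity e(R) > 2, then there exist indecomposable R-lattices of arbitrarily large finite h-length; in fact, for each n > e(R) the (d+1)-st syzygy module Ω_R^{d+1}(R/𝔪^n) is an indecomposable R-lattice, and the h-lengths of these lattices are unbounded. -/

import Mathlib

universe u

open IsLocalRing

noncomputable section

namespace BT

/-- The length of a module, defined as the Krull dimension of its lattice of
submodules (which agrees with the usual composition-series length). -/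
def moduleLength (A : Type u) [Ring A] (M : Type u) [AddCommGroup M] [Module A M] :
    WithBot ℕ∞ :=
  Order.krullDim (Submodule A M)

/-- `M` is a maximal Cohen-Macaulay module over the local ring `R`: it admits an
`M`-regular sequence contained in the maximal ideal whose length is `dim R`
(i.e. `depth_R M = dim R`). -/
def IsMCM (R : Type u) [CommRing R] [IsLocalRing R]
    (M : Type u) [AddCommGroup M] [Module R M] : Prop :=
  ∃ rs : List R, (∀ r ∈ rs, r ∈ maximalIdeal R) ∧ RingTheory.Sequence.IsRegular M rs ∧
    (rs.length : WithBot ℕ∞) = ringKrullDim R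

/-- The `n`-th Ext group of two `R`-modules. -/
def extGroup (R : Type u) [CommRing R] (n : ℕ)
    (A B : Type u) [AddCommGroup A] [Module R A] [AddCommGroup B] [Module R B] : Type u :=
  ((Ext R (ModuleCat.{u} R) n).obj (Opposite.op (ModuleCat.of R A))).obj (ModuleCat.of R B)

instance (R : Type u) [CommRing R] (n : ℕ)
    (A B : Type u) [AddCommGroup A] [Module R A] [AddCommGroup B] [Module R B] :
    AddCommGroup (extGroup R n A B) :=
  inferInstanceAs (AddCommGroup
    (((Ext R (ModuleCat.{u} R) n).obj (Opposite.op (ModuleCat.of R A))).obj (ModuleCat.of R B)))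

instance (R : Type u) [CommRing R] (n : ℕ)
    (A B : Type u) [AddCommGroup A] [Module R A] [AddCommGroup B] [Module R B] :
    Module R (extGroup R n A B) :=
  inferInstanceAs (Module R
    (((Ext R (ModuleCat.{u} R) n).obj (Opposite.op (ModuleCat.of R A))).obj (ModuleCat.of R B)))

/-- `ω` is a canonical module for the Cohen-Macaulay local ring `R`: it is a
finitely generated module with `Ext^i_R(k, ω) = 0` for `i ≠ dim R` and
`Ext^{dim R}_R(k, ω) ≅ k`. -/
def IsCanonicalModule (R : Type u) [CommRing R] [IsLocalRing R]
    (ω : Type u) [AddCommGroup ω] [Module R ω] : Prop :=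
  Module.Finite R ω ∧ ∃ d : ℕ, (d : WithBot ℕ∞) = ringKrullDim R ∧
    (∀ i : ℕ, i ≠ d → Subsingleton (extGroup R i (ResidueField R) ω)) ∧
    Nonempty (extGroup R d (ResidueField R) ω ≃ₗ[R] ResidueField R)

/-- A homomorphism of `Λ`-modules factors through a projective `Λ`-module. -/
def FactorsThroughProjective (Λ : Type u) [Ring Λ] {M N : Type u}
    [AddCommGroup M] [Module Λ M] [AddCommGroup N] [Module Λ N] (f : M →ₗ[Λ] N) : Prop :=
  ∃ (P : Type u) (_ : AddCommGroup P) (_ : Module Λ P), Module.Projective Λ P ∧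
    ∃ (g : M →ₗ[Λ] P) (h : P →ₗ[Λ] N), h.comp g = f

section StableHom

variable (R : Type u) [CommRing R] (Λ : Type u) [Ring Λ] [Algebra R Λ]
variable (M N : Type u) [AddCommGroup M] [Module Λ M]
  [AddCommGroup N] [Module Λ N] [Module R N] [IsScalarTower R Λ N]

/-- The `R`-submodule of `Hom_Λ(M, N)` consisting of the homomorphisms that
factor through a projective `Λ`-module. -/
def projTrivial : Submodule R (M →ₗ[Λ] N) where
  carrier := {f | FactorsThroughProjective Λ f}
  zero_mem' := ⟨Λ, inferInstance, inferInstance, inferInstance, 0, 0, by ext; simp⟩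
  add_mem' := by
    rintro f₁ f₂ ⟨P₁, _, _, hP₁, g₁, h₁, rfl⟩ ⟨P₂, _, _, hP₂, g₂, h₂, rfl⟩
    exact ⟨P₁ × P₂, inferInstance, inferInstance, inferInstance,
      g₁.prod g₂, h₁.comp (LinearMap.fst Λ P₁ P₂) + h₂.comp (LinearMap.snd Λ P₁ P₂),
      by ext m; simp⟩
  smul_mem' := by
    rintro r f ⟨P, _, _, hP, g, h, rfl⟩
    exact ⟨P, inferInstance, inferInstance, hP, g, r • h, by ext m; simp⟩

/-- The stable Hom `Hom-bar_Λ(M, N)`: homomorphisms modulo those factoring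
through projectives, as an `R`-module. -/
def stableHom : Type u := (M →ₗ[Λ] N) ⧸ projTrivial R Λ M N

instance : AddCommGroup (stableHom R Λ M N) :=
  inferInstanceAs (AddCommGroup ((M →ₗ[Λ] N) ⧸ projTrivial R Λ M N))

instance : Module R (stableHom R Λ M N) :=
  inferInstanceAs (Module R ((M →ₗ[Λ] N) ⧸ projTrivial R Λ M N))

end StableHom

/-- The `h`-length of `M` (relative to a fixed module `G`): the length over `R`
of `h(M) = Hom-bar_Λ(M, M ⊕ G)`. -/
def hLength (R : Type u) [CommRing R] (Λ : Type u) [Ring Λ] [Algebra R Λ]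
    (M : Type u) [AddCommGroup M] [Module Λ M] [Module R M] [IsScalarTower R Λ M]
    (G : Type u) [AddCommGroup G] [Module Λ G] [Module R G] [IsScalarTower R Λ G] :
    WithBot ℕ∞ :=
  moduleLength R (stableHom R Λ M (M × G))

/-- A module is indecomposable if it is nonzero and admits no nontrivial direct
sum decomposition. -/
def IsIndecomposable (Λ : Type u) [Ring Λ] (M : Type u) [AddCommGroup M] [Module Λ M] : Prop :=
  Nontrivial M ∧ ∀ A B : Submodule Λ M, IsCompl A B → A = ⊥ ∨ B = ⊥

/-- `Ext¹_Λ(M, Y) = 0`, expressed by the splitting of extensions: every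
surjection onto `M` with kernel isomorphic to `Y` splits. -/
def Ext1Vanishes (Λ : Type u) [Ring Λ] (M Y : Type u)
    [AddCommGroup M] [Module Λ M] [AddCommGroup Y] [Module Λ Y] : Prop :=
  ∀ (E : Type u) (_ : AddCommGroup E) (_ : Module Λ E) (g : E →ₗ[Λ] M),
    Function.Surjective g → Nonempty ((LinearMap.ker g) ≃ₗ[Λ] Y) →
      ∃ s : M →ₗ[Λ] E, g.comp s = LinearMap.id

/-- A homomorphism `f : X → C` is right minimal if every endomorphism `g` of `X`
with `f ∘ g = f` is an isomorphism. -/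
def RightMinimal (Λ : Type u) [Ring Λ] {X C : Type u} [AddCommGroup X] [Module Λ X]
    [AddCommGroup C] [Module Λ C] (f : X →ₗ[Λ] C) : Prop :=
  ∀ g : X →ₗ[Λ] X, f.comp g = f → Function.Bijective g

/-- `M` is an `R`-lattice over the commutative local ring `R`: a finitely
generated maximal Cohen-Macaulay module that is free on the punctured
spectrum of `R`. -/
def IsLatticeC (R : Type u) [CommRing R] [IsLocalRing R]
    (M : Type u) [AddCommGroup M] [Module R M] : Prop :=
  Module.Finite R M ∧ IsMCM R M ∧
    ∀ (p : Ideal R) [p.IsPrime], p ≠ maximalIdeal R →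
      Module.Free (Localization.AtPrime p) (LocalizedModule p.primeCompl M)

/-- The `h`-length of an `R`-module `M` (relative to `G`): the length over `R`
of `Hom-bar_R(M, M ⊕ G)`. -/
def hLengthC (R : Type u) [CommRing R] (M : Type u) [AddCommGroup M] [Module R M]
    (G : Type u) [AddCommGroup G] [Module R G] : WithBot ℕ∞ :=
  hLength R R M G

/-- `Y` is a lat-injective `R`-module: a lattice with `Ext¹_R(M, Y) = 0` for
every `R`-lattice `M`. -/
def IsLatInjectiveC (R : Type u) [CommRing R] [IsLocalRing R]
    (Y : Type u) [AddCommGroup Y] [Module R Y] : Prop :=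
  IsLatticeC R Y ∧ ∀ (M : Type u) (_ : AddCommGroup M) (_ : Module R M),
    IsLatticeC R M → Ext1Vanishes R M Y

/-- `Y` admits a finite resolution `0 → L_t → ⋯ → L_0 → Y → 0` by lat-injective
`R`-modules. -/
def HasLatInjResOfLengthC (R : Type u) [CommRing R] [IsLocalRing R] :
    ℕ → ∀ (Y : Type u) [AddCommGroup Y] [Module R Y], Prop
  | 0, Y, _, _ => IsLatInjectiveC R Y
  | (t + 1), Y, _, _ =>
      ∃ (L : Type u) (_ : AddCommGroup L) (_ : Module R L) (π : L →ₗ[R] Y),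
        IsLatInjectiveC R L ∧ Function.Surjective π ∧
          HasLatInjResOfLengthC R t (LinearMap.ker π)

/-- `α : X → C` is a minimal lat-approximation of the `R`-module `C`. -/
def IsMinimalLatApproxC (R : Type u) [CommRing R] [IsLocalRing R]
    {X : Type u} [AddCommGroup X] [Module R X]
    {C : Type u} [AddCommGroup C] [Module R C] (α : X →ₗ[R] C) : Prop :=
  IsLatticeC R X ∧ Function.Surjective α ∧
    (∃ t : ℕ, HasLatInjResOfLengthC R t (LinearMap.ker α)) ∧ RightMinimal R α

/-- `α : G → k` is a minimal lat-approximation of the residue field of `R`. -/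
def IsResidueApprox (R : Type u) [CommRing R] [IsLocalRing R]
    (G : Type u) [AddCommGroup G] [Module R G] (α : G →ₗ[R] ResidueField R) : Prop :=
  IsMinimalLatApproxC R α

/-- There are infinitely many pairwise non-isomorphic indecomposable
`R`-lattices of `h`-length `t`. -/
def InfManyIndecLatticesOfHLengthC (R : Type u) [CommRing R] [IsLocalRing R]
    (G : Type u) [AddCommGroup G] [Module R G] (t : ℕ) : Prop :=
  ∃ (F : ℕ → Type u) (_ : ∀ n, AddCommGroup (F n)) (_ : ∀ n, Module R (F n)),
    (∀ n, IsLatticeC R (F n) ∧ IsIndecomposable R (F n) ∧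
      hLengthC R (F n) G = (t : WithBot ℕ∞)) ∧
    ∀ m n : ℕ, m ≠ n → IsEmpty (F m ≃ₗ[R] F n)

/-- `R` has strongly unbounded lattice type. -/
def StronglyUnboundedLatTypeC (R : Type u) [CommRing R] [IsLocalRing R]
    (G : Type u) [AddCommGroup G] [Module R G] : Prop :=
  ∃ b : ℕ → ℕ, StrictMono b ∧ ∀ i, InfManyIndecLatticesOfHLengthC R G (b i)

/-- `R` is of finite lattice type: there are only finitely many isomorphism
classes of indecomposable `R`-lattices. -/
def FiniteLatTypeC (R : Type u) [CommRing R] [IsLocalRing R] : Prop :=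
  ∃ (n : ℕ) (F : Fin n → Type u) (_ : ∀ i, AddCommGroup (F i)) (_ : ∀ i, Module R (F i)),
    ∀ (M : Type u) (_ : AddCommGroup M) (_ : Module R M),
      IsLatticeC R M → IsIndecomposable R M → ∃ i, Nonempty (M ≃ₗ[R] F i)

/-- `R` is of bounded lattice type: there is `b > 0` with `ℓ(h(M)) < b` for
every indecomposable `R`-lattice `M`. -/
def BoundedLatTypeC (R : Type u) [CommRing R] [IsLocalRing R]
    (G : Type u) [AddCommGroup G] [Module R G] : Prop :=
  ∃ b : ℕ, 0 < b ∧ ∀ (M : Type u) (_ : AddCommGroup M) (_ : Module R M),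
    IsLatticeC R M → IsIndecomposable R M → hLengthC R M G < (b : WithBot ℕ∞)

/-- The local ring `R` has Hilbert–Samuel multiplicity `e` (with respect to its
maximal ideal): `d! ⬝ ℓ(R/𝔪ⁿ)/nᵈ → e` as `n → ∞`, where `d = dim R`. -/
def HasMultiplicity (R : Type u) [CommRing R] [IsLocalRing R] (e : ℕ) : Prop :=
  ∃ d : ℕ, (d : WithBot ℕ∞) = ringKrullDim R ∧
    ∃ len : ℕ → ℕ,
      (∀ n, (len n : WithBot ℕ∞) = moduleLength R (R ⧸ (maximalIdeal R ^ n))) ∧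
      Filter.Tendsto (fun n : ℕ => (d.factorial * len n : ℝ) / (n : ℝ) ^ d)
        Filter.atTop (nhds (e : ℝ))

/-- `N` is an `i`-th syzygy module of `C` in a minimal free resolution over the
local ring `R`. -/
def IsMinimalSyzygyOf (R : Type u) [CommRing R] [IsLocalRing R] :
    ℕ → ∀ (N : Type u) [AddCommGroup N] [Module R N]
      (C : Type u) [AddCommGroup C] [Module R C], Prop
  | 0, N, _, _, C, _, _ => Nonempty (N ≃ₗ[R] C)
  | (i + 1), N, _, _, C, _, _ =>
      ∃ (K : Type u) (_ : AddCommGroup K) (_ : Module R K), IsMinimalSyzygyOf R i K C ∧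
        ∃ (n : ℕ) (π : (Fin n → R) →ₗ[R] K), Function.Surjective π ∧
          (LinearMap.ker π ≤ (maximalIdeal R) • (⊤ : Submodule R (Fin n → R))) ∧
          Nonempty (N ≃ₗ[R] LinearMap.ker π)

/-! ### Quasi-regularity of regular sequences -/

section QuasiRegular

open MvPolynomial

variable {S : Type*} [CommRing S]

/-- Elements of `I ^ (j + 1)` are values of forms of degree `j` with coefficients in `I`. -/
lemma exists_form_of_mem_pow_succ {n : ℕ} (x : Fin n → S) (j : ℕ) {z : S}
    (hz : z ∈ Ideal.span (Set.range x) ^ (j + 1)) :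
    ∃ B : MvPolynomial (Fin n) S, B.IsHomogeneous j ∧
      (∀ a, coeff a B ∈ Ideal.span (Set.range x)) ∧ eval x B = z := by
  rw [pow_succ'] at hz
  induction hz using Submodule.mul_induction_on' with
  | mem_mul_mem a ha b hb =>
    obtain ⟨B, hB, rfl⟩ := (Ideal.mem_span_pow_iff_exists_isHomogeneous x b).1 hb
    refine ⟨C a * B, by simpa using (isHomogeneous_C (Fin n) a).mul hB, fun m => ?_, by simp⟩
    rw [coeff_C_mul]
    exact Ideal.mul_mem_right _ _ ha
  | add a _ b _ h1 h2 =>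
    obtain ⟨A, hA, hA', rfl⟩ := h1
    obtain ⟨B, hB, hB', rfl⟩ := h2
    exact ⟨A + B, hA.add hB, fun m => by rw [coeff_add]; exact add_mem (hA' m) (hB' m), by simp⟩

lemma eval_mem_of_coeff_mem {n : ℕ} (x : Fin n → S) {j : ℕ} {F : MvPolynomial (Fin n) S}
    (hF : F.IsHomogeneous j) {J : Ideal S} (h : ∀ a, coeff a F ∈ J) :
    eval x F ∈ J * Ideal.span (Set.range x) ^ j := by
  rw [F.as_sum, map_sum]
  refine sum_mem fun a ha => ?_
  rw [← mul_one (coeff a F), ← C_mul_monomial, map_mul, eval_C]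
  refine Ideal.mul_mem_mul (h a) ((Ideal.mem_span_pow_iff_exists_isHomogeneous x _).2
    ⟨_, isHomogeneous_monomial 1 ?_, rfl⟩)
  have := hF (mem_support_iff.1 ha)
  rwa [Finsupp.degree_eq_weight_one]

/-- A finite sequence is quasi-regular if every form vanishing on it has coefficients in the
ideal it generates. -/
def QuasiReg {n : ℕ} (x : Fin n → S) : Prop :=
  ∀ (j : ℕ) (F : MvPolynomial (Fin n) S), F.IsHomogeneous j → eval x F = 0 →
    ∀ a, coeff a F ∈ Ideal.span (Set.range x)

lemma coeff_mem_of_eval_mem {n : ℕ} {x : Fin n → S} {j : ℕ}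
    (hx : ∀ F : MvPolynomial (Fin n) S, F.IsHomogeneous j → eval x F = 0 →
      ∀ a, coeff a F ∈ Ideal.span (Set.range x))
    {F : MvPolynomial (Fin n) S} (hF : F.IsHomogeneous j)
    (h : eval x F ∈ Ideal.span (Set.range x) ^ (j + 1)) (a) :
    coeff a F ∈ Ideal.span (Set.range x) := by
  obtain ⟨B, hB, hB', hBe⟩ := exists_form_of_mem_pow_succ x j h
  have := hx (F - B) (hF.sub hB) (by simp [hBe]) a
  rw [coeff_sub] at this
  simpa using add_mem this (hB' a)

lemma QuasiReg.mem_pow_of_mul_mem {n : ℕ} {x : Fin n → S} (hx : QuasiReg x) {y : S}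
    (hy : ∀ a, y * a ∈ Ideal.span (Set.range x) → a ∈ Ideal.span (Set.range x)) (j : ℕ) {a : S}
    (h : y * a ∈ Ideal.span (Set.range x) ^ j) : a ∈ Ideal.span (Set.range x) ^ j := by
  induction j generalizing a with
  | zero => simp
  | succ j ih =>
    obtain ⟨A, hA, rfl⟩ := (Ideal.mem_span_pow_iff_exists_isHomogeneous x a).1
      (ih (Ideal.pow_le_pow_right (Nat.le_succ j) h))
    rw [pow_succ']
    refine eval_mem_of_coeff_mem x hA fun m => hy _ ?_
    rw [← coeff_C_mul]
    refine coeff_mem_of_eval_mem (hx j) (by simpa using (isHomogeneous_C (Fin n) y).mul hA) ?_ m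
    simpa using h

lemma map_mk_eq_zero_iff {σ : Type*} (I : Ideal S) (F : MvPolynomial σ S) :
    map (Ideal.Quotient.mk I) F = 0 ↔ ∀ a, coeff a F ∈ I := by
  simp [MvPolynomial.ext_iff, coeff_map, Ideal.Quotient.eq_zero_iff_mem]

lemma exists_rename_succ_add_X_zero_mul {n j : ℕ} {F : MvPolynomial (Fin (n + 1)) S}
    (hF : F.IsHomogeneous (j + 1)) :
    ∃ (G : MvPolynomial (Fin n) S) (H : MvPolynomial (Fin (n + 1)) S),
      G.IsHomogeneous (j + 1) ∧ H.IsHomogeneous j ∧ F = rename Fin.succ G + X 0 * H := by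
  set p := finSuccEquiv S n F with hp
  have hG : (p.coeff 0).IsHomogeneous (j + 1) :=
    hF.finSuccEquiv_coeff_isHomogeneous 0 (j + 1) (by omega)
  have hren : ∀ G : MvPolynomial (Fin n) S,
      finSuccEquiv S n (rename Fin.succ G) = Polynomial.C G := by
    intro G
    induction G using MvPolynomial.induction_on with
    | C a => simp [finSuccEquiv_apply]
    | add p q hp hq => simp [hp, hq]
    | mul_X p i hp => rw [map_mul, map_mul, hp, rename_X, finSuccEquiv_X_succ, map_mul]
  have heq : F = rename Fin.succ (p.coeff 0) + X 0 * (finSuccEquiv S n).symm p.divX := by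
    apply (finSuccEquiv S n).injective
    rw [map_add, map_mul, hren, finSuccEquiv_X_zero, AlgEquiv.apply_symm_apply, ← hp, add_comm,
      mul_comm, Polynomial.divX_mul_X_add]
  refine ⟨_, _, hG, fun a ha => ?_, heq⟩
  have h1 : (X 0 * (finSuccEquiv S n).symm p.divX).IsHomogeneous (j + 1) := by
    have := hF.sub (hG.rename_isHomogeneous (f := Fin.succ))
    nth_rw 1 [heq] at this
    simpa using this
  have := h1 (d := Finsupp.single 0 1 + a) (by rwa [coeff_X_mul])
  simp only [map_add, Finsupp.weight_single] at this
  simp at this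
  omega

/-- A sequence such that each entry is regular modulo the entries following it is
quasi-regular. -/
lemma quasiReg_of_regular {n : ℕ} (x : Fin n → S)
    (hx : ∀ i a, x i * a ∈ Ideal.span (x '' Set.Ioi i) → a ∈ Ideal.span (x '' Set.Ioi i)) :
    QuasiReg x := by
  induction n with
  | zero =>
    intro j F hF h a
    rw [F.eq_C_of_isEmpty] at h ⊢
    simp only [eval_C] at h
    simp [h]
  | succ n ih =>
    have himg : ∀ i : Fin n, x '' Set.Ioi i.succ = (x ∘ Fin.succ) '' Set.Ioi i := by
      intro i
      rw [Set.image_comp, Fin.image_succ_Ioi]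
    have himg0 : x '' Set.Ioi 0 = Set.range (x ∘ Fin.succ) := by
      rw [Set.range_comp]; congr 1; ext i; simp [Fin.pos_iff_ne_zero]
    have hq : QuasiReg (x ∘ Fin.succ) := ih _ fun i a h => by
      rw [← himg] at h ⊢; exact hx _ _ h
    have hle : Ideal.span (Set.range (x ∘ Fin.succ)) ≤ Ideal.span (Set.range x) :=
      Ideal.span_mono (by rintro _ ⟨i, rfl⟩; exact ⟨_, rfl⟩)
    intro j
    induction j with
    | zero =>
      intro F hF h a
      obtain ⟨c, rfl⟩ : ∃ c, F = C c := 
        ⟨_, totalDegree_eq_zero_iff_eq_C.1 (Nat.le_zero.1 hF.totalDegree_le)⟩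
      simp only [eval_C] at h
      simp [h]
    | succ j ihj =>
      intro F hF h
      obtain ⟨G, H, hG, hH, rfl⟩ := exists_rename_succ_add_X_zero_mul hF
      simp only [map_add, map_mul, eval_X, eval_rename] at h
      have h1 : eval x H ∈ Ideal.span (Set.range (x ∘ Fin.succ)) ^ (j + 1) := by
        refine hq.mem_pow_of_mul_mem (y := x 0) (by rw [← himg0]; exact hx 0) _ ?_
        rw [eq_neg_of_add_eq_zero_right h]
        exact neg_mem ((Ideal.mem_span_pow_iff_exists_isHomogeneous _ _).2 ⟨G, hG, rfl⟩)
      have h2 := coeff_mem_of_eval_mem ihj hH (Ideal.pow_right_mono hle _ h1)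
      obtain ⟨h', hh', hhe⟩ := (Ideal.mem_span_pow_iff_exists_isHomogeneous _ _).1 h1
      have h3 := hq (j + 1) (G + C (x 0) * h')
        (hG.add (by simpa using (isHomogeneous_C (Fin n) (x 0)).mul hh')) (by simp [hhe, h])
      rw [← map_mk_eq_zero_iff, map_add, map_mul, map_rename, map_X, (map_mk_eq_zero_iff _ H).2 h2,
        mul_zero, add_zero, (map_mk_eq_zero_iff _ G).2, map_zero]
      intro a
      have h4 := hle (h3 a)
      rw [coeff_add, coeff_C_mul] at h4
      exact (Ideal.add_mem_iff_left _ (Ideal.mul_mem_right _ _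
        (Ideal.subset_span (Set.mem_range_self 0)))).1 h4

end QuasiRegular

/-! ### Regular local rings -/

section RegSys

/-- A regular system of parameters of a (regular) local ring. -/
structure IsRegSys {S : Type*} [CommRing S] [IsLocalRing S] {n : ℕ} (x : Fin n → S) : Prop where
  span_eq : Ideal.span (Set.range x) = maximalIdeal S
  dim_eq : ringKrullDim S = n

variable {S : Type*} [CommRing S] [IsLocalRing S]

lemma isLocalRing_quotient {I : Ideal S} (hI : I ≤ maximalIdeal S) : IsLocalRing (S ⧸ I) := by
  have : Nontrivial (S ⧸ I) := Ideal.Quotient.nontrivial_iff.2 fun h =>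
    (maximalIdeal.isMaximal S).ne_top (top_le_iff.1 (h ▸ hI))
  exact IsLocalRing.of_surjective' (Ideal.Quotient.mk I) Ideal.Quotient.mk_surjective

lemma IsRegSys.mem {n : ℕ} {x : Fin n → S} (hx : IsRegSys x) (i) : x i ∈ maximalIdeal S :=
  hx.span_eq ▸ Ideal.subset_span ⟨i, rfl⟩

lemma ringKrullDim_le_of_span_range [IsNoetherianRing S] {n : ℕ} (x : Fin n → S)
    (h : Ideal.span (Set.range x) = maximalIdeal S) : ringKrullDim S ≤ n := by
  refine (ringKrullDim_le_spanFinrank_maximalIdeal S).trans ?_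
  rw [← h]
  have h1 := Submodule.spanFinrank_span_le_ncard_of_finite (R := S) (Set.finite_range x)
  have h2 : (Set.range x).ncard ≤ n := by
    rw [← Set.image_univ]
    simpa using Set.ncard_image_le (f := x) (Set.finite_univ)
  exact_mod_cast h1.trans h2

lemma IsRegSys.quotient [IsNoetherianRing S] {n : ℕ} {x : Fin (n + 1) → S} (hx : IsRegSys x)
    [IsLocalRing (S ⧸ Ideal.span {x 0})] :
    IsRegSys (Ideal.Quotient.mk (Ideal.span {x 0}) ∘ x ∘ Fin.succ) := by
  have h1 : Ideal.span (Set.range (Ideal.Quotient.mk (Ideal.span {x 0}) ∘ x ∘ Fin.succ)) =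
      maximalIdeal (S ⧸ Ideal.span {x 0}) := by
    rw [← map_maximalIdeal_of_surjective _ Ideal.Quotient.mk_surjective, ← hx.span_eq,
      Ideal.map_span, Set.range_comp]
    apply le_antisymm
    · exact Ideal.span_mono (Set.image_mono (by rintro _ ⟨i, rfl⟩; exact ⟨_, rfl⟩))
    · rw [Ideal.span_le]
      rintro _ ⟨_, ⟨i, rfl⟩, rfl⟩
      refine Fin.cases ?_ (fun i => ?_) i
      · rw [Ideal.Quotient.eq_zero_iff_mem.2 (Ideal.mem_span_singleton_self _)]
        exact zero_mem _
      · exact Ideal.subset_span ⟨_, ⟨i, rfl⟩, rfl⟩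
  refine ⟨h1, le_antisymm (ringKrullDim_le_of_span_range _ h1) ?_⟩
  have := ringKrullDim_le_ringKrullDim_quotient_add_card (R := S) (s := {x 0})
    (by rw [IsLocalRing.ringJacobson_eq_maximalIdeal]; simpa using hx.mem 0)
  rw [hx.dim_eq] at this
  rw [show Ideal.span (↑({x 0} : Finset S) : Set S) = Ideal.span {x 0} by simp] at this
  simp only [Finset.card_singleton, Nat.cast_add, Nat.cast_one] at this
  exact ENat.WithBot.add_le_add_one_right_iff.1 this

lemma IsRegSys.exists_cons [IsNoetherianRing S] {n : ℕ} {x : Fin (n + 1) → S} (hx : IsRegSys x)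
    {y : S} (hy : y ∈ maximalIdeal S) (hy2 : y ∉ maximalIdeal S ^ 2) :
    ∃ x' : Fin n → S, IsRegSys (Fin.cons y x' : Fin (n + 1) → S) := by
  rw [← hx.span_eq] at hy
  obtain ⟨c, rfl⟩ := (Ideal.mem_span_range_iff_exists_fun).1 hy
  obtain ⟨i, hi⟩ : ∃ i, IsUnit (c i) := by
    by_contra! h
    refine hy2 (sum_mem fun i _ => ?_)
    rw [pow_two]
    exact Ideal.mul_mem_mul ((mem_maximalIdeal _).2 (h i)) (hx.mem i)
  refine ⟨x ∘ i.succAbove, ?_, hx.dim_eq⟩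
  rw [← hx.span_eq]
  apply le_antisymm <;> rw [Ideal.span_le]
  · rintro _ ⟨j, rfl⟩
    refine Fin.cases hy (fun j => ?_) j
    exact Ideal.subset_span ⟨_, rfl⟩
  · rintro _ ⟨j, rfl⟩
    obtain rfl | ⟨j, rfl⟩ := Fin.eq_self_or_eq_succAbove i j
    · refine (Ideal.unit_mul_mem_iff_mem _ hi).1 ?_
      set I := Ideal.span (Set.range (Fin.cons (∑ i, c i * x i) (x ∘ j.succAbove) : Fin (n+1) → S))
      have h0 : ∑ i, c i * x i ∈ I := Ideal.subset_span ⟨0, rfl⟩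
      rw [Fin.sum_univ_succAbove _ j] at h0
      refine (Ideal.add_mem_iff_left _ (sum_mem fun l _ => Ideal.mul_mem_left _ _ ?_)).1 h0
      exact Ideal.subset_span ⟨l.succ, rfl⟩
    · exact Ideal.subset_span ⟨j.succ, rfl⟩

end RegSys

lemma IsRegSys.isDomain {n : ℕ} : ∀ {S : Type u} [CommRing S] [IsLocalRing S] [IsNoetherianRing S]
    {x : Fin n → S}, IsRegSys x → IsDomain S := by
  induction n with
  | zero =>
    intro S _ _ _ x hx
    have := hx.span_eq
    simp only [Set.range_eq_empty, Ideal.span_empty] at this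
    exact (IsLocalRing.isField_iff_maximalIdeal_eq.2 this.symm).isDomain
  | succ n ih =>
    intro S _ _ _ x hx
    obtain ⟨y, hy, hy2, hyP⟩ : ∃ y ∈ maximalIdeal S, y ∉ maximalIdeal S ^ 2 ∧
        ∀ P ∈ minimalPrimes S, y ∉ P := by
      by_contra! h
      have hfin := minimalPrimes.finite_of_isNoetherianRing S
      have := (Ideal.subset_union_prime' (s := hfin.toFinset) (f := id)
        (a := maximalIdeal S ^ 2) (b := maximalIdeal S ^ 2) (I := maximalIdeal S)
        (fun P hP => (hfin.mem_toFinset.1 hP).1.1)).1 (by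
          intro y hy
          by_cases h2 : y ∈ maximalIdeal S ^ 2
          · exact Or.inl (Or.inl h2)
          · obtain ⟨P, hP, hyP⟩ := h y hy h2
            refine Or.inr (Set.mem_biUnion (x := P) (by simpa using hP) hyP))
      have hdim : (maximalIdeal S).height ≠ 0 := by
        intro h0
        have h1 := maximalIdeal_height_eq_ringKrullDim (R := S)
        rw [h0, hx.dim_eq] at h1
        have : (0 : WithBot ℕ∞) = ((n + 1 : ℕ) : WithBot ℕ∞) := h1
        norm_cast at this
      have h2 : ¬ maximalIdeal S ≤ maximalIdeal S ^ 2 := by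
        refine not_le_of_gt (maximalIdeal_sq_lt_of_ringKrullDim_ne_zero fun h0 => hdim ?_)
        rw [← maximalIdeal_height_eq_ringKrullDim] at h0
        exact_mod_cast h0
      obtain ⟨P, hP, hle⟩ := (this.resolve_left h2).resolve_left h2
      rw [hfin.mem_toFinset] at hP
      have hPp : P.IsPrime := hP.1.1
      have hPe : P = maximalIdeal S := le_antisymm (le_maximalIdeal hPp.ne_top) hle
      apply hdim
      rw [← hPe]
      exact Ideal.height_eq_zero_iff.2 hP
    obtain ⟨x', hx'⟩ := hx.exists_cons hy hy2
    have : IsLocalRing (S ⧸ Ideal.span {(Fin.cons y x' : Fin (n + 1) → S) 0}) :=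
      isLocalRing_quotient (by simpa [Ideal.span_le] using hy)
    have hd : IsDomain (S ⧸ Ideal.span {(Fin.cons y x' : Fin (n + 1) → S) 0}) := ih hx'.quotient
    rw [Fin.cons_zero] at hd
    have hp := (Ideal.Quotient.isDomain_iff_prime _).1 hd
    obtain ⟨P, hP, hle⟩ := Ideal.exists_minimalPrimes_le (I := ⊥) (J := Ideal.span {y}) bot_le
    have hPp : P.IsPrime := hP.1.1
    have : P = ⊥ := by
      refine Submodule.eq_bot_of_le_smul_of_le_jacobson_bot (Ideal.span {y}) P
        (IsNoetherian.noetherian P) (fun p hp' => ?_)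
        (by simpa [Ideal.span_le, jacobson_eq_maximalIdeal] using hy)
      obtain ⟨s, rfl⟩ := Ideal.mem_span_singleton'.1 (hle hp')
      rw [mul_comm, smul_eq_mul]
      exact Ideal.mul_mem_mul (Ideal.mem_span_singleton_self y)
        ((hPp.mem_or_mem hp').resolve_right (hyP P hP))
    subst this
    exact IsDomain.of_bot_isPrime S

lemma IsRegSys.rev {S : Type*} [CommRing S] [IsLocalRing S] {n : ℕ} {x : Fin n → S}
    (hx : IsRegSys x) : IsRegSys (x ∘ Fin.rev) :=
  ⟨by rw [Fin.rev_surjective.range_comp, hx.span_eq], hx.dim_eq⟩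

lemma IsRegSys.ne_zero {n : ℕ} {S : Type*} [CommRing S] [IsLocalRing S] [IsNoetherianRing S]
    {x : Fin (n + 1) → S} (hx : IsRegSys x) : x 0 ≠ 0 := by
  intro h0
  have : Ideal.span (Set.range (x ∘ Fin.succ)) = maximalIdeal S := by
    rw [← hx.span_eq]
    apply le_antisymm <;> rw [Ideal.span_le]
    · rintro _ ⟨j, rfl⟩
      exact Ideal.subset_span ⟨_, rfl⟩
    · rintro _ ⟨j, rfl⟩
      refine Fin.cases (by simp [h0]) (fun j => Ideal.subset_span ⟨j, rfl⟩) j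
  have := ringKrullDim_le_of_span_range _ this
  rw [hx.dim_eq] at this
  norm_cast at this
  omega

lemma IsRegSys.regular_iio {n : ℕ} : ∀ {S : Type u} [CommRing S] [IsLocalRing S]
    [IsNoetherianRing S] {x : Fin n → S}, IsRegSys x → ∀ i a,
      x i * a ∈ Ideal.span (x '' Set.Iio i) → a ∈ Ideal.span (x '' Set.Iio i) := by
  induction n with
  | zero => exact fun _ i => i.elim0
  | succ n ih =>
    intro S _ _ _ x hx i a
    have := hx.isDomain
    refine Fin.cases (fun h => ?_) (fun i h => ?_) i
    · have h0 : (Set.Iio (0 : Fin (n + 1))) = ∅ := by ext; simp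
      simp only [h0, Set.image_empty, Ideal.span_empty, Ideal.mem_bot] at h ⊢
      exact (mul_eq_zero.1 h).resolve_left hx.ne_zero
    · have : IsLocalRing (S ⧸ Ideal.span {x 0}) :=
        isLocalRing_quotient (by simpa [Ideal.span_le] using hx.mem 0)
      have key : Ideal.span (x '' Set.Iio i.succ) = Ideal.comap (Ideal.Quotient.mk (Ideal.span {x 0}))
          (Ideal.span ((Ideal.Quotient.mk (Ideal.span {x 0}) ∘ x ∘ Fin.succ) '' Set.Iio i)) := by
        rw [Set.image_comp, ← Ideal.map_span, Ideal.comap_map_of_surjective _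
          Ideal.Quotient.mk_surjective, ← RingHom.ker_eq_comap_bot, Ideal.mk_ker,
          ← Ideal.span_union]
        congr 1
        ext y
        simp only [Set.mem_image, Set.mem_Iio, Set.mem_union, Set.mem_singleton_iff]
        constructor
        · rintro ⟨j, hj, rfl⟩
          refine Fin.cases (fun _ => Or.inr rfl) (fun j hj => Or.inl ⟨j, ?_, rfl⟩) j hj
          simpa using hj
        · rintro (⟨j, hj, rfl⟩ | rfl)
          · exact ⟨j.succ, by simpa using hj, rfl⟩
          · exact ⟨0, by simp, rfl⟩
      rw [key] at h ⊢
      refine ih hx.quotient i _ ?_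
      simpa using h

theorem IsRegSys.quasiReg {n : ℕ} {S : Type u} [CommRing S] [IsLocalRing S]
    [IsNoetherianRing S] {x : Fin n → S} (hx : IsRegSys x) : QuasiReg x := by
  refine quasiReg_of_regular x fun i a h => ?_
  have key : x '' Set.Ioi i = (x ∘ Fin.rev) '' Set.Iio i.rev := by
    rw [Set.image_comp]
    congr 1
    ext j
    simp only [Set.mem_Ioi, Set.mem_image, Set.mem_Iio]
    constructor
    · exact fun h => ⟨j.rev, by simpa using h, by simp⟩
    · rintro ⟨j, hj, rfl⟩
      simpa [Fin.lt_rev_iff] using hj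
  rw [key] at h ⊢
  exact hx.rev.regular_iio i.rev a (by simpa using h)

/-! ### Clifford operators on exterior-algebra-valued families -/

section Clifford

variable {D : ℕ} {Z Z' : Type*} [AddCommGroup Z] [AddCommGroup Z']

/-- The sign of moving `l` past the elements of `I` below it. -/
def extSign (l : Fin D) (I : Finset (Fin D)) : ℤ := ∏ m ∈ I, if m < l then -1 else 1

/-- Contraction by the `l`-th basis vector on `Λ ⊗ Z`, with `Λ ⊗ Z` written as families indexed
by the subsets of the basis. -/
def contr (l : Fin D) : (Finset (Fin D) → Z) →+ (Finset (Fin D) → Z) where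
  toFun z I := if l ∈ I then 0 else extSign l I • z (insert l I)
  map_zero' := by ext; simp
  map_add' z w := by ext I; by_cases h : l ∈ I <;> simp [h]

/-- Exterior multiplication by the `l`-th basis vector. -/
def wedge (l : Fin D) : (Finset (Fin D) → Z) →+ (Finset (Fin D) → Z) where
  toFun z I := if l ∈ I then extSign l I • z (I.erase l) else 0
  map_zero' := by ext; simp
  map_add' z w := by ext I; by_cases h : l ∈ I <;> simp [h]

lemma contr_apply (l : Fin D) (z : Finset (Fin D) → Z) (I) :
    contr l z I = if l ∈ I then 0 else extSign l I • z (insert l I) := rfl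

lemma wedge_apply (l : Fin D) (z : Finset (Fin D) → Z) (I) :
    wedge l z I = if l ∈ I then extSign l I • z (I.erase l) else 0 := rfl

lemma contr_map (g : Z →+ Z') (l : Fin D) (z : Finset (Fin D) → Z) :
    contr l (g ∘ z) = g ∘ contr l z := by
  ext I; by_cases h : l ∈ I <;> simp [contr_apply, h]

lemma wedge_map (g : Z →+ Z') (l : Fin D) (z : Finset (Fin D) → Z) :
    wedge l (g ∘ z) = g ∘ wedge l z := by
  ext I; by_cases h : l ∈ I <;> simp [wedge_apply, h]

lemma contr_smul {A : Type*} [Monoid A] [DistribMulAction A Z] (c : A) (l : Fin D)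
    (z : Finset (Fin D) → Z) : contr l (c • z) = c • contr l z :=
  contr_map (DistribSMul.toAddMonoidHom Z c) l z

lemma wedge_smul {A : Type*} [Monoid A] [DistribMulAction A Z] (c : A) (l : Fin D)
    (z : Finset (Fin D) → Z) : wedge l (c • z) = c • wedge l z :=
  wedge_map (DistribSMul.toAddMonoidHom Z c) l z

lemma extSign_mul_self (l : Fin D) (I : Finset (Fin D)) : extSign l I * extSign l I = 1 := by
  rw [extSign, ← Finset.prod_mul_distrib]
  exact Finset.prod_eq_one fun m _ => by split_ifs <;> rfl

lemma extSign_insert {l m : Fin D} {I : Finset (Fin D)} (h : m ∉ I) :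
    extSign l (insert m I) = (if m < l then -1 else 1) * extSign l I :=
  Finset.prod_insert h

lemma extSign_erase {l m : Fin D} {I : Finset (Fin D)} (h : m ∈ I) :
    extSign l I = (if m < l then -1 else 1) * extSign l (I.erase m) :=
  (Finset.mul_prod_erase I _ h).symm

lemma contr_contr_self (l : Fin D) (z : Finset (Fin D) → Z) : contr l (contr l z) = 0 := by
  ext I; by_cases h : l ∈ I <;> simp [contr_apply, h]

lemma wedge_wedge_self (l : Fin D) (z : Finset (Fin D) → Z) : wedge l (wedge l z) = 0 := by
  ext I; by_cases h : l ∈ I <;> simp [wedge_apply, h]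

lemma sign_anti {l m : Fin D} (h : l ≠ m) :
    (if l < m then -1 else 1 : ℤ) = - (if m < l then -1 else 1) := by
  rcases lt_or_gt_of_ne h with h | h <;> simp [h, h.not_gt]

lemma contr_contr (l m : Fin D) (z : Finset (Fin D) → Z) :
    contr l (contr m z) = - contr m (contr l z) := by
  rcases eq_or_ne l m with rfl | hlm
  · simp [contr_contr_self]
  ext I
  by_cases hl : l ∈ I <;> by_cases hm : m ∈ I <;>
    simp only [contr_apply, hl, hm, if_true, if_false, Finset.mem_insert, hlm, hlm.symm, or_self,
      smul_zero, neg_zero, Pi.neg_apply, or_true]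
  rw [extSign_insert hl, extSign_insert hm, sign_anti hlm, smul_smul, smul_smul, Finset.insert_comm,
    ← neg_smul]
  congr 1; ring

lemma wedge_wedge (l m : Fin D) (z : Finset (Fin D) → Z) :
    wedge l (wedge m z) = - wedge m (wedge l z) := by
  rcases eq_or_ne l m with rfl | hlm
  · simp [wedge_wedge_self]
  ext I
  by_cases hl : l ∈ I <;> by_cases hm : m ∈ I <;>
    simp only [wedge_apply, hl, hm, if_true, if_false, Finset.mem_erase, hlm, hlm.symm, ne_eq,
      smul_zero, neg_zero, Pi.neg_apply, and_true, and_false, not_false_eq_true]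
  rw [extSign_erase (l := l) hm, extSign_erase (l := m) hl, sign_anti hlm, smul_smul, smul_smul,
    Finset.erase_right_comm, ← neg_smul]
  congr 1; ring

lemma contr_wedge {l m : Fin D} (hlm : l ≠ m) (z : Finset (Fin D) → Z) :
    contr l (wedge m z) = - wedge m (contr l z) := by
  ext I
  by_cases hl : l ∈ I <;> by_cases hm : m ∈ I <;>
    simp only [wedge_apply, contr_apply, hl, hm, if_true, if_false, Finset.mem_erase,
      Finset.mem_insert, hlm, hlm.symm, ne_eq, or_false, or_true,
      smul_zero, neg_zero, Pi.neg_apply, and_true, and_false, not_false_eq_true]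
  rw [extSign_insert hl, extSign_erase (l := l) hm, sign_anti hlm, smul_smul, smul_smul,
    Finset.erase_insert_of_ne hlm, ← neg_smul]
  congr 1; split_ifs <;> ring

lemma contr_wedge_self_apply (l : Fin D) (z : Finset (Fin D) → Z) (I) :
    contr l (wedge l z) I = if l ∈ I then 0 else z I := by
  by_cases hl : l ∈ I <;> simp [wedge_apply, contr_apply, hl, extSign_insert, smul_smul,
    extSign_mul_self]

lemma wedge_contr_self_apply (l : Fin D) (z : Finset (Fin D) → Z) (I) :
    wedge l (contr l z) I = if l ∈ I then z I else 0 := by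
  by_cases hl : l ∈ I
  · simp [wedge_apply, contr_apply, hl, smul_smul, extSign_erase hl,
      extSign_mul_self]
  · simp [wedge_apply, hl]

lemma contr_wedge_self (l : Fin D) (z : Finset (Fin D) → Z) :
    contr l (wedge l z) + wedge l (contr l z) = z := by
  ext I
  rw [Pi.add_apply, contr_wedge_self_apply, wedge_contr_self_apply]
  by_cases hl : l ∈ I <;> simp [hl]

lemma contr_mem {S : AddSubgroup Z} (l : Fin D) {z : Finset (Fin D) → Z} (h : ∀ I, z I ∈ S) (I) :
    contr l z I ∈ S := by
  rw [contr_apply]; split_ifs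
  · exact zero_mem _
  · exact S.zsmul_mem (h _) _

lemma wedge_mem {S : AddSubgroup Z} (l : Fin D) {z : Finset (Fin D) → Z} (h : ∀ I, z I ∈ S) (I) :
    wedge l z I ∈ S := by
  rw [wedge_apply]; split_ifs
  · exact S.zsmul_mem (h _) _
  · exact zero_mem _

end Clifford

/-! ### Acyclicity of the polynomial Koszul complexes -/

lemma extSign_smul_eq_zero {D : ℕ} {Z : Type*} [AddCommGroup Z] {l : Fin D}
    {I : Finset (Fin D)} {v : Z} (h : extSign l I • v = 0) : v = 0 := by
  rw [← one_smul ℤ v, ← extSign_mul_self l I, mul_smul, h, smul_zero]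

section Koszul

variable {D : ℕ} {R Z Z' : Type*} [CommRing R] [AddCommGroup Z] [AddCommGroup Z']
  [Module R Z] [Module R Z']

/-- The operator `∑ cₗ αₗ`. -/
def opSum (c : Fin D → R) (α : Fin D → ((Finset (Fin D) → Z) →+ (Finset (Fin D) → Z))) :
    (Finset (Fin D) → Z) →+ (Finset (Fin D) → Z) :=
  ∑ l, (DistribSMul.toAddMonoidHom _ (c l)).comp (α l)

lemma opSum_apply (c : Fin D → R) (α : Fin D → ((Finset (Fin D) → Z) →+ (Finset (Fin D) → Z)))
    (z) : opSum c α z = ∑ l, c l • α l z := by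
  simp [opSum, AddMonoidHom.finsetSum_apply]

lemma sum_antisymm {M : Type*} [AddCommGroup M] (t : Fin D → Fin D → M)
    (h : ∀ l m, t l m = - t m l) (h0 : ∀ l, t l l = 0) : ∑ l, ∑ m, t l m = 0 := by
  rw [← Finset.sum_product']
  refine Finset.sum_involution (fun a _ => a.swap) (fun a _ => ?_) (fun a _ ha hs => ha ?_)
    (fun a _ => by simp) (fun a _ => by simp)
  · simp [h a.1 a.2]
  · have : a.2 = a.1 := congrArg Prod.fst hs
    rw [this, h0]

lemma opSum_contr_smul (c : Fin D → R) (r : R) (z : Finset (Fin D) → Z) :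
    opSum c contr (r • z) = r • opSum c contr z := by
  simp only [opSum_apply, contr_smul, Finset.smul_sum, smul_comm r]

lemma opSum_wedge_smul (c : Fin D → R) (r : R) (z : Finset (Fin D) → Z) :
    opSum c wedge (r • z) = r • opSum c wedge z := by
  simp only [opSum_apply, wedge_smul, Finset.smul_sum, smul_comm r]

lemma opSum_contr_map (c : Fin D → R) (g : Z →ₗ[R] Z') (z : Finset (Fin D) → Z) :
    opSum c contr (g ∘ z) = g ∘ opSum c contr z := by
  have := fun l => contr_map g.toAddMonoidHom l z
  simp only [LinearMap.toAddMonoidHom_coe] at this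
  ext I
  simp [opSum_apply, this]

lemma opSum_wedge_map (c : Fin D → R) (g : Z →ₗ[R] Z') (z : Finset (Fin D) → Z) :
    opSum c wedge (g ∘ z) = g ∘ opSum c wedge z := by
  have := fun l => wedge_map g.toAddMonoidHom l z
  simp only [LinearMap.toAddMonoidHom_coe] at this
  ext I
  simp [opSum_apply, this]

lemma opSum_contr_opSum_contr (c : Fin D → R) (z : Finset (Fin D) → Z) :
    opSum c contr (opSum c contr z) = 0 := by
  simp only [opSum_apply, map_sum, contr_smul]
  refine sum_antisymm _ (fun l m => ?_) (fun l => by simp [contr_contr_self])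
  rw [contr_contr, smul_comm]; simp

lemma opSum_wedge_opSum_wedge (c : Fin D → R) (z : Finset (Fin D) → Z) :
    opSum c wedge (opSum c wedge z) = 0 := by
  simp only [opSum_apply, map_sum, wedge_smul]
  refine sum_antisymm _ (fun l m => ?_) (fun l => by simp [wedge_wedge_self])
  rw [wedge_wedge, smul_comm]; simp

lemma opSum_contr_wedge (c a : Fin D → R) (z : Finset (Fin D) → Z) :
    opSum c contr (opSum a wedge z) + opSum a wedge (opSum c contr z) = (∑ l, c l * a l) • z := by
  simp only [opSum_apply, map_sum, wedge_smul, contr_smul]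
  rw [Finset.sum_comm (f := fun m l => a l • c m • wedge l (contr m z)),
    ← Finset.sum_add_distrib, Finset.sum_smul]
  refine Finset.sum_congr rfl fun l _ => ?_
  rw [← Finset.sum_add_distrib, Finset.sum_eq_single l]
  · rw [smul_comm (a l), ← smul_add, ← smul_add, contr_wedge_self, smul_smul]
  · intro m _ hm
    rw [contr_wedge hm, smul_comm (a l)]; simp
  · simp

end Koszul

section Poly

open MvPolynomial

variable {D : ℕ} {k : Type*} [CommRing k]

/-- Division by the variable `Xₗ`. -/
def divX (l : Fin D) : MvPolynomial (Fin D) k →+ MvPolynomial (Fin D) k where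
  toFun p := p.divMonomial (Finsupp.single l 1)
  map_zero' := zero_divMonomial _
  map_add' p q := add_divMonomial p q _

lemma coeff_divX (l : Fin D) (p : MvPolynomial (Fin D) k) (s) :
    coeff s (divX l p) = coeff (Finsupp.single l 1 + s) p := coeff_divMonomial _ _ _

lemma divX_X_mul_self (l : Fin D) (p : MvPolynomial (Fin D) k) : divX l (X l * p) = p :=
  X_mul_divMonomial _ _

lemma divX_X_mul {l m : Fin D} (h : l ≠ m) (p : MvPolynomial (Fin D) k) :
    divX l (X m * p) = X m * divX l p := by
  ext s
  rw [coeff_divX, coeff_X_mul', coeff_X_mul', coeff_divX]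
  have h1 : (m ∈ (Finsupp.single l 1 + s).support) ↔ m ∈ s.support := by
    simp [h]
  simp only [h1]
  split_ifs with hm
  · congr 1
    rw [add_tsub_assoc_of_le]
    simpa [Nat.one_le_iff_ne_zero] using hm
  · rfl

lemma eq_C_of_divX_eq_zero {p : MvPolynomial (Fin D) k} (h : ∀ l, divX l p = 0) :
    p = C (coeff 0 p) := by
  ext s
  rw [coeff_C]
  split_ifs with hs
  · rw [hs]
  · obtain ⟨l, hl⟩ : ∃ l, s l ≠ 0 := by
      by_contra! h0
      exact hs (by ext l; simp [h0])
    have := coeff_divX l p (s - Finsupp.single l 1)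
    rw [h l, coeff_zero, add_tsub_cancel_of_le] at this
    · exact this.symm
    · simpa [Nat.one_le_iff_ne_zero] using hl

/-- Two families of operators on `Λ ⊗ k[X]` satisfying the Clifford relations used to contract
the complex with differential `∑ Xₗ αₗ`. -/
structure IsCliffordPair (α β : Fin D → ((Finset (Fin D) → MvPolynomial (Fin D) k) →+
    (Finset (Fin D) → MvPolynomial (Fin D) k))) : Prop where
  anti : ∀ l m z, α l (α m z) = - α m (α l z)
  sq : ∀ l z, α l (α l z) = 0
  mix : ∀ l m z, l ≠ m → α l (β m z) = - β m (α l z)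
  one : ∀ l z, α l (β l z) + β l (α l z) = z
  map_left : ∀ (g : MvPolynomial (Fin D) k →+ MvPolynomial (Fin D) k) l z,
    α l (g ∘ z) = g ∘ α l z
  map_right : ∀ (g : MvPolynomial (Fin D) k →+ MvPolynomial (Fin D) k) l z,
    β l (g ∘ z) = g ∘ β l z

lemma isCliffordPair_contr : IsCliffordPair (k := k) (D := D) contr wedge where
  anti := contr_contr
  sq := contr_contr_self
  mix _ _ z h := contr_wedge h z
  one := contr_wedge_self
  map_left := contr_map
  map_right := wedge_map

lemma isCliffordPair_wedge : IsCliffordPair (k := k) (D := D) wedge contr where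
  anti := wedge_wedge
  sq := wedge_wedge_self
  mix l m z h := by rw [contr_wedge h.symm, neg_neg]
  one l z := by rw [add_comm, contr_wedge_self]
  map_left := wedge_map
  map_right := contr_map

variable {α β : Fin D → ((Finset (Fin D) → MvPolynomial (Fin D) k) →+
    (Finset (Fin D) → MvPolynomial (Fin D) k))}

lemma IsCliffordPair.left_smul (h : IsCliffordPair α β) (c : MvPolynomial (Fin D) k) (l z) :
    α l (c • z) = c • α l z := h.map_left (DistribSMul.toAddMonoidHom _ c) l z

lemma IsCliffordPair.right_smul (h : IsCliffordPair α β) (c : MvPolynomial (Fin D) k) (l z) :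
    β l (c • z) = c • β l z := h.map_right (DistribSMul.toAddMonoidHom _ c) l z

lemma IsCliffordPair.opSum_sq (h : IsCliffordPair α β) (z) :
    opSum (X (R := k)) α (opSum (X (R := k)) α z) = 0 := by
  simp only [opSum_apply, map_sum, h.left_smul]
  refine sum_antisymm _ (fun l m => ?_) (fun l => by simp [h.sq])
  rw [h.anti, smul_comm]; simp

lemma divX_comp_X_smul_self (l : Fin D) (z : Finset (Fin D) → MvPolynomial (Fin D) k) :
    divX l ∘ ((X l : MvPolynomial (Fin D) k) • z) = z := by
  ext1 I; simp [divX_X_mul_self]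

lemma divX_comp_X_smul {l m : Fin D} (h : l ≠ m) (z : Finset (Fin D) → MvPolynomial (Fin D) k) :
    divX l ∘ ((X m : MvPolynomial (Fin D) k) • z) =
      (X m : MvPolynomial (Fin D) k) • (divX l ∘ z) := by
  ext1 I; simp [divX_X_mul h]

lemma IsCliffordPair.homotopy (h : IsCliffordPair α β) {z}
    (hz : opSum (X (R := k)) α z = 0) (l : Fin D) :
    z - opSum (X (R := k)) α (β l (divX l ∘ z)) =
      α l (β l (z - (X l : MvPolynomial (Fin D) k) • (divX l ∘ z))) := by
  have h1 : β l (divX l ∘ opSum (X (R := k)) α z) = 0 := by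
    rw [hz]
    have : divX l ∘ (0 : Finset (Fin D) → MvPolynomial (Fin D) k) = 0 := by ext1; simp
    rw [this, map_zero]
  have h2 : divX l ∘ opSum (X (R := k)) α z =
      ∑ m, divX l ∘ ((X m : MvPolynomial (Fin D) k) • α m z) := by
    ext1 I
    simp [opSum_apply]
  rw [h2, map_sum, ← Finset.add_sum_erase _ _ (Finset.mem_univ l), divX_comp_X_smul_self] at h1
  rw [opSum_apply, ← Finset.add_sum_erase _ _ (Finset.mem_univ l)]
  have h3 : ∑ m ∈ Finset.univ.erase l, (X m : MvPolynomial (Fin D) k) • α m (β l (divX l ∘ z)) =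
      - ∑ m ∈ Finset.univ.erase l, β l (divX l ∘ ((X m : MvPolynomial (Fin D) k) • α m z)) := by
    rw [← Finset.sum_neg_distrib]
    refine Finset.sum_congr rfl fun m hm => ?_
    have hm' := (Finset.ne_of_mem_erase hm)
    rw [h.mix _ _ _ hm', divX_comp_X_smul hm'.symm, h.right_smul, ← h.map_left, smul_neg]
  rw [h3, map_sub, map_sub, h.right_smul, h.left_smul, eq_neg_of_add_eq_zero_right h1, neg_neg]
  nth_rewrite 1 [← h.one l z]
  abel

lemma IsCliffordPair.exists_sub_opSum (h : IsCliffordPair α β) {z}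
    (hz : opSum (X (R := k)) α z = 0) :
    ∃ w, ∀ l, divX l ∘ (z - opSum (X (R := k)) α w) = 0 ∧ α l (z - opSum (X (R := k)) α w) = 0 := by
  suffices H : ∀ T : Finset (Fin D), ∃ w, ∀ l ∈ T, divX l ∘ (z - opSum (X (R := k)) α w) = 0 ∧
      α l (z - opSum (X (R := k)) α w) = 0 by
    obtain ⟨w, hw⟩ := H Finset.univ
    exact ⟨w, fun l => hw l (Finset.mem_univ l)⟩
  intro T
  induction T using Finset.induction_on with
  | empty => exact ⟨0, by simp⟩
  | insert m T hm ih =>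
    obtain ⟨w, hw⟩ := ih
    set z' := z - opSum (X (R := k)) α w with hz'
    have hz0 : opSum (X (R := k)) α z' = 0 := by rw [hz', map_sub, hz, h.opSum_sq, sub_zero]
    refine ⟨w + β m (divX m ∘ z'), fun l hl => ?_⟩
    have key : z - opSum (X (R := k)) α (w + β m (divX m ∘ z')) =
        α m (β m (z' - (X m : MvPolynomial (Fin D) k) • (divX m ∘ z'))) := by
      rw [← h.homotopy hz0, map_add, hz']; abel
    rw [key]
    rcases eq_or_ne l m with rfl | hlm
    · refine ⟨?_, h.sq _ _⟩
      rw [← h.map_left, ← h.map_right]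
      have : divX l ∘ (z' - (X l : MvPolynomial (Fin D) k) • (divX l ∘ z')) = 0 := by
        ext1 I
        simp [divX_X_mul_self]
      rw [this, map_zero, map_zero]
    · obtain ⟨h1, h2⟩ := hw l (Finset.mem_of_mem_insert_of_ne hl hlm)
      constructor
      · rw [← h.map_left, ← h.map_right]
        have : divX l ∘ (z' - (X m : MvPolynomial (Fin D) k) • (divX m ∘ z')) = 0 := by
          have h3 : ∀ I, divX l (z' I) = 0 := fun I => congrFun h1 I
          have h4 : ∀ I, divX l (divX m (z' I)) = 0 := fun I => by
            ext s
            have := congrArg (coeff (Finsupp.single m 1 + s)) (h3 I)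
            rw [coeff_divX] at this ⊢
            rw [coeff_divX, add_left_comm]
            exact this
          ext1 I
          simp [divX_X_mul hlm, h3, h4]
        rw [this, map_zero, map_zero]
      · rw [h.anti, h.mix _ _ _ hlm, map_sub, h.left_smul, h.map_left, h2]
        have : divX m ∘ (0 : Finset (Fin D) → MvPolynomial (Fin D) k) = 0 := by ext1; simp
        rw [this]; simp

/-- A cycle of the Koszul complex whose degree-zero component has no constant term is a
boundary. -/
theorem exists_contr_eq {z : Finset (Fin D) → MvPolynomial (Fin D) k}
    (hz : opSum (X (R := k)) contr z = 0) (h0 : coeff 0 (z ∅) = 0) :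
    ∃ w, z = opSum (X (R := k)) contr w := by
  obtain ⟨w, hw⟩ := isCliffordPair_contr.exists_sub_opSum hz
  refine ⟨w, sub_eq_zero.1 ?_⟩
  ext1 I
  rw [Pi.zero_apply]
  rcases I.eq_empty_or_nonempty with rfl | ⟨l, hl⟩
  · rw [eq_C_of_divX_eq_zero fun l => congrFun (hw l).1 ∅]
    simp [h0, opSum_apply, contr_apply, coeff_sum, coeff_X_mul']
  · have := congrFun (hw l).2 (I.erase l)
    simp only [contr_apply, Finset.mem_erase, ne_eq, not_true_eq_false, false_and, if_false,
      Finset.insert_erase hl, Pi.zero_apply] at this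
    exact extSign_smul_eq_zero this

/-- A cycle of the dual Koszul complex whose top component has no constant term is a
boundary. -/
theorem exists_wedge_eq {z : Finset (Fin D) → MvPolynomial (Fin D) k}
    (hz : opSum (X (R := k)) wedge z = 0) (h0 : coeff 0 (z Finset.univ) = 0) :
    ∃ w, z = opSum (X (R := k)) wedge w := by
  obtain ⟨w, hw⟩ := isCliffordPair_wedge.exists_sub_opSum hz
  refine ⟨w, sub_eq_zero.1 ?_⟩
  ext1 I
  rw [Pi.zero_apply]
  by_cases hI : I = Finset.univ
  · subst hI
    rw [eq_C_of_divX_eq_zero fun l => congrFun (hw l).1 Finset.univ]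
    simp [h0, opSum_apply, wedge_apply, coeff_sum, coeff_X_mul']
  · obtain ⟨l, hl⟩ : ∃ l, l ∉ I := by simpa [Finset.eq_univ_iff_forall] using hI
    have := congrFun (hw l).2 (insert l I)
    simp only [wedge_apply, Finset.mem_insert_self, if_true,
      Finset.erase_insert hl, Pi.zero_apply] at this
    exact extSign_smul_eq_zero this

end Poly

/-! ### Koszul complexes over a graded hypersurface ring -/

section GradedHypersurface

open MvPolynomial

lemma homogeneousComponent_mul_add {σ k : Type*} [CommRing k] {F : MvPolynomial σ k} {e : ℕ}
    (hF : F.IsHomogeneous e) (i : ℕ) (U : MvPolynomial σ k) :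
    homogeneousComponent (e + i) (F * U) = F * homogeneousComponent i U := by
  induction U using MvPolynomial.induction_on' with
  | monomial s a =>
    have h : (monomial s a).IsHomogeneous s.degree := isHomogeneous_monomial a rfl
    rw [homogeneousComponent_of_mem (hF.mul h), homogeneousComponent_of_mem h]
    by_cases hi : i = s.degree <;> simp [hi]
  | add p q hp hq => rw [mul_add, map_add, hp, hq, map_add, mul_add]

lemma homogeneousComponent_mul_of_lt {σ k : Type*} [CommRing k] {F : MvPolynomial σ k} {e : ℕ}
    (hF : F.IsHomogeneous e) {j : ℕ} (hj : j < e) (U : MvPolynomial σ k) :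
    homogeneousComponent j (F * U) = 0 := by
  induction U using MvPolynomial.induction_on' with
  | monomial s a =>
    have h : (monomial s a).IsHomogeneous s.degree := isHomogeneous_monomial a rfl
    rw [homogeneousComponent_of_mem (hF.mul h), if_neg (by omega)]
  | add p q hp hq => rw [mul_add, map_add, hp, hq, add_zero]

lemma coeff_zero_mul {σ k : Type*} [CommSemiring k] (p q : MvPolynomial σ k) :
    coeff 0 (p * q) = coeff 0 p * coeff 0 q := by
  simp only [← constantCoeff_eq, map_mul]

variable {D : ℕ} {k : Type*} [Field k]

/-- The graded hypersurface ring `k[X]/(F)`. -/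
abbrev QRing (F : MvPolynomial (Fin D) k) := MvPolynomial (Fin D) k ⧸ Ideal.span {F}

/-- The quotient map `k[X] → k[X]/(F)`. -/
def toQ (F : MvPolynomial (Fin D) k) : MvPolynomial (Fin D) k →ₗ[MvPolynomial (Fin D) k] QRing F :=
  Submodule.mkQ _

/-- The degree-`j` piece of `k[X]/(F)`. -/
def Qdeg (F : MvPolynomial (Fin D) k) (j : ℕ) : Submodule k (QRing F) :=
  (homogeneousSubmodule (Fin D) k j).map ((toQ F).restrictScalars k)

variable {F : MvPolynomial (Fin D) k} {e : ℕ}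

lemma toQ_one : toQ F 1 = 1 := rfl

lemma toQ_smul (p q : MvPolynomial (Fin D) k) : toQ F (p * q) = p • toQ F q := rfl

lemma toQ_surjective : Function.Surjective (toQ F) := Submodule.mkQ_surjective _

lemma smul_eq_toQ_mul (p : MvPolynomial (Fin D) k) (q : QRing F) : p • q = toQ F p * q := by
  obtain ⟨q, rfl⟩ := Submodule.mkQ_surjective _ q
  rfl

lemma toQ_eq_zero_iff {p : MvPolynomial (Fin D) k} : toQ F p = 0 ↔ F ∣ p := by
  rw [toQ, Submodule.mkQ_apply, Submodule.Quotient.mk_eq_zero, Ideal.mem_span_singleton]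

lemma mem_Qdeg {j : ℕ} {q : QRing F} : q ∈ Qdeg F j ↔ ∃ p, p.IsHomogeneous j ∧ toQ F p = q :=
  Iff.rfl

lemma toQ_mem_Qdeg {j : ℕ} {p : MvPolynomial (Fin D) k} (hp : p.IsHomogeneous j) :
    toQ F p ∈ Qdeg F j := ⟨p, hp, rfl⟩

lemma mul_mem_Qdeg {i j : ℕ} {p q : QRing F} (hp : p ∈ Qdeg F i) (hq : q ∈ Qdeg F j) :
    p * q ∈ Qdeg F (i + j) := by
  obtain ⟨p, hp, rfl⟩ := hp
  obtain ⟨q, hq, rfl⟩ := hq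
  exact ⟨p * q, hp.mul hq, rfl⟩

lemma X_smul_mem_Qdeg {j : ℕ} {q : QRing F} (hq : q ∈ Qdeg F j) (l : Fin D) :
    (X l : MvPolynomial (Fin D) k) • q ∈ Qdeg F (j + 1) := by
  rw [smul_eq_toQ_mul, add_comm]
  exact mul_mem_Qdeg (toQ_mem_Qdeg (isHomogeneous_X _ _)) hq

lemma dvd_of_dvd_homogeneousComponents (hF : F.IsHomogeneous e) {j : ℕ}
    {p : MvPolynomial (Fin D) k} (hp : p.IsHomogeneous j) (hd : F ∣ p) :
    p = 0 ∨ ∃ i q, j = e + i ∧ q.IsHomogeneous i ∧ p = F * q := by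
  obtain ⟨q, rfl⟩ := hd
  rcases lt_or_ge j e with hj | hj
  · left
    rw [← homogeneousComponent_eq_self hp, homogeneousComponent_mul_of_lt hF hj]
  · obtain ⟨i, rfl⟩ := Nat.exists_eq_add_of_le hj
    refine Or.inr ⟨i, homogeneousComponent i q, rfl, homogeneousComponent_isHomogeneous _ _, ?_⟩
    rw [← homogeneousComponent_mul_add hF, homogeneousComponent_eq_self hp]

lemma homogeneousComponent_opSum_contr (j : ℕ) (w : Finset (Fin D) → MvPolynomial (Fin D) k) :
    homogeneousComponent (j + 1) ∘ opSum (X (R := k)) contr w =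
      opSum (X (R := k)) contr (homogeneousComponent j ∘ w) := by
  have h := fun l => contr_map (homogeneousComponent (σ := Fin D) (R := k) j).toAddMonoidHom l w
  simp only [LinearMap.toAddMonoidHom_coe] at h
  ext1 I
  simp only [Function.comp_apply, opSum_apply, Finset.sum_apply, map_sum, Pi.smul_apply,
    smul_eq_mul, h]
  refine Finset.sum_congr rfl fun l _ => ?_
  rw [add_comm, homogeneousComponent_mul_add (isHomogeneous_X k l)]

theorem exists_contr_eq_of_le (he : e ≠ 0) (hF : F.IsHomogeneous e) (h0 : F ≠ 0) {j : ℕ}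
    (hj : e ≤ j + 1)
    {z : Finset (Fin D) → QRing F} (hz : ∀ I, z I ∈ Qdeg F (j + 1))
    (hd : opSum (X (R := k)) contr z = 0) :
    ∃ w, (∀ I, w I ∈ Qdeg F j) ∧ z = opSum (X (R := k)) contr w := by
  choose Z hZ hZz using fun I => mem_Qdeg.1 (hz I)
  have hzZ : z = toQ F ∘ Z := funext fun I => (hZz I).symm
  rw [hzZ, opSum_contr_map] at hd
  choose U hU using fun I => toQ_eq_zero_iff.1 (congrFun hd I)
  have hU' : opSum (X (R := k)) contr Z = F • U := funext hU
  have hdU : opSum (X (R := k)) contr U = 0 := by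
    have := opSum_contr_opSum_contr (X (R := k)) Z
    rw [hU', opSum_contr_smul] at this
    exact (smul_eq_zero.1 this).resolve_left h0
  have hU0 : coeff 0 (U ∅) = 0 := by
    have h1 := congrFun (homogeneousComponent_opSum_contr (j + 1) Z) ∅
    have h2 : homogeneousComponent (j + 1) ∘ Z = Z :=
      funext fun I => homogeneousComponent_eq_self (hZ I)
    obtain ⟨i, hi⟩ := Nat.exists_eq_add_of_le hj
    rw [h2, hU', hi] at h1
    simp only [Function.comp_apply, Pi.smul_apply, smul_eq_mul, add_assoc] at h1
    rw [homogeneousComponent_mul_add hF] at h1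
    rw [← mul_left_cancel₀ h0 h1]
    exact (homogeneousComponent_isHomogeneous _ _).coeff_eq_zero (by simp)
  obtain ⟨V, rfl⟩ := exists_contr_eq hdU hU0
  rw [← opSum_contr_smul, ← sub_eq_zero, ← map_sub] at hU'
  have hc : coeff 0 ((Z - F • V) ∅) = 0 := by
    have h1 : coeff 0 (Z ∅) = 0 := (hZ ∅).coeff_eq_zero (by simp)
    have h2 : coeff 0 F = 0 := hF.coeff_eq_zero (by simpa using Ne.symm he)
    simp [h1, h2, coeff_zero_mul]
  obtain ⟨W, hW⟩ := exists_contr_eq hU' hc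
  refine ⟨toQ F ∘ (homogeneousComponent j ∘ W),
    fun I => toQ_mem_Qdeg (homogeneousComponent_isHomogeneous _ _), ?_⟩
  rw [opSum_contr_map, ← homogeneousComponent_opSum_contr, ← hW, hzZ]
  ext1 I
  simp only [Function.comp_apply, Pi.sub_apply, map_sub, Pi.smul_apply, smul_eq_mul]
  rw [homogeneousComponent_eq_self (hZ I), eq_comm, sub_eq_self, toQ_eq_zero_iff]
  obtain ⟨i, hi⟩ := Nat.exists_eq_add_of_le hj
  rw [hi, homogeneousComponent_mul_add hF]
  exact dvd_mul_right _ _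

lemma exists_wedge_decomp (he : e ≠ 0) (hF : F.IsHomogeneous e) (h0 : F ≠ 0)
    {Z : Finset (Fin D) → MvPolynomial (Fin D) k}
    (hd : opSum (X (R := k)) wedge (toQ F ∘ Z) = 0)
    (hu : opSum (X (R := k)) wedge Z Finset.univ = 0) (hc : coeff 0 (Z Finset.univ) = 0) :
    ∃ V T, Z = F • V + opSum (X (R := k)) wedge T := by
  rw [opSum_wedge_map] at hd
  choose U hU using fun I => toQ_eq_zero_iff.1 (congrFun hd I)
  have hU' : opSum (X (R := k)) wedge Z = F • U := funext hU
  have hdU : opSum (X (R := k)) wedge U = 0 := by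
    have := opSum_wedge_opSum_wedge (X (R := k)) Z
    rw [hU', opSum_wedge_smul] at this
    exact (smul_eq_zero.1 this).resolve_left h0
  have hU0 : coeff 0 (U Finset.univ) = 0 := by
    rw [hU] at hu
    rw [(mul_eq_zero.1 hu).resolve_left h0, coeff_zero]
  obtain ⟨V, rfl⟩ := exists_wedge_eq hdU hU0
  rw [← opSum_wedge_smul, ← sub_eq_zero, ← map_sub] at hU'
  have hc' : coeff 0 ((Z - F • V) Finset.univ) = 0 := by
    have h2 : coeff 0 F = 0 := hF.coeff_eq_zero (by simpa using Ne.symm he)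
    simp [hc, h2, coeff_zero_mul]
  obtain ⟨T, hT⟩ := exists_wedge_eq hU' hc'
  exact ⟨V, T, by rw [← hT]; abel⟩

/-- Socle elements of a graded hypersurface in at least two variables vanish. -/
theorem eq_zero_of_forall_X_smul (hD : 2 ≤ D) (he : e ≠ 0) (hF : F.IsHomogeneous e) (h0 : F ≠ 0)
    {s : QRing F} (hs : ∀ l, (X l : MvPolynomial (Fin D) k) • s = 0) : s = 0 := by
  obtain ⟨p, rfl⟩ := toQ_surjective s
  have hun : (Finset.univ : Finset (Fin D)).card = D := by simp
  have hne : (Finset.univ : Finset (Fin D)) ≠ ∅ := fun h => by rw [h] at hun; simp at hun; omega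
  have hne' : ∀ l, (Finset.univ : Finset (Fin D)).erase l ≠ ∅ := fun l h => by
    have := Finset.card_erase_of_mem (Finset.mem_univ l)
    rw [h, hun] at this; simp at this; omega
  obtain ⟨V, T, h⟩ := exists_wedge_decomp he hF h0 (Z := Pi.single ∅ p) (by
      have : toQ F ∘ (Pi.single ∅ p : Finset (Fin D) → MvPolynomial (Fin D) k) =
          Pi.single ∅ (toQ F p) := by
        ext1 I; by_cases hI : I = ∅ <;> simp [hI]
      rw [this, opSum_apply]
      refine Finset.sum_eq_zero fun l _ => ?_
      rw [← wedge_smul, ← Pi.single_smul, hs, Pi.single_zero, map_zero])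
    (by simp [opSum_apply, wedge_apply, hne']) (by simp [hne])
  have := congrFun h ∅
  simp only [Pi.single_eq_same, opSum_apply, Pi.add_apply, Pi.smul_apply, Finset.sum_apply,
    wedge_apply, Finset.notMem_empty, if_false, smul_zero, Finset.sum_const_zero, add_zero] at this
  rw [this, toQ_eq_zero_iff]
  exact dvd_mul_right _ _

theorem exists_eq_X_smul (hD : 3 ≤ D) (he : e ≠ 0) (hF : F.IsHomogeneous e) (h0 : F ≠ 0)
    {j : ℕ} {w : Fin D → QRing F} (hw : ∀ l, w l ∈ Qdeg F (j + 1))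
    (hs : ∀ l m, (X m : MvPolynomial (Fin D) k) • w l = (X l : MvPolynomial (Fin D) k) • w m) :
    ∃ t ∈ Qdeg F j, ∀ l, w l = (X l : MvPolynomial (Fin D) k) • t := by
  choose W hW hWw using fun I => mem_Qdeg.1 (hw I)
  have hun : (Finset.univ : Finset (Fin D)).card = D := by simp
  set Z : Finset (Fin D) → MvPolynomial (Fin D) k := ∑ m, wedge m (Pi.single ∅ (W m)) with hZ
  have hZ0 : ∀ I : Finset (Fin D), 2 ≤ I.card → Z I = 0 := by
    intro I hI
    rw [hZ, Finset.sum_apply]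
    refine Finset.sum_eq_zero fun m _ => ?_
    rw [wedge_apply]
    split_ifs with hm
    · have : I.erase m ≠ ∅ := fun h => by
        have := Finset.card_erase_of_mem hm
        rw [h] at this; simp at this; omega
      simp [this]
    · rfl
  have hZ1 : ∀ l, Z {l} = W l := by
    intro l
    rw [hZ, Finset.sum_apply, Finset.sum_eq_single l]
    · simp [wedge_apply, extSign]
    · intro m _ hm
      simp [wedge_apply, hm]
    · simp
  obtain ⟨V, T, h⟩ := exists_wedge_decomp he hF h0 (Z := Z) (by
      have h1 : toQ F ∘ Z = ∑ m, wedge m (Pi.single ∅ (w m)) := by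
        have h2 : ∀ m, Pi.single ∅ (w m) =
            toQ F ∘ (Pi.single ∅ (W m) : Finset (Fin D) → MvPolynomial (Fin D) k) := by
          intro m; ext1 I; by_cases hI : I = ∅ <;> simp [hI, hWw]
        have h3 := fun m => wedge_map (toQ F).toAddMonoidHom m
          (Pi.single ∅ (W m) : Finset (Fin D) → MvPolynomial (Fin D) k)
        simp only [LinearMap.toAddMonoidHom_coe] at h3
        ext1 I
        simp only [h2, h3, hZ, Function.comp_apply, Finset.sum_apply, map_sum]
      rw [h1, opSum_apply]
      simp only [map_sum, Finset.smul_sum, ← wedge_smul, ← Pi.single_smul]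
      refine sum_antisymm _ (fun l m => ?_) (fun l => wedge_wedge_self _ _)
      rw [wedge_wedge, hs])
    (by
      simp only [opSum_apply, Finset.sum_apply, Pi.smul_apply, wedge_apply, Finset.mem_univ, if_true]
      refine Finset.sum_eq_zero fun l _ => ?_
      rw [hZ0, smul_zero, smul_zero]
      rw [Finset.card_erase_of_mem (Finset.mem_univ l), hun]; omega)
    (by rw [hZ0 _ (by omega), coeff_zero])
  refine ⟨toQ F (homogeneousComponent j (T ∅)),
    toQ_mem_Qdeg (homogeneousComponent_isHomogeneous _ _), fun l => ?_⟩
  have h1 := congrFun h {l}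
  rw [hZ1, opSum_apply] at h1
  simp only [Pi.add_apply, Pi.smul_apply, Finset.sum_apply, wedge_apply] at h1
  rw [Finset.sum_eq_single l (fun m _ hm => by simp [hm]) (by simp)] at h1
  simp only [Finset.mem_singleton, if_true, extSign, Finset.prod_singleton, lt_irrefl, if_false,
    one_smul, Finset.erase_singleton, smul_eq_mul] at h1
  have h2 := congrArg (homogeneousComponent (j + 1)) h1
  rw [homogeneousComponent_eq_self (hW l), map_add, add_comm j 1,
    homogeneousComponent_mul_add (isHomogeneous_X k l)] at h2
  rw [← hWw, h2, map_add, toQ_smul, add_eq_right, toQ_eq_zero_iff]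
  rcases lt_or_ge (1 + j) e with hj | hj
  · rw [homogeneousComponent_mul_of_lt hF hj]; exact dvd_zero _
  · obtain ⟨i, hi⟩ := Nat.exists_eq_add_of_le hj
    rw [hi, homogeneousComponent_mul_add hF]
    exact dvd_mul_right _ _

end GradedHypersurface

/-! ### Endomorphisms of the graded Koszul cycles -/

section GradedCore

open MvPolynomial

variable {D : ℕ} {k : Type*} [Field k] {F : MvPolynomial (Fin D) k} {e : ℕ}

lemma exists_sum_X_smul {j : ℕ} {q : QRing F} (hq : q ∈ Qdeg F (j + 1)) :
    ∃ t : Fin D → QRing F, (∀ l, t l ∈ Qdeg F j) ∧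
      q = ∑ l, (X l : MvPolynomial (Fin D) k) • t l := by
  obtain ⟨p, hp, rfl⟩ := mem_Qdeg.1 hq
  have h0 : coeff 0 p = 0 := hp.coeff_eq_zero (by simp)
  have h1 : p ∈ Ideal.span (Set.range (X : Fin D → MvPolynomial (Fin D) k)) := by
    rw [← Set.image_univ, MvPolynomial.mem_ideal_span_X_image]
    intro m hm
    by_contra! h
    have : m = 0 := by ext l; simpa using h l
    subst this
    exact (mem_support_iff.1 hm) h0
  obtain ⟨c, hc⟩ := Ideal.mem_span_range_iff_exists_fun.1 h1
  refine ⟨fun l => toQ F (homogeneousComponent j (c l)),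
    fun l => toQ_mem_Qdeg (homogeneousComponent_isHomogeneous _ _), ?_⟩
  have h2 := congrArg (homogeneousComponent (j + 1)) hc
  rw [homogeneousComponent_eq_self hp, map_sum] at h2
  rw [← h2, map_sum]
  refine Finset.sum_congr rfl fun l _ => ?_
  rw [mul_comm, add_comm, homogeneousComponent_mul_add (isHomogeneous_X k l), toQ_smul]

lemma mem_Qdeg_zero {q : QRing F} (hq : q ∈ Qdeg F 0) : ∃ c : k, q = c • (1 : QRing F) := by
  obtain ⟨p, hp, rfl⟩ := mem_Qdeg.1 hq
  refine ⟨coeff 0 p, ?_⟩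
  have : p = C (coeff 0 p) := by
    rw [← homogeneousComponent_zero, homogeneousComponent_eq_self hp]
  conv_lhs => rw [this, ← mul_one (C _), toQ_smul]
  rw [C_eq_smul_one, smul_assoc, one_smul, toQ_one]

/-- A linear endomorphism of a graded piece preserving linear relations over the variables is a
scalar. -/
theorem exists_scalar (hD : 3 ≤ D) (he : e ≠ 0) (hF : F.IsHomogeneous e) (h0 : F ≠ 0) :
    ∀ (j : ℕ) (g : QRing F → QRing F), (∀ q ∈ Qdeg F j, g q ∈ Qdeg F j) →
      (∀ q ∈ Qdeg F j, ∀ q' ∈ Qdeg F j, g (q + q') = g q + g q') →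
      (∀ (c : k), ∀ q ∈ Qdeg F j, g (c • q) = c • g q) →
      (∀ v : Fin D → QRing F, (∀ l, v l ∈ Qdeg F j) →
        ∑ l, (X l : MvPolynomial (Fin D) k) • v l = 0 →
        ∑ l, (X l : MvPolynomial (Fin D) k) • g (v l) = 0) →
      ∃ c : k, ∀ q ∈ Qdeg F j, g q = c • q := by
  intro j
  induction j with
  | zero =>
    intro g hg _ hsmul _
    have h1 : (1 : QRing F) ∈ Qdeg F 0 := toQ_mem_Qdeg (isHomogeneous_one _ _)
    obtain ⟨c, hc⟩ := mem_Qdeg_zero (hg 1 h1)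
    refine ⟨c, fun q hq => ?_⟩
    obtain ⟨a, rfl⟩ := mem_Qdeg_zero hq
    rw [hsmul a 1 h1, hc, smul_comm]
  | succ j ih =>
    intro g hg hadd hsmul hrel
    have hzero : g 0 = 0 := by
      have := hadd 0 (zero_mem _) 0 (zero_mem _)
      simpa using this
    have hneg : ∀ q ∈ Qdeg F (j + 1), g (-q) = - g q := fun q hq => by
      simpa using hsmul (-1) q hq
    have hsum : ∀ v : Fin D → QRing F, (∀ l, v l ∈ Qdeg F (j + 1)) →
        g (∑ l, v l) = ∑ l, g (v l) := by
      intro v hv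
      have : ∀ T : Finset (Fin D), g (∑ l ∈ T, v l) = ∑ l ∈ T, g (v l) := by
        intro T
        induction T using Finset.induction_on with
        | empty => simpa using hzero
        | insert m T hm ih =>
          rw [Finset.sum_insert hm, Finset.sum_insert hm,
            hadd _ (hv m) _ (sum_mem fun l _ => hv l), ih]
      exact this _
    have hex : ∀ t : QRing F, ∃ s, t ∈ Qdeg F j → s ∈ Qdeg F j ∧
        ∀ l, g ((X l : MvPolynomial (Fin D) k) • t) = (X l : MvPolynomial (Fin D) k) • s := by
      intro t
      by_cases ht : t ∈ Qdeg F j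
      · obtain ⟨s, hs, h⟩ := exists_eq_X_smul hD he hF h0
          (w := fun l => g ((X l : MvPolynomial (Fin D) k) • t))
          (fun l => hg _ (X_smul_mem_Qdeg ht l)) (fun l m => by
            rcases eq_or_ne l m with rfl | hlm
            · rfl
            have hsub : ∀ y : Fin D → QRing F, (∀ i, i ≠ l → i ≠ m → y i = 0) →
                ∑ i, (X i : MvPolynomial (Fin D) k) • y i =
                  (X l : MvPolynomial (Fin D) k) • y l + (X m : MvPolynomial (Fin D) k) • y m := by
              intro y hy
              rw [← Finset.sum_subset (Finset.subset_univ {l, m}), Finset.sum_pair hlm]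
              intro i _ hi
              simp only [Finset.mem_insert, Finset.mem_singleton, not_or] at hi
              rw [hy i hi.1 hi.2, smul_zero]
            have := hrel (fun i => if i = m then (X l : MvPolynomial (Fin D) k) • t else
                if i = l then - ((X m : MvPolynomial (Fin D) k) • t) else 0) (fun i => by
                  split_ifs
                  · exact X_smul_mem_Qdeg ht l
                  · exact neg_mem (X_smul_mem_Qdeg ht m)
                  · exact zero_mem _)
                (by
                  rw [hsub _ (fun i h1 h2 => by simp [h1, h2])]
                  simp only [hlm, if_true, if_false, smul_neg]
                  rw [smul_comm]; abel)
            rw [hsub _ (fun i h1 h2 => by simp [h1, h2, hzero])] at this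
            simp only [hlm, if_true, if_false, hneg _ (X_smul_mem_Qdeg ht m), smul_neg] at this
            rw [neg_add_eq_zero] at this
            exact this.symm)
        exact ⟨s, fun _ => ⟨hs, h⟩⟩
      · exact ⟨0, fun h => absurd h ht⟩
    choose g' hg' using hex
    have huniq : ∀ {s s' : QRing F}, (∀ l, (X l : MvPolynomial (Fin D) k) • s =
        (X l : MvPolynomial (Fin D) k) • s') → s = s' := fun h =>
      sub_eq_zero.1 (eq_zero_of_forall_X_smul (by omega) he hF h0 fun l => by
        rw [smul_sub, h, sub_self])
    obtain ⟨c, hc⟩ := ih g' (fun q hq => (hg' q hq).1)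
      (fun q hq q' hq' => huniq fun l => by
        rw [← (hg' _ (add_mem hq hq')).2, smul_add, smul_add, ← (hg' q hq).2, ← (hg' q' hq').2,
          hadd _ (X_smul_mem_Qdeg hq l) _ (X_smul_mem_Qdeg hq' l)])
      (fun c q hq => huniq fun l => by
        rw [← (hg' _ (Submodule.smul_mem _ c hq)).2, smul_comm, smul_comm _ c, ← (hg' q hq).2,
          hsmul _ _ (X_smul_mem_Qdeg hq l)])
      (fun v hv hv0 => eq_zero_of_forall_X_smul (by omega) he hF h0 fun m => by
        rw [Finset.smul_sum]
        have := hrel (fun l => (X m : MvPolynomial (Fin D) k) • v l)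
          (fun l => X_smul_mem_Qdeg (hv l) m) (by
            simp only [smul_comm _ (X m : MvPolynomial (Fin D) k), ← Finset.smul_sum, hv0,
              smul_zero])
        simp only [(hg' _ (hv _)).2] at this
        rw [← this]
        exact Finset.sum_congr rfl fun l _ => smul_comm _ _ _)
    refine ⟨c, fun q hq => ?_⟩
    obtain ⟨t, ht, rfl⟩ := exists_sum_X_smul hq
    rw [hsum _ (fun l => X_smul_mem_Qdeg (ht l) l), Finset.smul_sum]
    refine Finset.sum_congr rfl fun l _ => ?_
    rw [(hg' _ (ht l)).2, hc _ (ht l), smul_comm]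

/-- The cycles of the Koszul complex with coefficients in degree `n`. -/
def Kbar (F : MvPolynomial (Fin D) k) (n : ℕ) : Set (Finset (Fin D) → QRing F) :=
  {Z | (∀ I, Z I ∈ Qdeg F n) ∧ opSum (X (R := k)) contr Z = 0}

lemma contr_eq_zero_iff {V : Type*} [AddCommGroup V] {Z : Finset (Fin D) → V} :
    (∀ l, contr l Z = 0) ↔ Z = Pi.single ∅ (Z ∅) := by
  constructor
  · intro h
    ext1 I
    rcases I.eq_empty_or_nonempty with rfl | ⟨l, hl⟩
    · simp
    · rw [Pi.single_eq_of_ne (Finset.ne_empty_of_mem hl)]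
      have := congrFun (h l) (I.erase l)
      simp only [contr_apply, Finset.mem_erase, ne_eq, not_true_eq_false, false_and, if_false,
        Finset.insert_erase hl, Pi.zero_apply] at this
      exact extSign_smul_eq_zero this
  · intro h l
    rw [h]
    ext1 I
    simp [contr_apply]

lemma contr_single {V : Type*} [AddCommGroup V] (m : Fin D) (v : V) :
    contr m (Pi.single ∅ v) = 0 :=
  contr_eq_zero_iff.2 (by rw [Pi.single_eq_same]) m

lemma wedge_contr_single {V : Type*} [AddCommGroup V] (l m : Fin D) (v : V) :
    wedge l (contr m (Pi.single ∅ v)) = 0 := by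
  rw [contr_single, map_zero]

lemma single_mem_Kbar {n : ℕ} {q : QRing F} (hq : q ∈ Qdeg F n) : Pi.single ∅ q ∈ Kbar F n := by
  refine ⟨fun I => ?_, ?_⟩
  · by_cases hI : I = ∅ <;> simp [hI, hq]
  · rw [opSum_apply]
    refine Finset.sum_eq_zero fun l _ => ?_
    rw [contr_single, smul_zero]

lemma sum_wedge_single_mem_Kbar {n : ℕ} {v : Fin D → QRing F} (hv : ∀ l, v l ∈ Qdeg F n)
    (h : ∑ l, (X l : MvPolynomial (Fin D) k) • v l = 0) :
    ∑ l, wedge l (Pi.single ∅ (v l)) ∈ Kbar F n := by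
  refine ⟨fun I => ?_, ?_⟩
  · rw [Finset.sum_apply]
    exact sum_mem fun l _ => wedge_mem (S := (Qdeg F n).toAddSubgroup) l
      (fun I => by by_cases hI : I = ∅ <;> simp [hI, hv]) I
  · have h1 : ∀ m, ∑ l, (X m : MvPolynomial (Fin D) k) • contr m (wedge l (Pi.single ∅ (v l))) =
        Pi.single ∅ ((X m : MvPolynomial (Fin D) k) • v m) := by
      intro m
      rw [Finset.sum_eq_single m]
      · have := contr_wedge_self m (Pi.single ∅ (v m))
        rw [wedge_contr_single, add_zero] at this
        rw [this, Pi.single_smul]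
      · intro l _ hl
        rw [contr_wedge hl.symm, wedge_contr_single, neg_zero, smul_zero]
      · simp
    have h3 : ∀ m, (X m : MvPolynomial (Fin D) k) •
        contr m (∑ l, wedge l (Pi.single ∅ (v l))) =
        Pi.single ∅ ((X m : MvPolynomial (Fin D) k) • v m) := fun m => by
      rw [map_sum, Finset.smul_sum, h1]
    rw [opSum_apply, Finset.sum_congr rfl fun m _ => h3 m]
    ext1 I
    by_cases hI : I = ∅
    · subst hI; simpa using h
    · simp [hI]

theorem eq_zero_or_eq_one_of_idempotent (hD : 3 ≤ D) (he : e ≠ 0) (hF : F.IsHomogeneous e)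
    (h0 : F ≠ 0) (n : ℕ) {A : Type*} [CommRing A] [Algebra A k]
    (hA : Function.Surjective (algebraMap A k)) {V : Type*} [AddCommGroup V] [Module A V]
    (p : V →ₗ[A] (Finset (Fin D) → QRing F)) (hp : Function.Injective p)
    (hK : ∀ Z, (∃ v, p v = Z) ↔ Z ∈ Kbar F n) (θ : Fin D → V → V)
    (hθ : ∀ l v, p (θ l v) = contr l (p v)) (φ : V →ₗ[A] V)
    (hφθ : ∀ l v, φ (θ l v) = θ l (φ v)) (hφ : ∀ v, φ (φ v) = φ v) :
    (∀ v, φ v = 0) ∨ ∀ v, φ v = v := by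
  have hJ : ∀ v, (∀ l, θ l v = 0) ↔ p v = Pi.single ∅ (p v ∅) := by
    intro v
    rw [← contr_eq_zero_iff]
    refine forall_congr' fun l => ?_
    rw [← hθ, map_eq_zero_iff p hp]
  have hθ0 : ∀ l, θ l 0 = 0 := fun l => hp (by rw [hθ, map_zero, map_zero])
  have hφJ : ∀ v, p v = Pi.single ∅ (p v ∅) → p (φ v) = Pi.single ∅ (p (φ v) ∅) := by
    intro v hv
    rw [← hJ] at hv ⊢
    intro l
    rw [← hφθ, hv, map_zero]
  have hex : ∀ q : QRing F, ∃ v, q ∈ Qdeg F n → p v = Pi.single ∅ q := by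
    intro q
    by_cases hq : q ∈ Qdeg F n
    · obtain ⟨v, hv⟩ := (hK _).2 (single_mem_Kbar hq)
      exact ⟨v, fun _ => hv⟩
    · exact ⟨0, fun h => absurd h hq⟩
  choose s hs using hex
  have hmem : ∀ v I, p v I ∈ Qdeg F n := fun v I => ((hK _).1 ⟨v, rfl⟩).1 I
  have hps : ∀ q ∈ Qdeg F n, p (φ (s q)) = Pi.single ∅ (p (φ (s q)) ∅) := fun q hq =>
    hφJ _ (by rw [hs q hq]; simp)
  obtain ⟨c, hc⟩ := exists_scalar hD he hF h0 n (fun q => p (φ (s q)) ∅) (fun q _ => hmem _ _)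
    (fun q hq q' hq' => by
      have : s (q + q') = s q + s q' := hp (by
        rw [map_add, hs _ hq, hs _ hq', hs _ (add_mem hq hq'), Pi.single_add])
      simp [this])
    (fun c q hq => by
      obtain ⟨a, rfl⟩ := hA c
      have : s (a • q) = a • s q := hp (by
        rw [map_smul, hs _ hq, hs _ (by
          rw [← algebraMap_smul k a q]; exact Submodule.smul_mem _ _ hq), Pi.single_smul])
      simp only [algebraMap_smul, this, map_smul, Pi.smul_apply])
    (fun v hv hv0 => by
      obtain ⟨z, hz⟩ := (hK _).2 (sum_wedge_single_mem_Kbar hv hv0)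
      have h1 : ∀ l, θ l z = s (v l) := by
        intro l
        apply hp
        rw [hθ, hz, hs _ (hv l), map_sum, Finset.sum_eq_single l]
        · have := contr_wedge_self l (Pi.single ∅ (v l))
          rwa [wedge_contr_single, add_zero] at this
        · intro m _ hm
          rw [contr_wedge hm.symm, wedge_contr_single, neg_zero]
        · simp
      have h2 := congrFun ((hK _).1 ⟨φ z, rfl⟩).2 ∅
      simp only [opSum_apply, Finset.sum_apply, Pi.smul_apply, ← hθ, ← hφθ, h1,
        Pi.zero_apply] at h2
      exact h2)
  have key : ∀ ψ : V →ₗ[A] V, (∀ l v, ψ (θ l v) = θ l (ψ v)) → (∀ v, ψ (ψ v) = ψ v) →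
      (∀ v, p v = Pi.single ∅ (p v ∅) → ψ v = 0) → ∀ v, ψ v = 0 := by
    intro ψ hψθ hψ hψJ v
    have : ∀ m v, (∀ I, m ≤ I.card → p v I = 0) → ψ v = 0 := by
      intro m
      induction m with
      | zero =>
        intro v hv
        have : v = 0 := hp (by rw [map_zero]; exact funext fun I => hv I (Nat.zero_le _))
        rw [this, map_zero]
      | succ m ih =>
        intro v hv
        rw [← hψ]
        apply hψJ
        rw [← hJ]
        intro l
        rw [← hψθ]
        refine ih _ fun I hI => ?_
        rw [hθ, contr_apply]
        split_ifs with hl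
        · rfl
        · rw [hv _ (by rw [Finset.card_insert_of_notMem hl]; omega), smul_zero]
    exact this (D + 1) v fun I hI => by
      have := Finset.card_le_univ I
      simp at this; omega
  have hJs : ∀ v, p v = Pi.single ∅ (p v ∅) → p (φ v) = c • p v := by
    intro v hv
    have h1 : s (p v ∅) = v := hp (by rw [hs _ (hmem _ _), ← hv])
    have h2 := hc _ (hmem v ∅)
    rw [h1] at h2
    rw [hφJ v hv, hv, h2, ← Pi.single_smul]
  by_cases hc0 : c = 0
  · left
    refine key φ hφθ hφ fun v hv => hp ?_
    rw [hJs v hv, hc0, zero_smul, map_zero]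
  · right
    have := key (LinearMap.id - φ) (fun l v => hp ?_) (fun v => by simp [hφ]) (fun v hv => hp ?_)
    · intro v
      have := this v
      simp only [LinearMap.sub_apply, LinearMap.id_apply] at this
      exact (sub_eq_zero.1 this).symm
    · simp only [LinearMap.sub_apply, LinearMap.id_apply, map_sub, hθ, hφθ]
    · have h1 := hJs _ (hφJ v hv)
      rw [hφ, hJs v hv, smul_right_injective _ hc0 |>.eq_iff] at h1
      simp [hJs v hv, ← h1]

end GradedCore

/-! ### Twisted Koszul homology -/

lemma exists_equiv_of_ker_eq {A C M N : Type*} [Ring A] [AddCommGroup C] [AddCommGroup M]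
    [AddCommGroup N] [Module A C] [Module A M] [Module A N] (α : C →ₗ[A] M) (β : C →ₗ[A] N)
    (hα : Function.Surjective α) (hβ : Function.Surjective β)
    (h : LinearMap.ker β = LinearMap.ker α) : ∃ e : N ≃ₗ[A] M, ∀ c, e (β c) = α c := by
  refine ⟨(β.quotKerEquivOfSurjective hβ).symm ≪≫ₗ Submodule.quotEquivOfEq _ _ h ≪≫ₗ
    α.quotKerEquivOfSurjective hα, fun c => ?_⟩
  have : (β.quotKerEquivOfSurjective hβ).symm (β c) = Submodule.Quotient.mk c := by
    rw [LinearEquiv.symm_apply_eq]; rfl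
  simp only [LinearEquiv.trans_apply, this]
  rfl

/-- Coefficients `x`, `a` with `∑ xₗaₗ = 0`, together with an expression of `a` through `x`; they
define a square-zero operator on `Λ ⊗ Z` for every module `Z`. -/
structure ClData (A : Type*) [CommRing A] (D : ℕ) where
  /-- The coefficients of the contractions. -/
  x : Fin D → A
  /-- The coefficients of the wedge products. -/
  a : Fin D → A
  /-- The coefficients of `a` in terms of `x`. -/
  b : Fin D → Fin D → A
  hab : ∀ l, a l = ∑ m, b l m * x m
  hxa : ∑ l, x l * a l = 0

namespace ClData

variable {D : ℕ} {A : Type*} [CommRing A] (c : ClData A D)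
variable {Z Z' Z'' : Type*} [AddCommGroup Z] [Module A Z] [AddCommGroup Z'] [Module A Z']
  [AddCommGroup Z''] [Module A Z'']

variable (Z) in
/-- The twisted Koszul differential. -/
def dif : (Finset (Fin D) → Z) →ₗ[A] (Finset (Fin D) → Z) where
  toFun z := opSum c.x contr z + opSum c.a wedge z
  map_add' z w := by simp only [map_add]; abel
  map_smul' r z := by
    simp only [opSum_contr_smul, opSum_wedge_smul, smul_add, RingHom.id_apply]

lemma dif_apply (z : Finset (Fin D) → Z) :
    c.dif Z z = opSum c.x contr z + opSum c.a wedge z := rfl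

lemma dif_dif (z : Finset (Fin D) → Z) : c.dif Z (c.dif Z z) = 0 := by
  simp only [dif_apply, map_add, opSum_contr_opSum_contr, opSum_wedge_opSum_wedge, zero_add,
    add_zero]
  rw [add_comm, opSum_contr_wedge, c.hxa, zero_smul]

lemma dif_map (g : Z →ₗ[A] Z') (z : Finset (Fin D) → Z) :
    c.dif Z' (g ∘ z) = g ∘ c.dif Z z := by
  rw [dif_apply, dif_apply, opSum_contr_map, opSum_wedge_map]
  ext; simp

variable (Z) in
/-- The operators anticommuting with the twisted Koszul differential. -/
def theta (l : Fin D) : (Finset (Fin D) → Z) →ₗ[A] (Finset (Fin D) → Z) where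
  toFun z := contr l z - opSum (c.b l) wedge z
  map_add' z w := by simp only [map_add]; abel
  map_smul' r z := by
    simp only [contr_smul, opSum_wedge_smul, smul_sub, RingHom.id_apply]

lemma theta_apply (l : Fin D) (z : Finset (Fin D) → Z) :
    c.theta Z l z = contr l z - opSum (c.b l) wedge z := rfl

lemma theta_map (l : Fin D) (g : Z →ₗ[A] Z') (z : Finset (Fin D) → Z) :
    c.theta Z' l (g ∘ z) = g ∘ c.theta Z l z := by
  have := contr_map g.toAddMonoidHom l z
  simp only [LinearMap.toAddMonoidHom_coe] at this
  rw [theta_apply, theta_apply, opSum_wedge_map, this]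
  ext; simp

lemma dif_theta (l : Fin D) (z : Finset (Fin D) → Z) :
    c.dif Z (c.theta Z l z) = - c.theta Z l (c.dif Z z) := by
  have h1 : opSum c.x contr (contr l z) = - contr l (opSum c.x contr z) := by
    simp only [opSum_apply, map_sum, contr_smul, ← Finset.sum_neg_distrib]
    exact Finset.sum_congr rfl fun m _ => by rw [contr_contr, smul_neg]
  have h2 : opSum c.a wedge (opSum (c.b l) wedge z) =
      - opSum (c.b l) wedge (opSum c.a wedge z) := by
    simp only [opSum_apply, map_sum, wedge_smul, ← Finset.sum_neg_distrib]
    rw [Finset.sum_comm]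
    refine Finset.sum_congr rfl fun m _ => Finset.sum_congr rfl fun i _ => ?_
    rw [wedge_wedge, smul_neg, smul_neg, smul_comm]
  have h3 := opSum_contr_wedge c.x (c.b l) z
  have h4 : contr l (opSum c.a wedge z) + opSum c.a wedge (contr l z) = c.a l • z := by
    have := opSum_contr_wedge (Pi.single l 1) c.a z
    have h5 : ∀ w : Finset (Fin D) → Z, opSum (Pi.single l (1 : A)) contr w = contr l w := by
      intro w
      rw [opSum_apply, Finset.sum_eq_single l (fun m _ hm => by simp [Pi.single_eq_of_ne hm])
        (by simp)]
      simp
    rw [h5, h5, Finset.sum_eq_single l (fun m _ hm => by simp [Pi.single_eq_of_ne hm])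
        (by simp)] at this
    simpa using this
  have h6 : ∑ m, c.x m * c.b l m = c.a l := by
    rw [c.hab]; exact Finset.sum_congr rfl fun m _ => mul_comm _ _
  rw [h6, ← h4] at h3
  simp only [theta_apply, dif_apply, map_sub, map_add, h1, h2]
  have h7 : opSum c.x contr (opSum (c.b l) wedge z) = contr l (opSum c.a wedge z) +
      opSum c.a wedge (contr l z) - opSum (c.b l) wedge (opSum c.x contr z) := eq_sub_of_add_eq h3
  rw [h7]
  abel

variable (Z) in
/-- Twisted Koszul homology with coefficients in `Z`. -/
abbrev T : Type _ :=
  LinearMap.ker (c.dif Z) ⧸ (LinearMap.range (c.dif Z)).submoduleOf (LinearMap.ker (c.dif Z))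

/-- The class of a cycle. -/
def cls (z : Finset (Fin D) → Z) (hz : c.dif Z z = 0) : c.T Z :=
  Submodule.Quotient.mk ⟨z, hz⟩

lemma exists_rep (t : c.T Z) : ∃ z hz, t = c.cls z hz := by
  obtain ⟨⟨z, hz⟩, rfl⟩ := Submodule.Quotient.mk_surjective _ t
  exact ⟨z, hz, rfl⟩

lemma cls_eq_zero {z : Finset (Fin D) → Z} {hz : c.dif Z z = 0} :
    c.cls z hz = 0 ↔ ∃ w, c.dif Z w = z := by
  rw [cls, Submodule.Quotient.mk_eq_zero]
  rfl

lemma cls_congr {z w : Finset (Fin D) → Z} {hz : c.dif Z z = 0} (h : z = w) :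
    c.cls z hz = c.cls w (h ▸ hz) := by
  subst h; rfl

lemma cls_add {z w : Finset (Fin D) → Z} (hz : c.dif Z z = 0) (hw : c.dif Z w = 0) :
    c.cls z hz + c.cls w hw = c.cls (z + w) (by rw [map_add, hz, hw, add_zero]) := rfl

lemma neg_cls {z : Finset (Fin D) → Z} (hz : c.dif Z z = 0) :
    - c.cls z hz = c.cls (-z) (by rw [map_neg, hz, neg_zero]) := rfl

/-- Maps out of twisted Koszul homology. -/
def lift {M : Type*} [AddCommGroup M] [Module A M] (f : LinearMap.ker (c.dif Z) →ₗ[A] M)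
    (hf : ∀ w, f ⟨c.dif Z w, c.dif_dif w⟩ = 0) : c.T Z →ₗ[A] M :=
  Submodule.liftQ _ f (by
    rintro ⟨_, hz⟩ ⟨w, rfl⟩
    exact hf w)

/-- The class map, as a linear map. -/
def mkT : LinearMap.ker (c.dif Z) →ₗ[A] c.T Z := Submodule.mkQ _

/-- Functoriality of twisted Koszul homology. -/
def map (g : Z →ₗ[A] Z') : c.T Z →ₗ[A] c.T Z' :=
  c.lift (c.mkT.comp ((g.compLeft (Finset (Fin D))).restrict (p := LinearMap.ker (c.dif Z))
    (q := LinearMap.ker (c.dif Z')) fun z hz => by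
      rw [LinearMap.mem_ker] at hz ⊢
      change c.dif Z' (g ∘ z) = 0
      rw [dif_map, hz]; ext; simp)) fun w => by
    refine c.cls_eq_zero.2 ⟨g ∘ w, ?_⟩
    rw [dif_map]; rfl

lemma map_cls (g : Z →ₗ[A] Z') (z) (hz : c.dif Z z = 0) :
    c.map g (c.cls z hz) = c.cls (g ∘ z) (by rw [dif_map, hz]; ext; simp) := rfl

lemma map_id (t : c.T Z) : c.map (LinearMap.id : Z →ₗ[A] Z) t = t := by
  obtain ⟨z, hz, rfl⟩ := c.exists_rep t; rfl

lemma map_comp (g : Z →ₗ[A] Z') (h : Z' →ₗ[A] Z'') (t : c.T Z) :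
    c.map (h.comp g) t = c.map h (c.map g t) := by
  obtain ⟨z, hz, rfl⟩ := c.exists_rep t; rfl

/-- The action of `theta` on twisted Koszul homology. -/
def thetaT (Z : Type*) [AddCommGroup Z] [Module A Z] (l : Fin D) : c.T Z →ₗ[A] c.T Z :=
  c.lift (c.mkT.comp ((c.theta Z l).restrict (p := LinearMap.ker (c.dif Z))
    (q := LinearMap.ker (c.dif Z)) fun z hz => by
      rw [LinearMap.mem_ker] at hz ⊢
      rw [dif_theta, hz, map_zero, neg_zero])) fun w => by
    refine c.cls_eq_zero.2 ⟨- c.theta Z l w, ?_⟩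
    rw [map_neg, dif_theta, neg_neg]; rfl

lemma thetaT_cls (l : Fin D) (z) (hz : c.dif Z z = 0) :
    c.thetaT Z l (c.cls z hz) =
      c.cls (c.theta Z l z) (by rw [dif_theta, hz, map_zero, neg_zero]) := rfl

lemma map_thetaT (g : Z →ₗ[A] Z') (l : Fin D) (t : c.T Z) :
    c.map g (c.thetaT Z l t) = c.thetaT Z' l (c.map g t) := by
  obtain ⟨z, hz, rfl⟩ := c.exists_rep t
  rw [thetaT_cls, map_cls, map_cls, thetaT_cls]
  exact c.cls_congr (c.theta_map l g z).symm

/-- Vanishing of twisted Koszul homology. -/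
def Acyc (Z : Type*) [AddCommGroup Z] [Module A Z] : Prop :=
  ∀ z : Finset (Fin D) → Z, c.dif Z z = 0 → ∃ w, c.dif Z w = z

variable {c} in
lemma Acyc.of_equiv (h : c.Acyc Z) (e : Z ≃ₗ[A] Z') : c.Acyc Z' := by
  intro z hz
  obtain ⟨w, hw⟩ := h (e.symm ∘ z) (by
    have := c.dif_map e.symm.toLinearMap z
    simp only [LinearEquiv.coe_coe] at this
    rw [this, hz]; ext; simp)
  refine ⟨e ∘ w, ?_⟩
  have := c.dif_map e.toLinearMap w
  simp only [LinearEquiv.coe_coe] at this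
  rw [this, hw]; ext; simp

variable {c} in
lemma Acyc.pi {ι : Type*} (h : c.Acyc Z) : c.Acyc (ι → Z) := by
  intro z hz
  have : ∀ i, ∃ w, c.dif Z w = fun I => z I i := fun i => h _ (by
    have := c.dif_map (LinearMap.proj i : (ι → Z) →ₗ[A] Z) z
    rw [hz] at this
    exact this)
  choose w hw using this
  refine ⟨fun I i => w i I, ?_⟩
  ext I i
  have := c.dif_map (LinearMap.proj i : (ι → Z) →ₗ[A] Z) (fun I i => w i I)
  have h2 := congrFun this I
  change c.dif Z (w i) I = _ at h2
  rw [hw] at h2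
  exact h2.symm

/-- The connecting isomorphism for a short exact sequence with acyclic middle term. -/
theorem exists_connecting (i : Z' →ₗ[A] Z) (p : Z →ₗ[A] Z'') (hi : Function.Injective i)
    (hp : Function.Surjective p) (hip : Function.Exact i p) (hZ : c.Acyc Z) :
    ∃ ε : c.T Z' ≃ₗ[A] c.T Z'', ∀ l t, ε (c.thetaT Z' l t) = - c.thetaT Z'' l (ε t) := by
  have lift' : ∀ z : Finset (Fin D) → Z, p ∘ z = 0 → ∃ z', i ∘ z' = z := by
    intro z hz
    choose z' hz' using fun I => (hip _).1 (congrFun hz I)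
    exact ⟨z', funext hz'⟩
  have hi' : ∀ z z' : Finset (Fin D) → Z', i ∘ z = i ∘ z' → z = z' := fun z z' h =>
    hi.comp_left h
  have hpi : ∀ z : Finset (Fin D) → Z', p ∘ i ∘ z = 0 := fun z => by
    ext I; exact hip.apply_apply_eq_zero _
  let C : Submodule A ((Finset (Fin D) → Z) × (Finset (Fin D) → Z')) :=
    LinearMap.ker ((c.dif Z).comp (LinearMap.fst A _ _) -
      (i.compLeft (Finset (Fin D))).comp (LinearMap.snd A _ _))
  have hC : ∀ w z', (w, z') ∈ C ↔ c.dif Z w = i ∘ z' := fun w z' => by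
    rw [LinearMap.mem_ker, LinearMap.sub_apply, sub_eq_zero]; rfl
  have h1 : ∀ w z', (w, z') ∈ C → c.dif Z'' (p ∘ w) = 0 := fun w z' h => by
    rw [dif_map, (hC w z').1 h, hpi]
  have h2 : ∀ w z', (w, z') ∈ C → c.dif Z' z' = 0 := fun w z' h => by
    apply hi'
    rw [← dif_map, ← (hC w z').1 h, dif_dif]; ext; simp
  let α : C →ₗ[A] c.T Z'' := c.mkT.comp (LinearMap.codRestrict _
    (((p.compLeft (Finset (Fin D))).comp (LinearMap.fst A _ _)).comp C.subtype)
    fun y => h1 y.1.1 y.1.2 y.2)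
  let β : C →ₗ[A] c.T Z' := c.mkT.comp (LinearMap.codRestrict _
    ((LinearMap.snd A _ _).comp C.subtype) fun y => h2 y.1.1 y.1.2 y.2)
  have hαc : ∀ w z' h, α ⟨(w, z'), h⟩ = c.cls (p ∘ w) (h1 w z' h) := fun _ _ _ => rfl
  have hβc : ∀ w z' h, β ⟨(w, z'), h⟩ = c.cls z' (h2 w z' h) := fun _ _ _ => rfl
  have hα : Function.Surjective α := by
    intro t
    obtain ⟨z, hz, rfl⟩ := c.exists_rep t
    choose w hw using fun I => hp (z I)
    have hw' : p ∘ w = z := funext hw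
    obtain ⟨z', hz'⟩ := lift' (c.dif Z w) (by rw [← dif_map, hw', hz])
    refine ⟨⟨(w, z'), (hC _ _).2 hz'.symm⟩, ?_⟩
    rw [hαc]
    exact c.cls_congr hw'
  have hβ : Function.Surjective β := by
    intro t
    obtain ⟨z', hz, rfl⟩ := c.exists_rep t
    obtain ⟨w, hw⟩ := hZ (i ∘ z') (by rw [dif_map, hz]; ext; simp)
    exact ⟨⟨(w, z'), (hC _ _).2 hw⟩, rfl⟩
  have hker : LinearMap.ker β = LinearMap.ker α := by
    ext ⟨⟨w, z'⟩, h⟩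
    have h' := (hC _ _).1 h
    rw [LinearMap.mem_ker, LinearMap.mem_ker, hαc, hβc, cls_eq_zero, cls_eq_zero]
    constructor
    · rintro ⟨v, rfl⟩
      obtain ⟨y, hy⟩ := hZ (w - i ∘ v) (by rw [map_sub, h', dif_map, sub_self])
      refine ⟨p ∘ y, ?_⟩
      rw [dif_map, hy]
      ext I
      have := congrFun (hpi v) I
      simp only [Function.comp_apply, Pi.zero_apply] at this
      simp [this]
    · rintro ⟨v'', hv⟩
      choose v hv'' using fun I => hp (v'' I)
      obtain rfl : p ∘ v = v'' := funext hv''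
      rw [dif_map] at hv
      obtain ⟨u, hu⟩ := lift' (w - c.dif Z v) (by
        ext I
        have := congrFun hv I
        simp only [Function.comp_apply] at this
        simp [this])
      refine ⟨u, hi' _ _ ?_⟩
      rw [← dif_map, hu, map_sub, dif_dif, sub_zero, h']
  obtain ⟨ε, hε⟩ := exists_equiv_of_ker_eq α β hα hβ hker
  refine ⟨ε, fun l t => ?_⟩
  obtain ⟨⟨⟨w, z'⟩, h⟩, rfl⟩ := hβ t
  have h' := (hC _ _).1 h
  have h3 : (- c.theta Z l w, c.theta Z' l z') ∈ C := by
    rw [hC, map_neg, dif_theta, neg_neg, h', theta_map]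
  rw [hε, hβc, thetaT_cls, hαc, thetaT_cls, ← hβc _ _ h3, hε, hαc, neg_cls]
  refine c.cls_congr ?_
  rw [theta_map]
  ext; simp

/-- Every idempotent of twisted Koszul homology commuting with the operators `thetaT` is
trivial. -/
def TIdem (Z : Type*) [AddCommGroup Z] [Module A Z] : Prop :=
  ∀ ψ : c.T Z →ₗ[A] c.T Z, (∀ l t, ψ (c.thetaT Z l t) = c.thetaT Z l (ψ t)) →
    (∀ t, ψ (ψ t) = ψ t) → (∀ t, ψ t = 0) ∨ ∀ t, ψ t = t

lemma TIdem.of_equiv (h : c.TIdem Z') (ε : c.T Z' ≃ₗ[A] c.T Z) (s : ℤˣ)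
    (hε : ∀ l t, ε (c.thetaT Z' l t) = (s : ℤ) • c.thetaT Z l (ε t)) : c.TIdem Z := by
  intro ψ hψ hi
  have hε' : ∀ l t, ε.symm (c.thetaT Z l t) = (s : ℤ) • c.thetaT Z' l (ε.symm t) := by
    intro l t
    rw [LinearEquiv.symm_apply_eq, map_zsmul, hε, LinearEquiv.apply_symm_apply, smul_smul]
    rcases Int.units_eq_one_or s with rfl | rfl <;> simp
  rcases h (ε.symm.toLinearMap.comp (ψ.comp ε.toLinearMap)) (fun l t => by
    simp only [LinearMap.comp_apply, LinearEquiv.coe_coe, hε, map_zsmul, hψ, hε', smul_smul]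
    rcases Int.units_eq_one_or s with rfl | rfl <;> simp) (fun t => by
    simp [hi]) with h | h
  · left
    intro t
    have := h (ε.symm t)
    simpa using this
  · right
    intro t
    have := h (ε.symm t)
    simpa using this

end ClData

/-! ### Hypersurface data and symbols -/

section Symbols

open MvPolynomial

lemma exists_homogeneous_lift {A k : Type*} [CommRing A] [CommRing k] {σ : Type*} (g : A →+* k)
    (hg : Function.Surjective g) {j : ℕ} {p : MvPolynomial σ k} (hp : p.IsHomogeneous j) :
    ∃ P : MvPolynomial σ A, P.IsHomogeneous j ∧ map g P = p := by
  obtain ⟨P, rfl⟩ := map_surjective g hg p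
  refine ⟨homogeneousComponent j P, homogeneousComponent_isHomogeneous _ _, ?_⟩
  rw [← homogeneousComponent_eq_self hp]
  ext s
  simp only [coeff_map, coeff_homogeneousComponent]
  split_ifs <;> simp

/-- The data on a hypersurface ring used in the computation of twisted Koszul homology: `F` is the
initial form of the equation, and the initial form ring is `k[X]/(F)`. -/
structure HypData (A : Type u) [CommRing A] [IsLocalRing A] (D : ℕ) extends ClData A D where
  /-- The initial form. -/
  F : MvPolynomial (Fin D) A
  /-- The multiplicity. -/
  e : ℕ
  he : 3 ≤ e
  hF : F.IsHomogeneous e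
  eval_F : eval x F = 0
  map_F : map (residue A) F ≠ 0
  span_eq : Ideal.span (Set.range x) = maximalIdeal A
  sym : ∀ (j : ℕ) (G : MvPolynomial (Fin D) A), G.IsHomogeneous j →
    eval x G ∈ maximalIdeal A ^ (j + 1) → map (residue A) F ∣ map (residue A) G
  a_mem : ∀ l, a l ∈ maximalIdeal A ^ 2
  b_mem : ∀ l m, b l m ∈ maximalIdeal A
  acyc : toClData.Acyc A

namespace HypData

variable {A : Type u} [CommRing A] [IsLocalRing A] {D : ℕ} (h : HypData A D)

/-- The reduction of the initial form. -/
def Fbar : MvPolynomial (Fin D) (ResidueField A) := map (residue A) h.F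

lemma Fbar_homog : h.Fbar.IsHomogeneous h.e := h.hF.map _

lemma toQ_eq {j : ℕ} {G G' : MvPolynomial (Fin D) A} (hG : G.IsHomogeneous j)
    (hG' : G'.IsHomogeneous j) (hd : eval h.x G - eval h.x G' ∈ maximalIdeal A ^ (j + 1)) :
    toQ h.Fbar (map (residue A) G) = toQ h.Fbar (map (residue A) G') := by
  rw [← sub_eq_zero, ← map_sub, ← map_sub, toQ_eq_zero_iff]
  exact h.sym j _ (hG.sub hG') (by rwa [map_sub])

lemma exists_form {j : ℕ} {z : A} (hz : z ∈ maximalIdeal A ^ j) :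
    ∃ G : MvPolynomial (Fin D) A, G.IsHomogeneous j ∧ eval h.x G = z := by
  rw [← h.span_eq] at hz
  exact (Ideal.mem_span_pow_iff_exists_isHomogeneous h.x z).1 hz

lemma eval_mem {j : ℕ} {G : MvPolynomial (Fin D) A} (hG : G.IsHomogeneous j) :
    eval h.x G ∈ maximalIdeal A ^ j := by
  rw [← h.span_eq]
  exact (Ideal.mem_span_pow_iff_exists_isHomogeneous h.x _).2 ⟨G, hG, rfl⟩

lemma x_mem (l : Fin D) : h.x l ∈ maximalIdeal A := by
  rw [← h.span_eq]; exact Ideal.subset_span ⟨l, rfl⟩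

/-- The leading form of an element of `𝔪ʲ`, in the initial form ring. -/
def symb (j : ℕ) : (maximalIdeal A ^ j : Ideal A) →ₗ[A] QRing h.Fbar where
  toFun z := toQ h.Fbar (map (residue A) (h.exists_form z.2).choose)
  map_add' z w := by
    have hz := (h.exists_form z.2).choose_spec
    have hw := (h.exists_form w.2).choose_spec
    have hzw := (h.exists_form (z + w).2).choose_spec
    rw [← map_add, ← map_add]
    refine h.toQ_eq hzw.1 (hz.1.add hw.1) ?_
    rw [map_add, hz.2, hw.2, hzw.2]; simp
  map_smul' r z := by
    have hz := (h.exists_form z.2).choose_spec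
    have hrz := (h.exists_form (r • z).2).choose_spec
    have : r • toQ h.Fbar (map (residue A) (h.exists_form z.2).choose) =
        toQ h.Fbar (map (residue A) (C r * (h.exists_form z.2).choose)) := by
      rw [map_mul, map_C, toQ_smul, ← algebraMap_smul (ResidueField A) r,
        ← IsLocalRing.ResidueField.algebraMap_eq, C_eq_smul_one, smul_assoc, one_smul]
    rw [RingHom.id_apply, this]
    refine h.toQ_eq hrz.1 (by simpa using (isHomogeneous_C _ r).mul hz.1) ?_
    rw [map_mul, eval_C, hz.2, hrz.2]; simp

lemma symb_eval {j : ℕ} {G : MvPolynomial (Fin D) A} (hG : G.IsHomogeneous j) (hz) :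
    h.symb j ⟨eval h.x G, hz⟩ = toQ h.Fbar (map (residue A) G) := by
  have hz' := (h.exists_form hz).choose_spec
  exact h.toQ_eq hz'.1 hG (by rw [hz'.2]; simp)

lemma symb_mem {j : ℕ} (z) : h.symb j z ∈ Qdeg h.Fbar j :=
  toQ_mem_Qdeg ((h.exists_form z.2).choose_spec.1.map _)

lemma exists_symb {j : ℕ} {q : QRing h.Fbar} (hq : q ∈ Qdeg h.Fbar j) : ∃ z, h.symb j z = q := by
  obtain ⟨p, hp, rfl⟩ := mem_Qdeg.1 hq
  obtain ⟨P, hP, rfl⟩ := exists_homogeneous_lift (residue A) residue_surjective hp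
  exact ⟨⟨_, h.eval_mem hP⟩, h.symb_eval hP _⟩

lemma symb_eq_zero_iff {j : ℕ} (z : (maximalIdeal A ^ j : Ideal A)) :
    h.symb j z = 0 ↔ (z : A) ∈ maximalIdeal A ^ (j + 1) := by
  obtain ⟨z, hz⟩ := z
  obtain ⟨G, hG, rfl⟩ := h.exists_form hz
  rw [h.symb_eval hG]
  constructor
  · intro h0
    have key : ∀ H : MvPolynomial (Fin D) A, H.IsHomogeneous j → map (residue A) H = 0 →
        eval h.x H ∈ maximalIdeal A ^ (j + 1) := by
      intro H hH h0
      have := eval_mem_of_coeff_mem h.x hH (J := maximalIdeal A)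
        ((map_mk_eq_zero_iff (maximalIdeal A) H).1 h0)
      rwa [h.span_eq, ← pow_succ'] at this
    rw [toQ_eq_zero_iff] at h0
    rcases dvd_of_dvd_homogeneousComponents h.Fbar_homog (hG.map _) h0 with h0 | ⟨i, q, rfl, hq, hGq⟩
    · exact key G hG h0
    · obtain ⟨P, hP, rfl⟩ := exists_homogeneous_lift (residue A) residue_surjective hq
      have := key (G - h.F * P) (hG.sub (h.hF.mul hP)) (by
        rw [map_sub, hGq, map_mul, Fbar, sub_self])
      rwa [map_sub, map_mul, h.eval_F, zero_mul, sub_zero] at this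
  · intro h0
    rw [toQ_eq_zero_iff]
    exact h.sym j G hG h0

end HypData

end Symbols

section Powers

open MvPolynomial

lemma opSum_contr_semilinear {D : ℕ} {R R' Z Z' : Type*} [CommRing R] [CommRing R']
    [AddCommGroup Z] [AddCommGroup Z'] [Module R Z] [Module R' Z'] (g : Z →+ Z') {c : Fin D → R}
    {c' : Fin D → R'} (hg : ∀ l z, g (c l • z) = c' l • g z) (z : Finset (Fin D) → Z) :
    opSum c' contr (g ∘ z) = g ∘ opSum c contr z := by
  ext I
  simp only [opSum_apply, contr_map, Finset.sum_apply, Pi.smul_apply, Function.comp_apply, map_sum,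
    hg]

lemma mem_smul_top_pi {A : Type*} [CommRing A] {ι : Type*} [Finite ι] {J : Ideal A} {z : ι → A}
    (hz : ∀ i, z i ∈ J) : z ∈ J • (⊤ : Submodule A (ι → A)) := by
  classical
  cases nonempty_fintype ι
  rw [pi_eq_sum_univ z]
  exact sum_mem fun i _ => Submodule.smul_mem_smul (hz i) trivial

namespace HypData

variable {A : Type u} [CommRing A] [IsLocalRing A] {D : ℕ} (h : HypData A D)

lemma symb_eq_of_sub_mem {j : ℕ} {G : MvPolynomial (Fin D) A} (hG : G.IsHomogeneous j) {z : A}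
    (hz : z ∈ maximalIdeal A ^ j) (hd : z - eval h.x G ∈ maximalIdeal A ^ (j + 1)) :
    h.symb j ⟨z, hz⟩ = toQ h.Fbar (map (residue A) G) := by
  obtain ⟨G', hG', rfl⟩ := h.exists_form hz
  rw [h.symb_eval hG', h.toQ_eq hG' hG hd]

lemma opSum_contr_mem {j : ℕ} {z : Finset (Fin D) → A} (hz : ∀ I, z I ∈ maximalIdeal A ^ j) (I) :
    opSum h.x contr z I ∈ maximalIdeal A ^ (j + 1) := by
  simp only [opSum_apply, Finset.sum_apply, Pi.smul_apply]
  refine sum_mem fun l _ => ?_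
  rw [pow_succ']
  exact Ideal.mul_mem_mul (h.x_mem l)
    (contr_mem (S := (maximalIdeal A ^ j : Ideal A).toAddSubgroup) l hz I)

lemma opSum_wedge_mem {j : ℕ} {z : Finset (Fin D) → A} (hz : ∀ I, z I ∈ maximalIdeal A ^ j) (I) :
    opSum h.a wedge z I ∈ maximalIdeal A ^ (j + 2) := by
  simp only [opSum_apply, Finset.sum_apply, Pi.smul_apply]
  refine sum_mem fun l _ => ?_
  rw [pow_add, mul_comm]
  exact Ideal.mul_mem_mul (h.a_mem l)
    (wedge_mem (S := (maximalIdeal A ^ j : Ideal A).toAddSubgroup) l hz I)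

lemma dif_mem_pow {j : ℕ} {z : Finset (Fin D) → A} (hz : ∀ I, z I ∈ maximalIdeal A ^ j) (I) :
    h.dif A z I ∈ maximalIdeal A ^ (j + 1) := by
  rw [ClData.dif_apply]
  exact add_mem (h.opSum_contr_mem hz I)
    (Ideal.pow_le_pow_right (by omega) (h.opSum_wedge_mem hz I))

lemma symb_dif {j : ℕ} {w : Finset (Fin D) → A} (hw : ∀ I, w I ∈ maximalIdeal A ^ j) (I) :
    h.symb (j + 1) ⟨h.dif A w I, h.dif_mem_pow hw I⟩ =
      opSum (X (R := ResidueField A)) contr (fun I => h.symb j ⟨w I, hw I⟩) I := by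
  choose G hG hGw using fun I => h.exists_form (hw I)
  have hH : ∀ I, (opSum (X (R := A)) contr G I).IsHomogeneous (j + 1) := by
    intro I
    simp only [opSum_apply, Finset.sum_apply, Pi.smul_apply]
    refine sum_mem (S := homogeneousSubmodule (Fin D) A (j + 1)) fun l _ => ?_
    rw [smul_eq_mul, mem_homogeneousSubmodule, add_comm]
    exact (isHomogeneous_X _ l).mul
      (contr_mem (S := (homogeneousSubmodule (Fin D) A j).toAddSubgroup) l hG I)
  have h1 : opSum h.x contr w I = eval h.x (opSum (X (R := A)) contr G I) := by
    have := congrFun (opSum_contr_semilinear (eval h.x).toAddMonoidHom (c := X (R := A))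
      (c' := h.x) (fun l z => by simp) G) I
    have h2 : w = (eval h.x).toAddMonoidHom ∘ G := funext fun I => (hGw I).symm
    rw [h2, this]; rfl
  rw [h.symb_eq_of_sub_mem (hH I) _ (by
    rw [ClData.dif_apply, Pi.add_apply, h1, add_sub_cancel_left]
    exact h.opSum_wedge_mem hw I)]
  have h3 := congrFun (opSum_contr_semilinear
    ((toQ h.Fbar).toAddMonoidHom.comp (map (residue A)).toAddMonoidHom) (c := X (R := A))
    (c' := X (R := ResidueField A)) (fun l z => by
      simp only [AddMonoidHom.comp_apply, RingHom.toAddMonoidHom_eq_coe, AddMonoidHom.coe_coe,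
        smul_eq_mul, map_mul, map_X, LinearMap.toAddMonoidHom_coe, toQ_smul]) G) I
  refine h3.symm.trans ?_
  refine congrFun (congrArg _ (funext fun I => ?_)) I
  exact (h.symb_eq_of_sub_mem (hG I) (hw I) (by rw [hGw, sub_self]; exact zero_mem _)).symm

lemma exists_dif_sub_mem {j : ℕ} (hj : h.e ≤ j + 1) {z : Finset (Fin D) → A}
    (hz : ∀ I, z I ∈ maximalIdeal A ^ (j + 1)) (hd : h.dif A z = 0) :
    ∃ w, (∀ I, w I ∈ maximalIdeal A ^ j) ∧
      ∀ I, (z - h.dif A w) I ∈ maximalIdeal A ^ (j + 2) := by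
  have h1 : opSum (X (R := ResidueField A)) contr (fun I => h.symb (j + 1) ⟨z I, hz I⟩) = 0 := by
    ext1 I
    rw [← h.symb_dif hz, Pi.zero_apply, symb_eq_zero_iff]
    simp only [hd]
    exact zero_mem _
  obtain ⟨W, hW, hWz⟩ := exists_contr_eq_of_le (by have := h.he; omega) h.Fbar_homog h.map_F hj
    (fun I => h.symb_mem _) h1
  choose w hw using fun I => h.exists_symb (hW I)
  refine ⟨fun I => w I, fun I => (w I).2, fun I => ?_⟩
  have h2 := h.symb_dif (fun I => (w I).2) I
  simp only [Subtype.coe_eta, hw] at h2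
  have h3 : h.symb (j + 1) (⟨z I, hz I⟩ - ⟨_, h.dif_mem_pow (fun I => (w I).2) I⟩) = 0 := by
    rw [map_sub, h2, ← hWz, sub_self]
  exact (h.symb_eq_zero_iff _).1 h3

theorem exists_dif_eq [IsNoetherianRing A] {j : ℕ} (hj : h.e ≤ j + 1) {z : Finset (Fin D) → A}
    (hz : ∀ I, z I ∈ maximalIdeal A ^ (j + 1)) (hd : h.dif A z = 0) :
    ∃ w, (∀ I, w I ∈ maximalIdeal A ^ j) ∧ h.dif A w = z := by
  let B : Submodule A (Finset (Fin D) → A) :=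
    (Submodule.pi Set.univ fun _ => (maximalIdeal A ^ j : Ideal A)).map (h.dif A)
  have hB : ∀ i, ∃ w, (∀ I, w I ∈ maximalIdeal A ^ j) ∧
      ∀ I, (z - h.dif A w) I ∈ maximalIdeal A ^ (j + 1 + i) := by
    intro i
    induction i with
    | zero => exact ⟨0, fun I => zero_mem _, by simpa using hz⟩
    | succ i ih =>
      obtain ⟨w, hw, hw'⟩ := ih
      have e1 : j + 1 + i = (j + i) + 1 := by omega
      rw [e1] at hw'
      obtain ⟨v, hv, hv'⟩ := h.exists_dif_sub_mem (by omega) hw' (by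
        rw [map_sub, hd, ClData.dif_dif, sub_zero])
      refine ⟨w + v, fun I => add_mem (hw I) (Ideal.pow_le_pow_right (by omega) (hv I)),
        fun I => ?_⟩
      rw [map_add, ← sub_sub, show j + 1 + (i + 1) = j + i + 2 by omega]
      exact hv' I
  have hzB : z ∈ B := by
    rw [← Submodule.Quotient.mk_eq_zero, ← Submodule.mem_bot A,
      ← Ideal.iInf_pow_smul_eq_bot_of_isLocalRing (M := (Finset (Fin D) → A) ⧸ B)
        (maximalIdeal A) (Ideal.IsPrime.ne_top'), Submodule.mem_iInf]
    intro i
    obtain ⟨w, hw, hw'⟩ := hB i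
    have h1 : (Submodule.Quotient.mk z : (Finset (Fin D) → A) ⧸ B) = B.mkQ (z - h.dif A w) := by
      rw [map_sub, Submodule.mkQ_apply, Submodule.mkQ_apply,
        (Submodule.Quotient.mk_eq_zero B (x := h.dif A w)).2 ⟨w, fun I _ => hw I, rfl⟩, sub_zero]
    rw [h1]
    have h2 := Submodule.mem_map_of_mem (f := B.mkQ) (mem_smul_top_pi
      (fun I => Ideal.pow_le_pow_right (show i ≤ j + 1 + i by omega) (hw' I)))
    rw [Submodule.map_smul''] at h2
    exact Submodule.smul_mono le_rfl le_top h2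
  obtain ⟨w, hw, hw'⟩ := hzB
  exact ⟨w, fun I => hw I trivial, hw'⟩

lemma smul_QRing_eq_zero {r : A} (hr : r ∈ maximalIdeal A) (q : QRing h.Fbar) : r • q = 0 := by
  rw [← algebraMap_smul (ResidueField A) r q, IsLocalRing.ResidueField.algebraMap_eq,
    (residue_eq_zero_iff r).2 hr, zero_smul]

lemma opSum_QRing_eq_zero {c : Fin D → A} (hc : ∀ l, c l ∈ maximalIdeal A) (α)
    (z : Finset (Fin D) → QRing h.Fbar) : opSum c α z = 0 := by
  rw [opSum_apply]
  refine Finset.sum_eq_zero fun l _ => ?_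
  ext1 I
  exact h.smul_QRing_eq_zero (hc l) _

/-- The leading form map on twisted Koszul homology of a power of the maximal ideal. -/
def symbT (n : ℕ) : h.T (maximalIdeal A ^ n : Ideal A) →ₗ[A] (Finset (Fin D) → QRing h.Fbar) :=
  h.lift (((h.symb n).compLeft (Finset (Fin D))).comp (Submodule.subtype _)) fun w => by
    change h.symb n ∘ h.dif _ w = 0
    rw [← ClData.dif_map, ClData.dif_apply, h.opSum_QRing_eq_zero h.x_mem,
      h.opSum_QRing_eq_zero fun l => Ideal.pow_le_self (by norm_num) (h.a_mem l), add_zero]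

lemma symbT_cls (n : ℕ) (z) (hz) : h.symbT n (h.cls z hz) = h.symb n ∘ z := rfl

lemma symbT_thetaT (n : ℕ) (l : Fin D) (t) :
    h.symbT n (h.thetaT (maximalIdeal A ^ n : Ideal A) l t) = contr l (h.symbT n t) := by
  obtain ⟨z, hz, rfl⟩ := h.exists_rep t
  rw [ClData.thetaT_cls, symbT_cls, symbT_cls, ← ClData.theta_map, ClData.theta_apply,
    h.opSum_QRing_eq_zero (h.b_mem l), sub_zero]

lemma val_dif {n : ℕ} (z : Finset (Fin D) → (maximalIdeal A ^ n : Ideal A)) :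
    h.dif A (fun I => (z I : A)) = fun I => (h.dif (maximalIdeal A ^ n : Ideal A) z I : A) :=
  h.dif_map (Submodule.subtype (maximalIdeal A ^ n)) z

lemma symbT_injective [IsNoetherianRing A] {n : ℕ} (hn : h.e ≤ n + 1) :
    Function.Injective (h.symbT n) := by
  rw [injective_iff_map_eq_zero]
  intro t ht
  obtain ⟨z, hz, rfl⟩ := h.exists_rep t
  rw [symbT_cls] at ht
  obtain ⟨w, hw, hwz⟩ := h.exists_dif_eq hn (z := fun I => (z I : A))
    (fun I => (h.symb_eq_zero_iff _).1 (congrFun ht I)) (by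
      rw [val_dif, hz]; rfl)
  refine h.cls_eq_zero.2 ⟨fun I => ⟨w I, hw I⟩, ?_⟩
  ext I
  have := congrFun (h.val_dif fun I => ⟨w I, hw I⟩) I
  rw [← this]
  exact congrFun hwz I

lemma mem_range_symbT {n : ℕ} (hn : h.e ≤ n) (Z) :
    (∃ t, h.symbT n t = Z) ↔ Z ∈ Kbar h.Fbar n := by
  constructor
  · rintro ⟨t, rfl⟩
    obtain ⟨z, hz, rfl⟩ := h.exists_rep t
    refine ⟨fun I => h.symb_mem _, ?_⟩
    ext1 I
    rw [symbT_cls]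
    refine (h.symb_dif (fun I => (z I).2) I).symm.trans ?_
    rw [Pi.zero_apply, symb_eq_zero_iff]
    simp only [val_dif, hz]
    exact zero_mem _
  · rintro ⟨hZ, hZ0⟩
    obtain ⟨n, rfl⟩ : ∃ m, n = m + 1 := ⟨n - 1, by have := h.he; omega⟩
    obtain ⟨W, hW, rfl⟩ := exists_contr_eq_of_le (by have := h.he; omega) h.Fbar_homog h.map_F hn
      hZ hZ0
    choose w hw using fun I => h.exists_symb (hW I)
    refine ⟨h.cls (fun I => ⟨_, h.dif_mem_pow (fun I => (w I).2) I⟩) ?_, ?_⟩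
    · ext I
      have := congrFun (h.val_dif fun I => ⟨_, h.dif_mem_pow (fun I => (w I).2) I⟩) I
      rw [← this]
      exact congrFun (h.dif_dif fun I => (w I : A)) I
    · rw [symbT_cls]
      ext1 I
      rw [Function.comp_apply, h.symb_dif (fun I => (w I).2) I]
      simp only [Subtype.coe_eta, hw]

theorem tIdem_pow [IsNoetherianRing A] (hD : 3 ≤ D) {n : ℕ} (hn : h.e ≤ n) :
    h.TIdem (maximalIdeal A ^ n : Ideal A) := by
  intro ψ hψ hi
  exact eq_zero_or_eq_one_of_idempotent hD (by have := h.he; omega) h.Fbar_homog h.map_F n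
    (A := A) (by rw [IsLocalRing.ResidueField.algebraMap_eq]; exact residue_surjective)
    (h.symbT n) (h.symbT_injective (by omega)) (h.mem_range_symbT hn)
    (fun l t => h.thetaT (maximalIdeal A ^ n : Ideal A) l t) (h.symbT_thetaT n) ψ hψ hi

end HypData

end Powers

/-! ### Hypersurface data from a regular local ring -/

section Construct

open MvPolynomial

variable {S : Type u} [CommRing S] [IsLocalRing S] {D : ℕ} {x : Fin D → S}

lemma map_residue_eq_zero_iff (hx : QuasiReg x) (hs : Ideal.span (Set.range x) = maximalIdeal S)
    {j : ℕ} {G : MvPolynomial (Fin D) S} (hG : G.IsHomogeneous j) :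
    map (residue S) G = 0 ↔ eval x G ∈ maximalIdeal S ^ (j + 1) := by
  have h1 : map (residue S) G = 0 ↔ ∀ a, coeff a G ∈ maximalIdeal S :=
    map_mk_eq_zero_iff (maximalIdeal S) G
  rw [h1]
  constructor
  · intro h
    have := eval_mem_of_coeff_mem x hG h
    rwa [hs, ← pow_succ'] at this
  · intro h
    rw [← hs] at h ⊢
    exact coeff_mem_of_eval_mem (hx j) hG h

lemma mem_pow_iff_exists_form (hs : Ideal.span (Set.range x) = maximalIdeal S) {j : ℕ} {z : S} :
    z ∈ maximalIdeal S ^ j ↔ ∃ G : MvPolynomial (Fin D) S, G.IsHomogeneous j ∧ eval x G = z := by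
  rw [← hs]; exact Ideal.mem_span_pow_iff_exists_isHomogeneous x z

lemma mem_pow_of_mul_mem_pow (hx : QuasiReg x) (hs : Ideal.span (Set.range x) = maximalIdeal S)
    {e : ℕ} {F : MvPolynomial (Fin D) S} (hF : F.IsHomogeneous e) (hF0 : map (residue S) F ≠ 0)
    {g : S} {i : ℕ} (h : eval x F * g ∈ maximalIdeal S ^ (e + i)) : g ∈ maximalIdeal S ^ i := by
  induction i with
  | zero => simp
  | succ i ih =>
    obtain ⟨H, hH, rfl⟩ := (mem_pow_iff_exists_form hs).1
      (ih (Ideal.pow_le_pow_right (by omega) h))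
    rw [← map_mul, ← add_assoc, ← map_residue_eq_zero_iff hx hs (hF.mul hH), map_mul,
      mul_eq_zero, or_iff_right hF0, map_residue_eq_zero_iff hx hs hH] at h
    exact h

lemma dvd_of_eval_sub_mul_mem (hx : QuasiReg x) (hs : Ideal.span (Set.range x) = maximalIdeal S)
    {e : ℕ} {F : MvPolynomial (Fin D) S} (hF : F.IsHomogeneous e) (hF0 : map (residue S) F ≠ 0)
    {j : ℕ} {G : MvPolynomial (Fin D) S} (hG : G.IsHomogeneous j) {g : S}
    (h : eval x G - eval x F * g ∈ maximalIdeal S ^ (j + 1)) :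
    map (residue S) F ∣ map (residue S) G := by
  have hG' := (mem_pow_iff_exists_form hs).2 ⟨G, hG, rfl⟩
  have hF' := (mem_pow_iff_exists_form hs).2 ⟨F, hF, rfl⟩
  rcases lt_or_ge j e with hj | hj
  · rw [(map_residue_eq_zero_iff hx hs hG).2]
    · exact dvd_zero _
    · have h2 : eval x F * g ∈ maximalIdeal S ^ (j + 1) :=
        Ideal.mul_mem_right _ _ (Ideal.pow_le_pow_right (by omega) hF')
      simpa using add_mem h h2
  · obtain ⟨i, rfl⟩ := Nat.exists_eq_add_of_le hj
    have h2 : eval x F * g ∈ maximalIdeal S ^ (e + i) := by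
      have := sub_mem hG' (Ideal.pow_le_pow_right (Nat.le_succ _) h)
      simpa using this
    obtain ⟨H, hH, rfl⟩ := (mem_pow_iff_exists_form hs).1
      (mem_pow_of_mul_mem_pow hx hs hF hF0 h2)
    rw [← map_mul, ← map_sub, ← map_residue_eq_zero_iff hx hs (hG.sub (hF.mul hH)), map_sub,
      map_mul, sub_eq_zero] at h
    exact ⟨_, h⟩

lemma opSum_wedge_semilinear {D : ℕ} {R R' Z Z' : Type*} [CommRing R] [CommRing R']
    [AddCommGroup Z] [AddCommGroup Z'] [Module R Z] [Module R' Z'] (g : Z →+ Z') {c : Fin D → R}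
    {c' : Fin D → R'} (hg : ∀ l z, g (c l • z) = c' l • g z) (z : Finset (Fin D) → Z) :
    opSum c' wedge (g ∘ z) = g ∘ opSum c wedge z := by
  ext I
  simp only [opSum_apply, wedge_map, Finset.sum_apply, Pi.smul_apply, Function.comp_apply, map_sum,
    hg]

lemma exists_sum_mul_of_mem_pow (hs : Ideal.span (Set.range x) = maximalIdeal S) {j : ℕ} {z : S}
    (hz : z ∈ maximalIdeal S ^ (j + 1)) :
    ∃ c : Fin D → S, (∀ l, c l ∈ maximalIdeal S ^ j) ∧ z = ∑ l, c l * x l := by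
  have h : z ∈ (maximalIdeal S ^ j) • Submodule.span S (Set.range x) := by
    change z ∈ (maximalIdeal S ^ j) • Ideal.span (Set.range x)
    rwa [hs, smul_eq_mul, ← pow_succ]
  obtain ⟨c, hc, rfl⟩ := (Submodule.mem_ideal_smul_span_iff_exists_sum _ x z).1 h
  exact ⟨c, hc, Finsupp.sum_fintype _ _ fun i => by simp⟩

theorem exists_hypData [IsNoetherianRing S] {A : Type u} [CommRing A] [IsLocalRing A]
    (π : S →+* A) (hπ : Function.Surjective π) {f : S} (hker : RingHom.ker π = Ideal.span {f})
    (hx : IsRegSys x) {e : ℕ} (he : 3 ≤ e) (hf : f ∈ maximalIdeal S ^ e)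
    (hf' : f ∉ maximalIdeal S ^ (e + 1)) :
    ∃ h : HypData A D, h.e = e ∧ h.x = π ∘ x := by
  have hs := hx.span_eq
  have hq := hx.quasiReg
  have hdom : IsDomain S := hx.isDomain
  have : IsLocalHom π := IsLocalHom.of_surjective π hπ
  have hπf : π f = 0 := by
    rw [← RingHom.mem_ker, hker]; exact Ideal.mem_span_singleton_self f
  have hf0 : f ≠ 0 := fun h => hf' (h ▸ zero_mem _)
  have hmap : (maximalIdeal S).map π = maximalIdeal A := map_maximalIdeal_of_surjective π hπ
  have hmem : ∀ {j z}, z ∈ maximalIdeal S ^ j → π z ∈ maximalIdeal A ^ j := fun {j z} hz => by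
    rw [← hmap, ← Ideal.map_pow]; exact Ideal.mem_map_of_mem _ hz
  obtain ⟨F, hF, rfl⟩ := (mem_pow_iff_exists_form hs).1 hf
  have hF0 : map (residue S) F ≠ 0 := by
    rwa [Ne, map_residue_eq_zero_iff hq hs hF]
  obtain ⟨a, ha, hfa⟩ := exists_sum_mul_of_mem_pow hs
    (Ideal.pow_le_pow_right (show 2 + 1 ≤ e by omega) hf)
  choose b hb hab using fun l => exists_sum_mul_of_mem_pow (j := 1) hs (ha l)
  have hres : ∀ G : MvPolynomial (Fin D) S, map (residue A) (map π G) =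
      map (ResidueField.map π) (map (residue S) G) := fun G => by
    rw [map_map, map_map]; rfl
  have heval : ∀ G : MvPolynomial (Fin D) S, eval (π ∘ x) (map π G) = π (eval x G) := fun G => by
    rw [eval_map, eval₂_comp]
  have hinj : Function.Injective (map (σ := Fin D) (ResidueField.map π)) :=
    map_injective _ (ResidueField.map π).injective
  refine ⟨{
    x := π ∘ x
    a := π ∘ a
    b := fun l m => π (b l m)
    hab := fun l => ?_
    hxa := ?_
    F := map π F
    e := e
    he := he
    hF := hF.map _
    eval_F := by rw [heval, hπf]
    map_F := ?_
    span_eq := by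
      rw [← hmap, ← hs, Ideal.map_span, Set.range_comp]
    sym := ?_
    a_mem := fun l => hmem (ha l)
    b_mem := fun l m => by simpa using hmem (hb l m)
    acyc := ?_ }, rfl, rfl⟩
  · rw [Function.comp_apply, hab, map_sum]; simp
  · rw [← hπf, hfa, map_sum]
    exact Finset.sum_congr rfl fun l _ => by rw [map_mul, mul_comm]; rfl
  · rw [hres]
    exact fun h => hF0 (hinj (h.trans (map_zero _).symm))
  · intro j G hG h
    obtain ⟨G, hG', rfl⟩ := exists_homogeneous_lift π hπ hG
    rw [heval, ← hmap, ← Ideal.map_pow, Ideal.mem_map_iff_of_surjective π hπ] at h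
    obtain ⟨y, hy, hyG⟩ := h
    rw [← sub_eq_zero, ← map_sub, ← RingHom.mem_ker, hker, Ideal.mem_span_singleton] at hyG
    obtain ⟨g, hg⟩ := hyG
    rw [hres, hres]
    refine map_dvd _ (dvd_of_eval_sub_mul_mem hq hs hF hF0 hG' (g := -g) ?_)
    rwa [mul_neg, ← hg, sub_neg_eq_add, add_sub_cancel]
  · have hd : ∀ w : Finset (Fin D) → S, π ∘ (opSum x contr w + opSum a wedge w) =
        opSum (π ∘ x) contr (π ∘ w) + opSum (π ∘ a) wedge (π ∘ w) := by
      intro w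
      have h1 := opSum_contr_semilinear π.toAddMonoidHom (c := x) (c' := π ∘ x)
        (fun l z => by simp) w
      have h2 := opSum_wedge_semilinear π.toAddMonoidHom (c := a) (c' := π ∘ a)
        (fun l z => by simp) w
      simp only [RingHom.toAddMonoidHom_eq_coe, AddMonoidHom.coe_coe] at h1 h2
      rw [h1, h2]
      ext; simp
    intro z hz
    rw [ClData.dif_apply] at hz
    choose z' hz' using fun I => hπ (z I)
    obtain rfl : π ∘ z' = z := funext hz'
    rw [← hd] at hz
    have h1 : ∀ I, ∃ w, (opSum x contr z' + opSum a wedge z') I = eval x F * w := fun I => by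
      have := congrFun hz I
      rwa [Function.comp_apply, Pi.zero_apply, ← RingHom.mem_ker, hker,
        Ideal.mem_span_singleton] at this
    choose w hw using h1
    have h2 : opSum x contr z' + opSum a wedge z' = eval x F • w := funext hw
    have hxa : ∑ l, x l * a l = eval x F := by
      rw [hfa]; exact Finset.sum_congr rfl fun l _ => mul_comm _ _
    have h3 : eval x F • z' = eval x F • (opSum x contr w + opSum a wedge w) := by
      rw [← hxa, ← opSum_contr_wedge, hxa, smul_add, ← opSum_contr_smul, ← opSum_wedge_smul, ← h2,
        map_add, map_add, opSum_contr_opSum_contr, opSum_wedge_opSum_wedge, zero_add, add_zero]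
    refine ⟨π ∘ w, ?_⟩
    rw [ClData.dif_apply, ← hd, smul_right_injective _ hf0 h3]

end Construct

/-! ### Regular sequences and syzygies -/

section RegSeq

open RingTheory.Sequence

variable {R : Type u} [CommRing R]

lemma quotSMulTop_map_injective {K F M : Type u} [AddCommGroup K] [Module R K] [AddCommGroup F]
    [Module R F] [AddCommGroup M] [Module R M] {i : K →ₗ[R] F} {p : F →ₗ[R] M}
    (hi : Function.Injective i) (hip : Function.Exact i p) {r : R} (hr : IsSMulRegular M r) :
    Function.Injective (QuotSMulTop.map r i) := by
  have h0 : Function.Exact (0 : PUnit.{u + 1} →ₗ[R] K) i :=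
    (LinearMap.exact_zero_iff_injective _ _).2 hi
  have := QuotSMulTop.map_first_exact_on_four_term_exact_of_isSMulRegular_last h0 hip hr
  rw [map_zero] at this
  exact (LinearMap.exact_zero_iff_injective _ _).1 this

/-- Depth lemma: one more element is regular on the kernel than on the cokernel. -/
theorem IsWeaklyRegular.ker {r : R} {rs : List R} :
    ∀ {K F M : Type u} [AddCommGroup K] [Module R K] [AddCommGroup F]
    [Module R F] [AddCommGroup M] [Module R M] (i : K →ₗ[R] F) (p : F →ₗ[R] M),
    Function.Injective i → Function.Surjective p → Function.Exact i p →
    IsWeaklyRegular F (rs ++ [r]) → IsWeaklyRegular M rs → IsWeaklyRegular K (rs ++ [r]) := by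
  induction rs with
  | nil =>
    intro K F M _ _ _ _ _ _ i p hi hp hip hF hM
    rw [List.nil_append, isWeaklyRegular_singleton_iff] at hF ⊢
    exact hF.of_injective i hi
  | cons a rs ih =>
    intro K F M _ _ _ _ _ _ i p hi hp hip hF hM
    rw [List.cons_append, isWeaklyRegular_cons_iff] at hF ⊢
    rw [isWeaklyRegular_cons_iff] at hM
    exact ⟨hF.1.of_injective i hi, ih _ _ (quotSMulTop_map_injective hi hip hM.1)
      (QuotSMulTop.map_surjective a hp) (QuotSMulTop.map_exact a hip hp) hF.2 hM.2⟩

lemma mem_smul_top_of_exact {K F M : Type u} [AddCommGroup K] [Module R K] [AddCommGroup F]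
    [Module R F] [AddCommGroup M] [Module R M] {i : K →ₗ[R] F} {p : F →ₗ[R] M}
    (hi : Function.Injective i) (hp : Function.Surjective p) (hip : Function.Exact i p)
    {rs : List R} (hM : IsWeaklyRegular M rs) {k : K}
    (hk : i k ∈ Ideal.ofList rs • (⊤ : Submodule R F)) :
    k ∈ Ideal.ofList rs • (⊤ : Submodule R K) := by
  have h0 : Function.Exact (0 : PUnit.{u + 1} →ₗ[R] K) i :=
    (LinearMap.exact_zero_iff_injective _ _).2 hi
  have h1 := map_first_exact_on_four_term_right_exact_of_isSMulRegular_last h0 hip hp hM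
  rw [← Submodule.Quotient.mk_eq_zero]
  obtain ⟨y, hy⟩ := (h1 (Submodule.Quotient.mk k)).1 (by
    rw [Submodule.mapQ_apply, Submodule.Quotient.mk_eq_zero]; exact hk)
  obtain ⟨y, rfl⟩ := Submodule.Quotient.mk_surjective _ y
  rw [← hy, Submodule.mapQ_apply, LinearMap.zero_apply, Submodule.Quotient.mk_zero]

lemma IsWeaklyRegular.retract {rs : List R} :
    ∀ {B M : Type u} [AddCommGroup B] [Module R B] [AddCommGroup M] [Module R M]
    (i : B →ₗ[R] M) (p : M →ₗ[R] B), p.comp i = LinearMap.id →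
    IsWeaklyRegular M rs → IsWeaklyRegular B rs := by
  induction rs with
  | nil => intros; exact .nil _ _
  | cons a rs ih =>
    intro B M _ _ _ _ i p h hM
    rw [isWeaklyRegular_cons_iff] at hM ⊢
    refine ⟨hM.1.of_injective i fun x y hxy => ?_, ih (QuotSMulTop.map a i) (QuotSMulTop.map a p)
      ?_ hM.2⟩
    · simpa [← LinearMap.comp_apply, h] using congrArg p hxy
    · rw [← QuotSMulTop.map_comp, h, QuotSMulTop.map_id]

lemma IsWeaklyRegular.pi {rs : List R} (h : IsWeaklyRegular R rs) (n : ℕ) :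
    IsWeaklyRegular (Fin n → R) rs :=
  ((TensorProduct.piScalarRight R R R (Fin n)).symm.trans
    (TensorProduct.comm R R (Fin n → R))).isWeaklyRegular_congr rs |>.2 h.isWeaklyRegular_lTensor

lemma IsMinimalSyzygyOf.isWeaklyRegular [IsLocalRing R] {rs : List R} (h : IsWeaklyRegular R rs)
    {C : Type u} [AddCommGroup C] [Module R C] :
    ∀ (i : ℕ) {N : Type u} [AddCommGroup N] [Module R N],
    IsMinimalSyzygyOf R i N C → IsWeaklyRegular N (rs.take i)
  | 0, N, _, _, _ => by rw [List.take_zero]; exact .nil _ _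
  | i + 1, N, _, _, ⟨K, _, _, hK, n, π, hπ, _, ⟨ε⟩⟩ => by
    have h1 := IsMinimalSyzygyOf.isWeaklyRegular h i hK
    have h2 : IsWeaklyRegular (Fin n → R) (rs.take (i + 1)) := by
      refine IsWeaklyRegular.pi ?_ n
      rw [← List.take_append_drop (i + 1) rs, isWeaklyRegular_append_iff] at h
      exact h.1
    rw [ε.isWeaklyRegular_congr]
    rcases List.eq_nil_or_concat (rs.take (i + 1)) with h3 | ⟨l, r, h3⟩
    · rw [h3]; exact .nil _ _
    · rw [List.concat_eq_append] at h3
      rw [h3] at h2 ⊢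
      refine IsWeaklyRegular.ker (LinearMap.ker π).subtype π (Submodule.subtype_injective _) hπ
        (LinearMap.exact_subtype_ker_map π) h2 ?_
      have h4 : rs.take i = l ++ [r].take (i - l.length) := by
        have h5 : rs.take i = (rs.take (i + 1)).take i := by
          rw [List.take_take, min_eq_left (Nat.le_succ i)]
        have h6 : l.length ≤ i := by
          have := congrArg List.length h3
          simp at this
          omega
        rw [h5, h3, List.take_append, List.take_of_length_le h6]
      rw [h4, isWeaklyRegular_append_iff] at h1
      exact h1.1

lemma IsMinimalSyzygyOf.finite [IsLocalRing R] [IsNoetherianRing R]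
    {C : Type u} [AddCommGroup C] [Module R C] [Module.Finite R C] :
    ∀ (i : ℕ) {N : Type u} [AddCommGroup N] [Module R N],
    IsMinimalSyzygyOf R i N C → Module.Finite R N
  | 0, _, _, _, ⟨ε⟩ => Module.Finite.equiv ε.symm
  | _ + 1, _, _, _, ⟨_, _, _, _, _, _, _, _, ⟨ε⟩⟩ => Module.Finite.equiv ε.symm

end RegSeq

/-! ### Rigidity of syzygies -/

section Rigid

open RingTheory.Sequence
open scoped Pointwise

namespace ClData

variable {A : Type u} [CommRing A] {D : ℕ} {c : ClData A D}

variable (c) in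
/-- Isomorphic modules have isomorphic twisted Koszul homology. -/
def mapEquiv {Z Z' : Type u} [AddCommGroup Z] [Module A Z] [AddCommGroup Z'] [Module A Z']
    (ε : Z ≃ₗ[A] Z') : c.T Z ≃ₗ[A] c.T Z' :=
  { c.map ε.toLinearMap with
    invFun := c.map ε.symm.toLinearMap
    left_inv := fun t => by
      change c.map ε.symm.toLinearMap (c.map ε.toLinearMap t) = t
      rw [← c.map_comp, LinearEquiv.comp_coe, LinearEquiv.self_trans_symm]
      exact c.map_id t
    right_inv := fun t => by
      change c.map ε.toLinearMap (c.map ε.symm.toLinearMap t) = t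
      rw [← c.map_comp, LinearEquiv.comp_coe, LinearEquiv.symm_trans_self]
      exact c.map_id t }

lemma acyc_iff_subsingleton {Z : Type u} [AddCommGroup Z] [Module A Z] :
    c.Acyc Z ↔ Subsingleton (c.T Z) := by
  refine ⟨fun h => ⟨fun s t => ?_⟩, fun h z hz => c.cls_eq_zero.1 (Subsingleton.elim (c.cls z hz) 0)⟩
  have : ∀ t : c.T Z, t = 0 := fun t => by
    obtain ⟨z, hz, rfl⟩ := c.exists_rep t
    exact c.cls_eq_zero.2 (h z hz)
  rw [this s, this t]

lemma Acyc.quotSMulTop {Z : Type u} [AddCommGroup Z] [Module A Z] (h : c.Acyc Z) {r : A}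
    (hr : IsSMulRegular Z r) : c.Acyc (QuotSMulTop r Z) := by
  have hex : Function.Exact (LinearMap.lsmul A Z r) (Submodule.mkQ (r • (⊤ : Submodule A Z))) := by
    intro z
    rw [← LinearMap.mem_ker, Submodule.ker_mkQ, Submodule.mem_smul_pointwise_iff_exists]
    simp
  obtain ⟨ε, -⟩ := c.exists_connecting (LinearMap.lsmul A Z r) (Submodule.mkQ _) hr
    (Submodule.mkQ_surjective _) hex h
  rw [acyc_iff_subsingleton] at h ⊢
  exact ε.symm.injective.subsingleton

lemma Acyc.quot_ofList {rs : List A} : ∀ {Z : Type u} [AddCommGroup Z] [Module A Z],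
    c.Acyc Z → IsWeaklyRegular Z rs → c.Acyc (Z ⧸ Ideal.ofList rs • (⊤ : Submodule A Z)) := by
  induction rs with
  | nil =>
    intro Z _ _ h _
    exact h.of_equiv (Submodule.quotEquivOfEqBot _ (by rw [Ideal.ofList_nil, Submodule.bot_smul])).symm
  | cons r rs ih =>
    intro Z _ _ h hr
    rw [isWeaklyRegular_cons_iff] at hr
    exact (ih (h.quotSMulTop hr.1) hr.2).of_equiv
      (Submodule.quotOfListConsSMulTopEquivQuotSMulTopInner Z r rs).symm

lemma Acyc.eq_zero_of_smul_eq_zero [IsLocalRing A] {Z : Type u} [AddCommGroup Z] [Module A Z]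
    [Module.Finite A Z] (h : c.Acyc Z) (hx : ∀ l, c.x l ∈ maximalIdeal A)
    (ha : ∀ l, c.a l ∈ maximalIdeal A) (m : Fin D)
    (h1 : ∀ l, l ≠ m → ∀ z : Z, c.x l • z = 0) (h2 : ∀ z : Z, c.a m • z = 0) :
    Subsingleton Z := by
  have key : ∀ z : Z, z ∈ maximalIdeal A • (⊤ : Submodule A Z) := by
    intro z
    let I₀ : Finset (Fin D) := {m}ᶜ
    obtain ⟨w, hw⟩ := h (Pi.single I₀ z) (by
      rw [dif_apply, opSum_apply, opSum_apply]
      rw [Finset.sum_eq_zero, Finset.sum_eq_zero, add_zero]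
      · rintro l -
        ext I
        rw [Pi.smul_apply, wedge_apply]
        split_ifs with hl
        · rw [smul_comm, Pi.single_apply]
          split_ifs with hI
          · obtain rfl : l = m := by
              by_contra hlm
              have : l ∈ I.erase l := by rw [hI]; simpa [I₀] using hlm
              simp at this
            rw [h2, smul_zero]; rfl
          · rw [smul_zero, smul_zero]; rfl
        · rw [smul_zero]; rfl
      · rintro l -
        ext I
        rw [Pi.smul_apply, contr_apply]
        split_ifs with hl
        · rw [smul_zero]; rfl
        · rw [smul_comm, Pi.single_apply]
          split_ifs with hI
          · have : l ≠ m := by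
              rintro rfl
              have := Finset.mem_insert_self l I
              rw [hI] at this
              simp [I₀] at this
            rw [h1 l this, smul_zero]; rfl
          · rw [smul_zero, smul_zero]; rfl)
    have h3 := congrFun hw I₀
    rw [Pi.single_eq_same] at h3
    rw [← h3, dif_apply, opSum_apply, opSum_apply, Pi.add_apply, Finset.sum_apply,
      Finset.sum_apply]
    exact add_mem (sum_mem fun l _ => Submodule.smul_mem_smul (hx l) trivial)
      (sum_mem fun l _ => Submodule.smul_mem_smul (ha l) trivial)
  have h4 : (⊤ : Submodule A Z) = ⊥ := Submodule.eq_bot_of_le_smul_of_le_jacobson_bot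
    (maximalIdeal A) ⊤ Module.Finite.fg_top (fun z _ => key z) (maximalIdeal_le_jacobson _)
  exact (Submodule.subsingleton_iff A).1 (subsingleton_of_bot_eq_top h4.symm)

/-- An acyclic quotient of a module on which `a m` acts through the regular sequence vanishes. -/
lemma Acyc.subsingleton [IsLocalRing A] {N B : Type u} [AddCommGroup N] [Module A N]
    [AddCommGroup B] [Module A B] [Module.Finite A B] (h : c.Acyc B)
    (hx : ∀ l, c.x l ∈ maximalIdeal A)
    (ha : ∀ l, c.a l ∈ maximalIdeal A) (m : Fin D) {rs : List A} (hrs : IsWeaklyRegular B rs)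
    (h1 : ∀ l, l ≠ m → c.x l ∈ rs) (h1' : ∀ r ∈ rs, r ∈ maximalIdeal A)
    (h2 : ∀ z : N, c.a m • z ∈ Ideal.ofList rs • (⊤ : Submodule A N))
    (q : N →ₗ[A] B) (hq : Function.Surjective q) : Subsingleton B := by
  have h3 := (h.quot_ofList hrs).eq_zero_of_smul_eq_zero hx ha m (fun l hl z => by
    obtain ⟨z, rfl⟩ := Submodule.Quotient.mk_surjective _ z
    rw [← Submodule.Quotient.mk_smul, Submodule.Quotient.mk_eq_zero]
    exact Submodule.smul_mem_smul (Ideal.subset_span (h1 l hl)) trivial) (fun z => by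
    obtain ⟨z, rfl⟩ := Submodule.Quotient.mk_surjective _ z
    obtain ⟨z, rfl⟩ := hq z
    rw [← Submodule.Quotient.mk_smul, Submodule.Quotient.mk_eq_zero, ← map_smul]
    exact Submodule.smul_top_le_comap_smul_top _ _ (h2 z))
  rw [Submodule.Quotient.subsingleton_iff] at h3
  have h4 : (⊤ : Submodule A B) = ⊥ := Submodule.eq_bot_of_le_smul_of_le_jacobson_bot
    (Ideal.ofList rs) ⊤ Module.Finite.fg_top h3.ge
    ((Ideal.span_le.2 h1').trans (maximalIdeal_le_jacobson _))
  exact (Submodule.subsingleton_iff A).1 (subsingleton_of_bot_eq_top h4.symm)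

/-- Idempotents of `N` that are trivial on homology are trivial. -/
lemma TIdem.idempotent [IsLocalRing A] [IsNoetherianRing A] {N : Type u} [AddCommGroup N]
    [Module A N] [Module.Finite A N] (h : c.TIdem N)
    (hx : ∀ l, c.x l ∈ maximalIdeal A)
    (ha : ∀ l, c.a l ∈ maximalIdeal A) (m : Fin D) {rs : List A} (hrs : IsWeaklyRegular N rs)
    (h1 : ∀ l, l ≠ m → c.x l ∈ rs) (h1' : ∀ r ∈ rs, r ∈ maximalIdeal A)
    (h2 : ∀ z : N, c.a m • z ∈ Ideal.ofList rs • (⊤ : Submodule A N))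
    (φ : N →ₗ[A] N) (hφ : ∀ z, φ (φ z) = φ z) : φ = 0 ∨ φ = LinearMap.id := by
  have key : ∀ φ : N →ₗ[A] N, (∀ z, φ (φ z) = φ z) → (∀ t, c.map φ t = 0) → φ = 0 := by
    intro φ hφ ht
    have hid : φ.rangeRestrict.comp (LinearMap.range φ).subtype = LinearMap.id := by
      ext ⟨_, z, rfl⟩
      exact hφ z
    have hB : c.Acyc (LinearMap.range φ) := by
      intro z hz
      have h4 : c.dif N ((LinearMap.range φ).subtype ∘ z) = 0 := by
        rw [dif_map, hz]; ext; simp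
      have h5 := ht (c.cls _ h4)
      rw [map_cls, cls_eq_zero] at h5
      obtain ⟨w, hw⟩ := h5
      refine ⟨φ.rangeRestrict ∘ w, ?_⟩
      rw [dif_map, hw]
      ext I
      obtain ⟨y, hy⟩ := (z I).2
      simp [← hy, hφ]
    have h5 := hB.subsingleton hx ha m (IsWeaklyRegular.retract _ _ hid hrs) h1 h1' h2
      φ.rangeRestrict φ.surjective_rangeRestrict
    ext z
    exact congrArg Subtype.val (Subsingleton.elim (φ.rangeRestrict z) 0)
  rcases h (c.map φ) (fun l t => c.map_thetaT φ l t) (fun t => by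
    rw [← map_comp, show φ.comp φ = φ from LinearMap.ext hφ]) with h3 | h3
  · exact Or.inl (key φ hφ h3)
  · right
    have := key (LinearMap.id - φ) (fun z => by simp [hφ]) (fun t => by
      obtain ⟨z, hz, rfl⟩ := c.exists_rep t
      have := h3 (c.cls z hz)
      rw [map_cls, ← sub_eq_zero, ← neg_sub, neg_eq_zero, sub_eq_add_neg, neg_cls, cls_add] at this
      rw [map_cls, ← this]
      refine c.cls_congr ?_
      ext I
      simp [sub_eq_add_neg])
    exact (sub_eq_zero.1 this).symm

end ClData

lemma IsMinimalSyzygyOf.tIdem {A : Type u} [CommRing A] [IsLocalRing A] {D : ℕ}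
    {c : ClData A D} (hA : c.Acyc A) {C : Type u} [AddCommGroup C] [Module A C] (hC : c.TIdem C) :
    ∀ (i : ℕ) {N : Type u} [AddCommGroup N] [Module A N],
    IsMinimalSyzygyOf A i N C → c.TIdem N ∧ Nonempty (c.T N ≃ₗ[A] c.T C)
  | 0, N, _, _, ⟨ε⟩ => by
    exact ⟨ClData.TIdem.of_equiv c hC (c.mapEquiv ε.symm) 1 fun l t => by
      simpa using! c.map_thetaT ε.symm.toLinearMap l t, ⟨c.mapEquiv ε⟩⟩
  | i + 1, N, _, _, ⟨K, _, _, hK, n, π, hπ, _, ⟨ε⟩⟩ => by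
    obtain ⟨h1, ⟨h2⟩⟩ := IsMinimalSyzygyOf.tIdem hA hC i hK
    obtain ⟨δ, hδ⟩ := c.exists_connecting ((LinearMap.ker π).subtype.comp ε.toLinearMap) π
      ((Submodule.subtype_injective _).comp ε.injective) hπ
      (fun z => by
        rw [LinearMap.exact_subtype_ker_map π z, LinearMap.coe_comp]
        exact (ε.surjective.range_comp _ ▸ Iff.rfl)) hA.pi
    refine ⟨ClData.TIdem.of_equiv c h1 δ.symm (-1) fun l t => ?_, ⟨δ.trans h2⟩⟩
    apply δ.injective
    simp [hδ]

variable {A : Type u} [CommRing A] [IsLocalRing A]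

lemma HypData.a_mul_mem {D : ℕ} (h : HypData A D) {m : Fin D} {J : Ideal A}
    (h1 : ∀ l, l ≠ m → h.x l ∈ J) {y : A} (hy : y ∈ maximalIdeal A) : h.a m * y ∈ J := by
  rw [← h.span_eq] at hy
  induction hy using Submodule.span_induction with
  | mem y hy =>
    obtain ⟨l, rfl⟩ := hy
    by_cases hl : l = m
    · subst hl
      have := h.hxa
      rw [← Finset.add_sum_erase _ _ (Finset.mem_univ l)] at this
      rw [mul_comm, eq_neg_of_add_eq_zero_left this]
      exact J.neg_mem (J.sum_mem fun i hi => J.mul_mem_right _ (h1 i (Finset.ne_of_mem_erase hi)))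
    · exact J.mul_mem_left _ (h1 l hl)
  | zero => simp
  | add y z _ _ hy hz => rw [mul_add]; exact J.add_mem hy hz
  | smul r y _ hy => rw [smul_eq_mul, mul_left_comm]; exact J.mul_mem_left _ hy

lemma HypData.a_smul_mem {D : ℕ} (h : HypData A D) {m : Fin D} {rs : List A}
    (hrs : IsWeaklyRegular A rs) (h1 : ∀ l, l ≠ m → h.x l ∈ rs)
    {C : Type u} [AddCommGroup C] [Module A C] {N : Type u} [AddCommGroup N] [Module A N]
    (hN : IsMinimalSyzygyOf A (rs.length + 1) N C) (z : N) :
    h.a m • z ∈ Ideal.ofList rs • (⊤ : Submodule A N) := by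
  obtain ⟨K, _, _, hK, n, π, hπ, hm, ⟨ε⟩⟩ := hN
  have hK := IsMinimalSyzygyOf.isWeaklyRegular hrs _ hK
  rw [List.take_length] at hK
  refine mem_smul_top_of_exact (i := (LinearMap.ker π).subtype.comp ε.toLinearMap) (p := π)
    ((Submodule.subtype_injective _).comp ε.injective) hπ (fun z => by
      rw [LinearMap.exact_subtype_ker_map π z, LinearMap.coe_comp]
      exact (ε.surjective.range_comp _ ▸ Iff.rfl)) hK ?_
  rw [map_smul]
  have := hm (ε z).2
  refine Submodule.smul_induction_on (p := fun w => h.a m • w ∈ Ideal.ofList rs • ⊤) this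
    (fun y hy v _ => ?_) (fun v w hv hw => ?_)
  · rw [smul_smul]
    exact Submodule.smul_mem_smul (h.a_mul_mem (fun l hl => Ideal.subset_span (h1 l hl)) hy) trivial
  · rw [smul_add]; exact add_mem hv hw

lemma HypData.a_mem_maximalIdeal {D : ℕ} (h : HypData A D) (l : Fin D) :
    h.a l ∈ maximalIdeal A := Ideal.pow_le_self two_ne_zero (h.a_mem l)

lemma HypData.x_mem_maximalIdeal {D : ℕ} (h : HypData A D) (l : Fin D) :
    h.x l ∈ maximalIdeal A := h.span_eq ▸ Ideal.subset_span ⟨l, rfl⟩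

section Syzygy

variable {D : ℕ} (h : HypData A D)

/-- A high syzygy admits no surjection onto the ring. -/
lemma HypData.not_surjective {m : Fin D} {rs : List A}
    (hrs : IsWeaklyRegular A rs) (h1 : ∀ l, l ≠ m → h.x l ∈ rs)
    (h1' : ∀ r ∈ rs, r ∈ maximalIdeal A) {C : Type u} [AddCommGroup C] [Module A C]
    {N : Type u} [AddCommGroup N] [Module A N]
    (hN : IsMinimalSyzygyOf A (rs.length + 1) N C) (q : N →ₗ[A] A) : ¬ Function.Surjective q := by
  intro hq
  have := h.acyc.subsingleton h.x_mem_maximalIdeal h.a_mem_maximalIdeal m hrs h1 h1'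
    (h.a_smul_mem hrs h1 hN) q hq
  exact not_subsingleton A this

lemma HypData.tIdem_quot [IsNoetherianRing A] (hD : 3 ≤ D) {n : ℕ} (hn : h.e ≤ n) :
    h.TIdem (A ⧸ maximalIdeal A ^ n) ∧
      Nonempty (h.T (A ⧸ maximalIdeal A ^ n) ≃ₗ[A] h.T ↥(maximalIdeal A ^ n)) := by
  obtain ⟨δ, hδ⟩ := h.exists_connecting (Submodule.subtype (maximalIdeal A ^ n))
    (Submodule.mkQ _) (Submodule.subtype_injective _) (Submodule.mkQ_surjective _)
    (LinearMap.exact_subtype_mkQ _) h.acyc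
  exact ⟨ClData.TIdem.of_equiv _ (h.tIdem_pow hD hn) δ (-1) fun l t => by simp [hδ], ⟨δ.symm⟩⟩

/-- High syzygies of large powers of the maximal ideal have no nontrivial idempotents. -/
theorem HypData.idempotent_syzygy [IsNoetherianRing A] {m : Fin D} {rs : List A}
    (hrs : IsWeaklyRegular A rs) (h1 : ∀ l, l ≠ m → h.x l ∈ rs)
    (h1' : ∀ r ∈ rs, r ∈ maximalIdeal A) (hD : 3 ≤ D) {n : ℕ} (hn : h.e ≤ n)
    {N : Type u} [AddCommGroup N] [Module A N]
    (hN : IsMinimalSyzygyOf A (rs.length + 1) N (A ⧸ maximalIdeal A ^ n))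
    (φ : N →ₗ[A] N) (hφ : ∀ z, φ (φ z) = φ z) : φ = 0 ∨ φ = LinearMap.id := by
  have := IsMinimalSyzygyOf.finite _ hN
  exact (hN.tIdem h.acyc (h.tIdem_quot hD hn).1).1.idempotent h.x_mem_maximalIdeal
    h.a_mem_maximalIdeal m (by
      have := IsMinimalSyzygyOf.isWeaklyRegular hrs _ hN
      rwa [List.take_of_length_le (Nat.le_succ _)] at this) h1 h1' (h.a_smul_mem hrs h1 hN) φ hφ

lemma HypData.T_syzygy [IsNoetherianRing A] (hD : 3 ≤ D) {n : ℕ} (hn : h.e ≤ n) (i : ℕ)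
    {N : Type u} [AddCommGroup N] [Module A N]
    (hN : IsMinimalSyzygyOf A i N (A ⧸ maximalIdeal A ^ n)) :
    Nonempty (h.T N ≃ₗ[A] h.T ↥(maximalIdeal A ^ n)) := by
  obtain ⟨h3, ⟨h4⟩⟩ := h.tIdem_quot hD hn
  obtain ⟨-, ⟨h5⟩⟩ := hN.tIdem h.acyc h3
  exact ⟨h5.trans h4⟩

end Syzygy

end Rigid

/-! ### Flat unramified extensions of local rings -/

section Extension

open RingTheory.Sequence TensorProduct

variable {R A : Type u} [CommRing R] [IsLocalRing R] [CommRing A] [IsLocalRing A] [Algebra R A]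

variable (R A) in
/-- A flat extension of local rings whose closed fibre is a field. -/
structure UnramifiedExt : Prop where
  flat : Module.Flat R A
  map_eq : (maximalIdeal R).map (algebraMap R A) = maximalIdeal A

namespace UnramifiedExt

lemma isLocalHom (hA : UnramifiedExt R A) : IsLocalHom (algebraMap R A) :=
  ((local_hom_TFAE _).out 0 2).2 hA.map_eq.le

lemma faithfullyFlat (hA : UnramifiedExt R A) : Module.FaithfullyFlat R A :=
  have := hA.flat
  have := hA.isLocalHom
  Module.FaithfullyFlat.of_flat_of_isLocalHom

lemma length_baseChange (hA : UnramifiedExt R A) (M : Type u) [AddCommGroup M] [Module R M] :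
    Module.length A (A ⊗[R] M) = Module.length R M := by
  have := hA.flat
  have := hA.isLocalHom
  have h1 : Module.length A (A ⧸ maximalIdeal A) = 1 := by
    rw [Module.length_eq_one_iff]
    exact isSimpleModule_iff_quot_maximal.2 ⟨_, inferInstance, ⟨LinearEquiv.refl _ _⟩⟩
  rw [IsLocalRing.length_baseChange, hA.map_eq, h1, mul_one]

/-- The base change of `R ⧸ 𝔪 ^ n` is `A ⧸ 𝔪 ^ n`. -/
def quotPowEquiv (hA : UnramifiedExt R A) (n : ℕ) :
    A ⊗[R] (R ⧸ maximalIdeal R ^ n) ≃ₗ[A] A ⧸ maximalIdeal A ^ n :=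
  (Algebra.TensorProduct.quotIdealMapEquivTensorQuot A (maximalIdeal R ^ n)).symm.toLinearEquiv ≪≫ₗ
    Submodule.quotEquivOfEq _ _ (by rw [Ideal.map_pow, hA.map_eq])

lemma length_quot_pow (hA : UnramifiedExt R A) (n : ℕ) :
    Module.length A (A ⧸ maximalIdeal A ^ n) = Module.length R (R ⧸ maximalIdeal R ^ n) := by
  rw [← hA.length_baseChange, (hA.quotPowEquiv n).length_eq]

lemma isMinimalSyzygyOf (hA : UnramifiedExt R A) {C : Type u} [AddCommGroup C] [Module R C]
    {C' : Type u} [AddCommGroup C'] [Module A C'] (ε : A ⊗[R] C ≃ₗ[A] C') :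
    ∀ (i : ℕ) {N : Type u} [AddCommGroup N] [Module R N],
    IsMinimalSyzygyOf R i N C → IsMinimalSyzygyOf A i (A ⊗[R] N) C'
  | 0, _, _, _, ⟨δ⟩ => ⟨LinearEquiv.baseChange R A _ _ δ ≪≫ₗ ε⟩
  | i + 1, N, _, _, ⟨K, _, _, hK, n, π, hπ, hm, ⟨δ⟩⟩ => by
    have := hA.flat
    let p := TensorProduct.piScalarRight R A A (Fin n)
    let π' : A ⊗[R] (Fin n → R) →ₗ[A] A ⊗[R] K := AlgebraTensorModule.lTensor A A π
    let q : (Fin n → A) →ₗ[A] A ⊗[R] K := π'.comp p.symm.toLinearMap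
    have hq : LinearMap.ker q = (LinearMap.ker π').map p.toLinearMap :=
      (Submodule.map_equiv_eq_comap_symm p (LinearMap.ker π')).symm
    refine ⟨A ⊗[R] K, inferInstance, inferInstance, hA.isMinimalSyzygyOf ε i hK, n, q,
      (LinearMap.lTensor_surjective A hπ).comp p.symm.surjective, ?_, ⟨?_⟩⟩
    · rw [hq]
      rintro _ ⟨w, hw, rfl⟩
      refine mem_smul_top_pi fun j => ?_
      obtain ⟨t, ht⟩ : ∃ t, LinearMap.lTensor A (LinearMap.ker π).subtype t = w :=
        ⟨_, LinearMap.lTensor_ker_subtype_tensorKerEquiv_symm A A π ⟨w, hw⟩⟩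
      rw [← ht]
      clear ht hw
      induction t with
      | zero => simp
      | add s t hs ht => rw [map_add, map_add]; exact add_mem hs ht
      | tmul a k =>
        have h1 : (k : Fin n → R) j ∈ maximalIdeal R := by
          refine Submodule.smul_induction_on (p := fun v => v j ∈ maximalIdeal R) (hm k.2)
            (fun r hr v _ => Ideal.mul_mem_right _ _ hr) fun v w hv hw => add_mem hv hw
        simp only [LinearMap.lTensor_tmul, Submodule.subtype_apply]
        change (TensorProduct.piScalarRight R A A (Fin n) (a ⊗ₜ[R] (k : Fin n → R))) j ∈ _
        rw [TensorProduct.piScalarRight_apply, TensorProduct.piScalarRightHom_tmul]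
        change (k : Fin n → R) j • a ∈ _
        rw [Algebra.smul_def]
        exact Ideal.mul_mem_right _ _ (hA.map_eq ▸ Ideal.mem_map_of_mem _ h1)
    · exact LinearEquiv.baseChange R A _ _ δ ≪≫ₗ LinearMap.tensorKerEquiv A A π ≪≫ₗ
        p.submoduleMap _ ≪≫ₗ LinearEquiv.ofEq _ _ hq.symm

/-- Weakly regular sequences descend along faithfully flat extensions. -/
lemma isWeaklyRegular_of_tensor (hA : UnramifiedExt R A) {rs : List R} :
    ∀ {M : Type u} [AddCommGroup M] [Module R M],
    IsWeaklyRegular (A ⊗[R] M) rs → IsWeaklyRegular M rs := by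
  have := hA.faithfullyFlat
  induction rs with
  | nil => intros; exact IsWeaklyRegular.nil _ _
  | cons r rs ih =>
    intro M _ _ h
    rw [isWeaklyRegular_cons_iff] at h ⊢
    refine ⟨?_, ih (((QuotSMulTop.tensorQuotSMulTopEquivQuotSMulTop r A M).isWeaklyRegular_congr
      rs).2 h.2)⟩
    refine (Module.FaithfullyFlat.lTensor_injective_iff_injective R A (LinearMap.lsmul R M r)).1 ?_
    have h1 : ⇑(LinearMap.lTensor A (LinearMap.lsmul R M r)) = (r • · : A ⊗[R] M → A ⊗[R] M) := by
     ext t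
     induction t with
     | zero => simp
     | add s t hs ht => simp only [map_add, hs, ht, smul_add]
     | tmul a m => simp
    rw [h1]
    exact h.1

lemma isWeaklyRegular (hA : UnramifiedExt R A) {rs : List R}
    (h : IsWeaklyRegular A (rs.map (algebraMap R A))) : IsWeaklyRegular R rs := by
  rw [isWeaklyRegular_map_algebraMap_iff] at h
  exact hA.isWeaklyRegular_of_tensor
    (((TensorProduct.rid R A).isWeaklyRegular_congr rs).2 h)

lemma idempotent (hA : UnramifiedExt R A) {N : Type u} [AddCommGroup N] [Module R N]
    (h : ∀ φ : A ⊗[R] N →ₗ[A] A ⊗[R] N, (∀ z, φ (φ z) = φ z) → φ = 0 ∨ φ = LinearMap.id)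
    (φ : N →ₗ[R] N) (hφ : ∀ z, φ (φ z) = φ z) : φ = 0 ∨ φ = LinearMap.id := by
  have := hA.faithfullyFlat
  refine (h (AlgebraTensorModule.lTensor A A φ) fun z => ?_).imp (fun h0 => ?_) fun h1 => ?_
  · induction z with
    | zero => simp
    | add s t hs ht => simp only [map_add, hs, ht]
    | tmul a n => simp [hφ]
  · rw [Module.FaithfullyFlat.zero_iff_lTensor_zero R A]
    exact LinearMap.ext fun a => LinearMap.congr_fun h0 a
  · rw [← sub_eq_zero, Module.FaithfullyFlat.zero_iff_lTensor_zero R A]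
    rw [LinearMap.lTensor_sub, LinearMap.lTensor_id]
    exact LinearMap.ext fun a => by
      rw [LinearMap.sub_apply, LinearMap.zero_apply, sub_eq_zero]
      exact LinearMap.congr_fun h1 a

end UnramifiedExt

end Extension

section

open TensorProduct

variable {R A : Type u} [CommRing R] [CommRing A] [Algebra R A]

lemma not_surjective_of_baseChange {N : Type u} [AddCommGroup N] [Module R N]
    (h : ∀ q : A ⊗[R] N →ₗ[A] A, ¬ Function.Surjective q) (q : N →ₗ[R] R) :
    ¬ Function.Surjective q := fun hq =>
  h ((AlgebraTensorModule.rid R A A).toLinearMap.comp (AlgebraTensorModule.lTensor A A q))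
    ((AlgebraTensorModule.rid R A A).surjective.comp (LinearMap.lTensor_surjective A hq))

lemma isIndecomposable_of_idempotent {N : Type u} [AddCommGroup N] [Module R N] [Nontrivial N]
    (h : ∀ φ : N →ₗ[R] N, (∀ z, φ (φ z) = φ z) → φ = 0 ∨ φ = LinearMap.id) :
    IsIndecomposable R N := by
  refine ⟨inferInstance, fun P Q hPQ => ?_⟩
  have h1 : ∀ z ∈ P, P.projection Q hPQ z = z := fun z hz =>
    Submodule.projection_apply_of_mem_left hPQ hz
  rcases h (P.projection Q hPQ) (fun z => h1 _ (Submodule.projection_apply_mem _ _)) with h2 | h2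
  · left
    rw [eq_bot_iff]
    intro z hz
    rw [Submodule.mem_bot, ← h1 z hz, h2, LinearMap.zero_apply]
  · right
    rw [eq_bot_iff]
    intro z hz
    rw [Submodule.mem_bot, ← LinearMap.id_apply (R := R) z, ← h2]
    exact Submodule.projection_apply_of_mem_right hPQ hz

end

/-! ### The completion -/

section Completion

variable {R B : Type u} [CommRing R] [IsLocalRing R] [IsNoetherianRing R] [CommRing B]
  [IsLocalRing B] [Algebra R B]

lemma unramifiedExt_of_completion (ψ : AdicCompletion (maximalIdeal R) R ≃+* B)
    (hψ : ∀ r, algebraMap R B r = ψ (algebraMap R _ r)) : UnramifiedExt R B where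
  flat := by
    let ψ' : AdicCompletion (maximalIdeal R) R ≃ₗ[R] B :=
      ψ.toAddEquiv.toLinearEquiv fun r z => by
        simp [Algebra.smul_def, hψ]
    exact Module.Flat.of_linearEquiv ψ'.symm
  map_eq := by
    have h1 : algebraMap R B =
        (ψ : AdicCompletion (maximalIdeal R) R →+* B).comp (algebraMap R _) := RingHom.ext hψ
    rw [h1, ← Ideal.map_map, ← AdicCompletion.maximalIdeal_eq_map]
    exact map_maximalIdeal_of_surjective _ ψ.surjective

lemma exists_sub_algebraMap_mem_of_completion (ψ : AdicCompletion (maximalIdeal R) R ≃+* B)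
    (hψ : ∀ r, algebraMap R B r = ψ (algebraMap R _ r)) (n : ℕ) (b : B) :
    ∃ r, b - algebraMap R B r ∈ maximalIdeal B ^ n := by
  obtain ⟨a, rfl⟩ := ψ.surjective b
  obtain ⟨r, hr⟩ := Ideal.Quotient.mk_surjective (AdicCompletion.eval (maximalIdeal R) R n a)
  refine ⟨r, ?_⟩
  have h1 : a - algebraMap R _ r ∈ maximalIdeal (AdicCompletion (maximalIdeal R) R) ^ n := by
    rw [AdicCompletion.maximalIdeal_eq_map, ← Ideal.map_pow]
    rw [← Submodule.restrictScalars_mem R, ← Ideal.smul_top_eq_map,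
      AdicCompletion.pow_smul_top_eq_ker_eval (maximalIdeal R).fg_of_isNoetherianRing,
      LinearMap.mem_ker, map_sub, sub_eq_zero, ← hr]
    rfl
  rw [hψ, ← map_sub, ← map_maximalIdeal_of_surjective
    (ψ : AdicCompletion (maximalIdeal R) R →+* B) ψ.surjective, ← Ideal.map_pow]
  exact Ideal.mem_map_of_mem _ h1

end Completion

/-! ### Hilbert functions -/

section Hilbert

variable {S A : Type u} [CommRing S] [IsLocalRing S] [IsNoetherianRing S] [CommRing A]
  [IsLocalRing A] [Algebra S A]

lemma IsRegSys.length_quot_pow_add {D : ℕ} {x : Fin D → S} (hx : IsRegSys x)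
    (hπ : Function.Surjective (algebraMap S A)) {f : S}
    (hker : RingHom.ker (algebraMap S A) = Ideal.span {f}) {e : ℕ} (hf : f ∈ maximalIdeal S ^ e)
    (hf' : f ∉ maximalIdeal S ^ (e + 1)) (i : ℕ) :
    Module.length S (S ⧸ maximalIdeal S ^ (e + i)) =
      Module.length S (S ⧸ maximalIdeal S ^ i) + Module.length A (A ⧸ maximalIdeal A ^ (e + i)) := by
  have hmap (k : ℕ) : (maximalIdeal S ^ k).map (algebraMap S A) = maximalIdeal A ^ k := by
    rw [Ideal.map_pow, map_maximalIdeal_of_surjective _ hπ]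
  let p : S →ₗ[S] A ⧸ maximalIdeal A ^ (e + i) :=
    ((Submodule.mkQ (maximalIdeal A ^ (e + i))).restrictScalars S).comp (Algebra.linearMap S A)
  have hp (z : S) : p z = 0 ↔ algebraMap S A z ∈ maximalIdeal A ^ (e + i) :=
    Submodule.Quotient.mk_eq_zero _
  have hple : maximalIdeal S ^ (e + i) ≤ LinearMap.ker p := fun z hz =>
    (hp z).2 (hmap (e + i) ▸ Ideal.mem_map_of_mem _ hz)
  have hle : maximalIdeal S ^ i ≤
      Submodule.comap (LinearMap.lsmul S S f) (maximalIdeal S ^ (e + i)) := fun z hz => by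
    rw [Submodule.mem_comap, pow_add]
    exact Ideal.mul_mem_mul hf hz
  rw [← Module.length_eq_of_surjective (S := S) (R := A) hπ]
  refine Module.length_eq_add_of_exact (Submodule.mapQ _ _ (LinearMap.lsmul S S f) hle)
    (Submodule.liftQ _ p hple) ?_ ?_ ?_
  · rw [injective_iff_map_eq_zero]
    intro z hz
    obtain ⟨z, rfl⟩ := Submodule.Quotient.mk_surjective _ z
    rw [Submodule.mapQ_apply, Submodule.Quotient.mk_eq_zero] at hz
    rw [Submodule.Quotient.mk_eq_zero]
    obtain ⟨F, hF, rfl⟩ := (mem_pow_iff_exists_form hx.span_eq).1 hf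
    exact mem_pow_of_mul_mem_pow hx.quasiReg hx.span_eq hF
      (fun h => hf' ((map_residue_eq_zero_iff hx.quasiReg hx.span_eq hF).1 h)) hz
  · intro z
    obtain ⟨z, rfl⟩ := Submodule.Quotient.mk_surjective _ z
    obtain ⟨z, rfl⟩ := hπ z
    exact ⟨Submodule.Quotient.mk z, rfl⟩
  · intro z
    obtain ⟨z, rfl⟩ := Submodule.Quotient.mk_surjective _ z
    rw [Submodule.liftQ_apply, hp, ← hmap, Ideal.mem_map_iff_of_surjective _ hπ]
    constructor
    · rintro ⟨w, hw, hwz⟩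
      have : z - w ∈ Ideal.span {f} := by
        rw [← hker, RingHom.mem_ker, map_sub, hwz, sub_self]
      obtain ⟨c, hc⟩ := Ideal.mem_span_singleton'.1 this
      refine ⟨Submodule.Quotient.mk c, ?_⟩
      rw [Submodule.mapQ_apply, Submodule.Quotient.eq, LinearMap.lsmul_apply, smul_eq_mul, mul_comm,
        hc]
      simpa using hw
    · rintro ⟨c, hc⟩
      obtain ⟨c, rfl⟩ := Submodule.Quotient.mk_surjective _ c
      rw [Submodule.mapQ_apply, Submodule.Quotient.eq] at hc
      refine ⟨z - f * c, ?_, ?_⟩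
      · rw [← neg_mem_iff, neg_sub]; exact hc
      · have : algebraMap S A f = 0 := by
          rw [← RingHom.mem_ker, hker]; exact Ideal.mem_span_singleton_self f
        rw [map_sub, map_mul, this, zero_mul, sub_zero]

end Hilbert

lemma length_quot_maximalIdeal {S : Type*} [CommRing S] [IsLocalRing S] :
    Module.length S (S ⧸ maximalIdeal S) = 1 := by
  rw [Module.length_eq_one_iff]
  exact isSimpleModule_iff_quot_maximal.2 ⟨_, inferInstance, ⟨LinearEquiv.refl _ _⟩⟩

lemma IsRegSys.notMem_sq {S : Type u} [CommRing S] [IsLocalRing S] [IsNoetherianRing S] {D : ℕ}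
    {x : Fin D → S} (hx : IsRegSys x) (i : Fin D) : x i ∉ maximalIdeal S ^ 2 := by
  have h := map_residue_eq_zero_iff hx.quasiReg hx.span_eq (MvPolynomial.isHomogeneous_X S i)
  rw [MvPolynomial.eval_X] at h
  rw [← h, MvPolynomial.map_X]
  exact MvPolynomial.X_ne_zero i

/-- The Hilbert function of a regular local ring. -/
lemma IsRegSys.length_quot_pow {D : ℕ} : ∀ {S : Type u} [CommRing S] [IsLocalRing S]
    [IsNoetherianRing S] {x : Fin D → S}, IsRegSys x → ∀ j,
    Module.length S (S ⧸ maximalIdeal S ^ (j + 1)) = (D + j).choose D := by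
  induction D with
  | zero =>
    intro S _ _ _ x hx j
    have : maximalIdeal S = ⊥ := by rw [← hx.span_eq]; simp
    have h1 : maximalIdeal S ^ (j + 1) = maximalIdeal S := by
      rw [this, ← Ideal.zero_eq_bot, zero_pow (Nat.succ_ne_zero j)]
    rw [h1, length_quot_maximalIdeal]
    simp
  | succ D ih =>
    intro S _ _ _ x hx j
    have hloc : IsLocalRing (S ⧸ Ideal.span {x 0}) :=
      isLocalRing_quotient ((Ideal.span_singleton_le_iff_mem _).2 (hx.mem 0))
    induction j with
    | zero => 
      rw [zero_add, pow_one, length_quot_maximalIdeal]; simp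
    | succ j ihj =>
      have h1 := hx.length_quot_pow_add (A := S ⧸ Ideal.span {x 0}) (f := x 0) (e := 1)
        Ideal.Quotient.mk_surjective Ideal.mk_ker (by simpa using hx.mem 0) (hx.notMem_sq 0) (j + 1)
      rw [add_comm 1] at h1
      rw [h1, ihj, ih hx.quotient]
      norm_cast
      rw [show D + 1 + (j + 1) = D + (j + 1) + 1 by ring, Nat.choose_succ_succ, add_comm,
        show D + (j + 1) = D + 1 + j by ring]

/-! ### Multiplicity and growth -/

section Growth

open Filter Topology

lemma tendsto_choose_div_pow (a b k : ℕ) :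
    Tendsto (fun j : ℕ => ((j + a).choose k : ℝ) / ((j + b : ℕ) : ℝ) ^ k) atTop
      (𝓝 (1 / k.factorial)) := by
  have hk : (k.factorial : ℝ) ≠ 0 := by positivity
  have h1 : Tendsto (fun n : ℕ => (n.choose k : ℝ) / ((n : ℝ) ^ k / k.factorial)) atTop (𝓝 1) :=
    (Asymptotics.isEquivalent_iff_tendsto_one (by
      filter_upwards [eventually_gt_atTop 0] with n hn
      positivity)).1 (isEquivalent_choose k)
  have h2 := h1.comp (tendsto_add_atTop_nat a)
  have h3 (c : ℕ) : Tendsto (fun j : ℕ => (j : ℝ) / ((j + c : ℕ) : ℝ)) atTop (𝓝 1) := by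
    have := tendsto_natCast_div_add_atTop (c : ℝ)
    exact this.congr fun j => by push_cast; rfl
  have h4 : Tendsto (fun j : ℕ => ((j + a : ℕ) : ℝ) / ((j + b : ℕ) : ℝ)) atTop (𝓝 1) := by
    have := (h3 b).div (h3 a) one_ne_zero
    rw [div_one] at this
    refine this.congr' ?_
    filter_upwards [eventually_gt_atTop 0] with n hn
    have : (n : ℝ) ≠ 0 := by positivity
    simp only [Pi.div_apply]
    field_simp
  have h5 := (h2.mul (h4.pow k)).div_const (k.factorial : ℝ)
  rw [one_pow, one_mul] at h5
  refine h5.congr' ?_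
  filter_upwards [eventually_gt_atTop 0] with n hn
  have : ((n + a : ℕ) : ℝ) ≠ 0 := by positivity
  simp only [Function.comp_apply, div_pow]
  field_simp

lemma tendsto_div_pow_of_lt {u : ℕ → ℝ} {a b : ℕ} {c : ℝ} (h : a < b) {m : ℕ}
    (hu : Tendsto (fun j : ℕ => u j / ((j + m : ℕ) : ℝ) ^ a) atTop (𝓝 c)) :
    Tendsto (fun j : ℕ => u j / ((j + m : ℕ) : ℝ) ^ b) atTop (𝓝 0) := by
  have h1 : Tendsto (fun j : ℕ => (((j + m : ℕ) : ℝ) ^ (b - a))⁻¹) atTop (𝓝 0) :=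
    ((tendsto_pow_atTop (Nat.sub_ne_zero_of_lt h)).comp
      (tendsto_natCast_atTop_atTop.comp (tendsto_add_atTop_nat m))).inv_tendsto_atTop
  have h2 := hu.mul h1
  rw [mul_zero] at h2
  refine h2.congr' ?_
  filter_upwards [eventually_gt_atTop 0] with n hn
  have : ((n + m : ℕ) : ℝ) ≠ 0 := by positivity
  rw [← div_eq_mul_inv, div_div, ← pow_add, Nat.add_sub_cancel' h.le]

lemma eq_of_tendsto_of_sum_choose {d e D E a b : ℕ} {len : ℕ → ℕ} (he : 0 < e) (hE : 0 < E)
    (hlen : ∀ j, len (j + b) = ∑ i ∈ Finset.range E, (a + j + i).choose D)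
    (h : Tendsto (fun n : ℕ => (d.factorial * len n : ℝ) / (n : ℝ) ^ d) atTop (𝓝 (e : ℝ))) :
    D = d ∧ E = e := by
  have h1 : Tendsto (fun j : ℕ => (d.factorial * len (j + b) : ℝ) / ((j + b : ℕ) : ℝ) ^ d) atTop
      (𝓝 (e : ℝ)) := h.comp (tendsto_add_atTop_nat b)
  have h2 : Tendsto (fun j : ℕ => (d.factorial * len (j + b) : ℝ) / ((j + b : ℕ) : ℝ) ^ D) atTop
      (𝓝 (d.factorial * (E / D.factorial))) := by
    have h0 (i) (_ : i ∈ Finset.range E) := tendsto_choose_div_pow (a + i) b D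
    have := (tendsto_finsetSum _ h0).const_mul (d.factorial : ℝ)
    rw [Finset.sum_const, Finset.card_range, nsmul_eq_mul, mul_one_div] at this
    refine this.congr fun j => ?_
    rw [hlen, mul_div_assoc, ← Finset.sum_div]
    push_cast
    simp only [show ∀ i, j + (a + i) = a + j + i from fun i => by ring]
  have hd : (d.factorial : ℝ) ≠ 0 := by positivity
  have hD : (D.factorial : ℝ) ≠ 0 := by positivity
  have hE' : (E : ℝ) ≠ 0 := by positivity
  rcases lt_trichotomy D d with hlt | rfl | hlt
  · have := tendsto_nhds_unique (tendsto_div_pow_of_lt hlt h2) h1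
    exact absurd this.symm (by positivity)
  · refine ⟨rfl, ?_⟩
    have := tendsto_nhds_unique h2 h1
    rw [mul_div_cancel₀ _ hd] at this
    exact_mod_cast this
  · have := tendsto_nhds_unique (tendsto_div_pow_of_lt hlt h1) h2
    exact absurd this.symm (by positivity)

lemma sum_range_choose_add_le {a D j : ℕ} (E : ℕ) (hE : 0 < E) (hD : 2 ≤ D) (ha : D ≤ a) :
    (∑ i ∈ Finset.range E, (a + j + i).choose D) + (j + 1) ≤
      ∑ i ∈ Finset.range E, (a + (j + 1) + i).choose D := by
  obtain ⟨k, rfl⟩ := Nat.exists_eq_add_of_le' hD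
  have h1 : ∀ m, m + 1 ≤ (k + 1 + m).choose (k + 1) := fun m => by
    induction m with
    | zero => simp
    | succ m ih =>
      rw [← add_assoc, Nat.choose_succ_succ']
      have := Nat.choose_pos (n := k + 1 + m) (k := k) (by omega)
      omega
  have h2 (i : ℕ) : (a + (j + 1) + i).choose (k + 2) =
      (a + j + i).choose (k + 2) + (a + j + i).choose (k + 1) := by
    rw [show a + (j + 1) + i = a + j + i + 1 by ring, Nat.choose_succ_succ, add_comm]
  rw [Finset.sum_congr rfl fun i _ => h2 i, Finset.sum_add_distrib]
  gcongr
  calc j + 1 ≤ (a + j + 0).choose (k + 1) := (h1 j).trans (Nat.choose_le_choose _ (by omega))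
    _ ≤ _ := Finset.single_le_sum (f := fun i => (a + j + i).choose (k + 1)) (fun _ _ => Nat.zero_le _)
      (Finset.mem_range.2 hE)

lemma choose_add_eq_sum (D E j : ℕ) : (D + 1 + E + j).choose (D + 1) =
    (D + 1 + j).choose (D + 1) + ∑ i ∈ Finset.range E, (D + 1 + j + i).choose D := by
  induction E with
  | zero => simp
  | succ E ih =>
    rw [Finset.sum_range_succ, ← add_assoc ((D + 1 + j).choose _), ← ih,
      show D + 1 + (E + 1) + j = D + 1 + E + j + 1 by ring, Nat.choose_succ_succ, add_comm,
      show D + 1 + j + E = D + 1 + E + j by ring]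

end Growth

section Order

variable {S : Type u} [CommRing S] [IsLocalRing S] [IsNoetherianRing S]

lemma exists_mem_pow_notMem_pow {f : S} (hf : f ≠ 0) :
    ∃ e, f ∈ maximalIdeal S ^ e ∧ f ∉ maximalIdeal S ^ (e + 1) := by
  by_contra! h
  refine hf ?_
  have : f ∈ ⨅ i, maximalIdeal S ^ i := by
    rw [Ideal.mem_iInf]
    intro i
    induction i with
    | zero => simp
    | succ i ih => exact h i ih
  rwa [Ideal.iInf_pow_eq_bot_of_isLocalRing _ (maximalIdeal.isMaximal S).ne_top] at this

end Order

section Multiplicity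

variable {R S A : Type u} [CommRing R] [IsLocalRing R] [CommRing S] [IsLocalRing S]
  [IsNoetherianRing S] [CommRing A] [IsLocalRing A] [Algebra S A] [Algebra R A]

/-- The multiplicity of a hypersurface is the order of its equation, and its Hilbert function grows
at least linearly in dimension at least two. -/
lemma HasMultiplicity.exists_order [IsNoetherianRing R] (hA : UnramifiedExt R A)
    {D : ℕ} {x : Fin D → S} (hx : IsRegSys x)
    (hπ : Function.Surjective (algebraMap S A)) {f : S}
    (hker : RingHom.ker (algebraMap S A) = Ideal.span {f}) (hf : f ∈ maximalIdeal S ^ 2) {e d : ℕ}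
    (he : HasMultiplicity R e) (h2 : 2 < e) (hd : ringKrullDim R = d) :
    D = d + 1 ∧ f ≠ 0 ∧ f ∈ maximalIdeal S ^ e ∧ f ∉ maximalIdeal S ^ (e + 1) ∧
      (∀ n, Module.length A (A ⧸ maximalIdeal A ^ n) ≠ ⊤) ∧
      (2 ≤ d → ∀ j, Module.length A (A ⧸ maximalIdeal A ^ (e + 1 + j)) + (j + 1 : ℕ) ≤
        Module.length A (A ⧸ maximalIdeal A ^ (e + 1 + j + 1))) := by
  obtain ⟨d', hd', len, hlen, hlim⟩ := he
  obtain rfl : d' = d := by rw [hd] at hd'; exact_mod_cast hd'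
  replace hlen (n : ℕ) : Module.length A (A ⧸ maximalIdeal A ^ n) = len n := by
    have := hlen n
    rw [moduleLength, ← Module.coe_length, ← hA.length_quot_pow] at this
    exact (WithBot.coe_injective this).symm
  have hf0 : f ≠ 0 := by
    rintro rfl
    have h (j : ℕ) : len (j + 1) = ∑ i ∈ Finset.range 1, (D + j + i).choose D := by
      have hb : Function.Bijective (algebraMap S A) :=
        ⟨(RingHom.injective_iff_ker_eq_bot _).2 (by rw [hker]; simp), hπ⟩
      have h1 := hx.length_quot_pow j
      have h2 : Module.length S (S ⧸ maximalIdeal S ^ (j + 1)) =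
          Module.length A (A ⧸ maximalIdeal A ^ (j + 1)) := by
        rw [← Module.length_eq_of_surjective (S := S) (R := A) hπ]
        refine (Submodule.Quotient.equiv _ ((maximalIdeal A ^ (j + 1)).restrictScalars S)
          (LinearEquiv.ofBijective (Algebra.linearMap S A) hb) ?_ ≪≫ₗ
          Submodule.Quotient.restrictScalarsEquiv S _).length_eq
        ext z
        rw [← map_maximalIdeal_of_surjective _ hπ, ← Ideal.map_pow]
        exact (Ideal.mem_map_iff_of_surjective _ hπ).symm
      rw [h2, hlen] at h1
      simp
      exact_mod_cast h1
    have := (eq_of_tendsto_of_sum_choose (by omega) one_pos h hlim).2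
    omega
  obtain ⟨E, hE, hE'⟩ := exists_mem_pow_notMem_pow hf0
  have hE0 : 0 < E := by
    by_contra! h
    obtain rfl : E = 0 := by omega
    exact hE' (Ideal.pow_le_pow_right (by omega) hf)
  obtain ⟨D, rfl⟩ : ∃ D', D = D' + 1 := by
    refine Nat.exists_eq_succ_of_ne_zero ?_
    rintro rfl
    have : maximalIdeal S = ⊥ := by rw [← hx.span_eq]; simp
    rw [this, ← Ideal.zero_eq_bot, zero_pow two_ne_zero] at hf
    exact hf0 (by simpa using hf)
  have h (j : ℕ) : len (j + (E + 1)) = ∑ i ∈ Finset.range E, (D + 1 + j + i).choose D := by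
    have h1 := hx.length_quot_pow_add hπ hker hE hE' (j + 1)
    rw [← add_assoc, hx.length_quot_pow, hx.length_quot_pow, hlen, ← add_assoc] at h1
    norm_cast at h1
    rw [choose_add_eq_sum] at h1
    rw [show j + (E + 1) = E + j + 1 by ring]
    omega
  obtain ⟨rfl, rfl⟩ := eq_of_tendsto_of_sum_choose (by omega) hE0 h hlim
  refine ⟨rfl, hf0, hE, hE', fun n => by rw [hlen]; exact ENat.natCast_ne_top _, fun h2 j => ?_⟩
  rw [hlen, hlen]
  norm_cast
  rw [show E + 1 + j + 1 = (j + 1) + (E + 1) by ring, add_comm (E + 1) j, h, h]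
  exact sum_range_choose_add_le E hE0 h2 (by omega)

end Multiplicity

/-! ### Coordinates -/

section Coordinates

open scoped Pointwise

open RingTheory.Sequence

lemma exists_not_dvd_of_primes {S : Type u} [CommRing S] [IsLocalRing S] [IsNoetherianRing S]
    [IsDomain S] {p : ℕ → S} (hp : ∀ K, Prime (p K)) (hm : ∀ K, p K ∈ maximalIdeal S)
    (hd : ∀ K n, K < n → ¬ p n ∣ p K) {f : S} (hf : f ≠ 0) : ∃ K, ¬ p K ∣ f := by
  by_contra! h
  have h1 (n : ℕ) : ∏ K ∈ Finset.range n, p K ∣ f := by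
    induction n with
    | zero => simp
    | succ n ih =>
      obtain ⟨c, rfl⟩ := ih
      have h2 : p n ∣ c := ((hp n).dvd_or_dvd (h n)).resolve_left fun h3 => by
        obtain ⟨K, hK, hdvd⟩ := (Prime.dvd_finsetProd_iff (hp n) _).1 h3
        exact hd K n (Finset.mem_range.1 hK) hdvd
      rw [Finset.prod_range_succ]
      exact mul_dvd_mul_left _ h2
  obtain ⟨e, -, he⟩ := exists_mem_pow_notMem_pow hf
  refine he (Ideal.mem_of_dvd _ (h1 (e + 1)) ?_)
  have := Ideal.prod_mem_prod (s := Finset.range (e + 1)) (I := fun _ => maximalIdeal S)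
    fun K _ => hm K
  simpa using this

lemma IsRegSys.of_le {S : Type*} [CommRing S] [IsLocalRing S] {n : ℕ} {x x' : Fin n → S}
    (hx : IsRegSys x) (h : maximalIdeal S ≤ Ideal.span (Set.range x'))
    (h' : ∀ i, x' i ∈ maximalIdeal S) : IsRegSys x' :=
  ⟨le_antisymm (Ideal.span_le.2 (by rintro _ ⟨i, rfl⟩; exact h' i)) h, hx.dim_eq⟩

lemma IsRegSys.sub_mul {S : Type u} [CommRing S] [IsLocalRing S] {n : ℕ} {x x' c : Fin n → S}
    (hx : IsRegSys x) {m : Fin n} (hm : x' m = x m) (h : ∀ i, i ≠ m → x' i = x i - x m * c i) :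
    IsRegSys x' := by
  have hI : x m ∈ Ideal.span (Set.range x') := hm ▸ Ideal.subset_span ⟨m, rfl⟩
  refine hx.of_le ?_ fun i => ?_
  · rw [← hx.span_eq, Ideal.span_le]
    rintro _ ⟨i, rfl⟩
    by_cases him : i = m
    · exact him ▸ hI
    · rw [← sub_add_cancel (x i) (x m * c i), ← h i him]
      exact add_mem (Ideal.subset_span ⟨i, rfl⟩) (Ideal.mul_mem_right _ _ hI)
  · by_cases him : i = m
    · rw [him, hm]; exact hx.mem m
    · rw [h i him]
      exact sub_mem (hx.mem i) (Ideal.mul_mem_right _ _ (hx.mem m))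

lemma IsRegSys.prime {S : Type u} [CommRing S] [IsLocalRing S] [IsNoetherianRing S] {n : ℕ}
    {x : Fin (n + 1) → S} (hx : IsRegSys x) : Prime (x 0) := by
  have hloc : IsLocalRing (S ⧸ Ideal.span {x 0}) :=
    isLocalRing_quotient ((Ideal.span_singleton_le_iff_mem _).2 (hx.mem 0))
  have := hx.quotient.isDomain
  exact (Ideal.span_singleton_prime hx.ne_zero).1 ((Ideal.Quotient.isDomain_iff_prime _).1 this)

lemma IsRegSys.quotient_of_eq {S : Type u} [CommRing S] [IsLocalRing S] [IsNoetherianRing S]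
    {n : ℕ} {x : Fin (n + 1) → S} (hx : IsRegSys x) {y : S} (hy : x 0 = y)
    [IsLocalRing (S ⧸ Ideal.span {y})] :
    IsRegSys (Ideal.Quotient.mk (Ideal.span {y}) ∘ x ∘ Fin.succ) := by
  subst hy
  exact hx.quotient

lemma quotSMulTop_isWeaklyRegular_iff {S A : Type u} [CommRing S] [CommRing A] [Algebra S A]
    (hπ : Function.Surjective (algebraMap S A)) {f : S}
    (hker : RingHom.ker (algebraMap S A) = Ideal.span {f}) (rs : List S) :
    IsWeaklyRegular (QuotSMulTop f S) rs ↔ IsWeaklyRegular A (rs.map (algebraMap S A)) := by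
  rw [isWeaklyRegular_map_algebraMap_iff]
  have h1 : f • (⊤ : Submodule S S) = LinearMap.ker (Algebra.linearMap S A) := by
    ext z
    rw [LinearMap.mem_ker, Algebra.linearMap_apply, ← RingHom.mem_ker, hker,
      Ideal.mem_span_singleton', Submodule.mem_smul_pointwise_iff_exists]
    simp [mul_comm]
  exact LinearEquiv.isWeaklyRegular_congr (Submodule.quotEquivOfEq _ _ h1 ≪≫ₗ
    LinearMap.quotKerEquivOfSurjective (Algebra.linearMap S A) hπ) rs

/-- In a regular local ring with coordinates `x`, the differences `x l - x m ^ (N l + 1)`, where `m`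
is the last index, form a regular sequence together with a given nonzero `f`, for suitable `N`. -/
lemma IsRegSys.exists_isWeaklyRegular_sub_pow {d : ℕ} : ∀ {S : Type u} [CommRing S] [IsLocalRing S]
    [IsNoetherianRing S] {x : Fin (d + 1) → S} {f : S}, IsRegSys x → f ≠ 0 →
    ∃ N : Fin d → ℕ,
      IsWeaklyRegular S (List.ofFn (fun l => x l.castSucc - x (Fin.last d) ^ (N l + 1)) ++ [f]) ∧
      ∃ k, maximalIdeal S ^ k ≤
        Ideal.span (Set.range fun l => x l.castSucc - x (Fin.last d) ^ (N l + 1)) ⊔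
          Ideal.span {f} := by
  induction d with
  | zero =>
    intro S _ _ _ x f hx hf
    have := hx.isDomain
    refine ⟨Fin.elim0, ?_, ?_⟩
    · simp only [List.ofFn_zero, List.nil_append, isWeaklyRegular_singleton_iff]
      exact fun a b h => mul_left_cancel₀ hf h
    · have hm : maximalIdeal S = Ideal.span {x 0} := by
        rw [← hx.span_eq]
        congr 1
        ext z
        simp [eq_comm]
      obtain ⟨e, he, he'⟩ := exists_mem_pow_notMem_pow hf
      refine ⟨e, le_sup_of_le_right ?_⟩
      rw [hm, Ideal.span_singleton_pow, Ideal.mem_span_singleton'] at he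
      obtain ⟨c, rfl⟩ := he
      have hc : IsUnit c := by
        by_contra hc
        refine he' ?_
        rw [pow_succ']
        exact Ideal.mul_mem_mul ((mem_maximalIdeal _).2 hc) (Ideal.pow_mem_pow (hx.mem 0) _)
      rw [hm, Ideal.span_singleton_pow, Ideal.span_singleton_mul_left_unit hc]
  | succ d ih =>
    intro S _ _ _ x f hx hf
    have := hx.isDomain
    set t := x (Fin.last (d + 1)) with ht
    have hne : Fin.last (d + 1) ≠ 0 := Fin.last_pos.ne'
    have hreg (K : ℕ) : IsRegSys (Function.update x 0 (x 0 - t ^ (K + 1))) :=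
      hx.sub_mul (m := Fin.last (d + 1)) (c := Pi.single 0 (t ^ K))
        (Function.update_of_ne hne _ _) fun i _ => by
          by_cases hi : i = 0
          · subst hi; simp [pow_succ', ht]
          · simp [hi]
    have hmem (K : ℕ) : x 0 - t ^ (K + 1) ∈ maximalIdeal S := by simpa using (hreg K).mem 0
    have hprime (K : ℕ) : Prime (x 0 - t ^ (K + 1)) := by simpa using (hreg K).prime
    have hquot (K : ℕ) [IsLocalRing (S ⧸ Ideal.span {x 0 - t ^ (K + 1)})] :
        IsRegSys (Ideal.Quotient.mk (Ideal.span {x 0 - t ^ (K + 1)}) ∘ x ∘ Fin.succ) := by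
      have h2 : Function.update x 0 (x 0 - t ^ (K + 1)) ∘ Fin.succ = x ∘ Fin.succ := by
        ext i; simp
      exact h2 ▸ (hreg K).quotient_of_eq (Function.update_self _ _ _)
    have hloc (K : ℕ) : IsLocalRing (S ⧸ Ideal.span {x 0 - t ^ (K + 1)}) :=
      isLocalRing_quotient ((Ideal.span_singleton_le_iff_mem _).2 (hmem K))
    obtain ⟨K, hK⟩ := exists_not_dvd_of_primes hprime hmem (fun K n hKn hdvd => by
      have h1 : x 0 - t ^ (n + 1) ∣ t ^ (K + 1) * (1 - t ^ (n - K)) := by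
        have h2 : t ^ (K + 1) * (1 - t ^ (n - K)) =
            (x 0 - t ^ (n + 1)) - (x 0 - t ^ (K + 1)) := by
          rw [mul_sub, ← pow_add, show K + 1 + (n - K) = n + 1 by omega]
          ring
        exact h2 ▸ dvd_sub (dvd_refl _) hdvd
      have hu : IsUnit (1 - t ^ (n - K)) := by
        have h3 : t ^ (n - K) ∈ nonunits S :=
          (mem_maximalIdeal _).1 (Ideal.pow_mem_of_mem _ (hx.mem _) _ (by omega))
        exact isUnit_one_sub_self_of_mem_nonunits _ h3
      have h4 := (hprime n).dvd_of_dvd_pow ((hu.dvd_mul_right).1 h1)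
      have := hloc n
      have h5 := (hquot n).notMem_sq (Fin.last d)
      refine h5 ?_
      have h6 : (Ideal.Quotient.mk (Ideal.span {x 0 - t ^ (n + 1)})) t = 0 :=
        Ideal.Quotient.eq_zero_iff_dvd _ _ |>.2 h4
      simp only [Function.comp_apply, Fin.succ_last, ← ht, h6, zero_mem]) hf
    have := hloc K
    set I := Ideal.span {x 0 - t ^ (K + 1)} with hI
    obtain ⟨N, hN, k, hk⟩ := ih (hquot K) (f := Ideal.Quotient.mk I f) fun h =>
      hK ((Ideal.Quotient.eq_zero_iff_dvd _ _).1 h)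
    have hy : (fun l : Fin (d + 1) => x l.castSucc -
        t ^ ((Fin.cons K N : Fin (d + 1) → ℕ) l + 1)) =
        Fin.cons (x 0 - t ^ (K + 1)) (fun l => x l.castSucc.succ - t ^ (N l + 1)) := by
      ext l
      refine Fin.cases ?_ (fun l => ?_) l
      · simp
      · simp [Fin.castSucc_succ]
    simp only [Function.comp_apply, Fin.succ_last, Nat.succ_eq_add_one, ← ht, ← map_pow,
      ← map_sub] at hN hk
    refine ⟨Fin.cons K N, ?_, k, ?_⟩
    · rw [hy, List.ofFn_succ, List.cons_append, isWeaklyRegular_cons_iff]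
      refine ⟨fun a b h => mul_left_cancel₀ (hprime K).ne_zero h, ?_⟩
      rw [Fin.cons_zero, quotSMulTop_isWeaklyRegular_iff (A := S ⧸ I) Ideal.Quotient.mk_surjective
        Ideal.mk_ker, List.map_append, List.map_ofFn]
      exact hN
    · rw [hy]
      intro z hz
      have h1 := hk (show Ideal.Quotient.mk I z ∈ _ by
        rw [← map_maximalIdeal_of_surjective _ (Ideal.Quotient.mk_surjective (I := I)),
          ← Ideal.map_pow]
        exact Ideal.mem_map_of_mem _ hz)
      have h2 : Ideal.span (Set.range fun l => Ideal.Quotient.mk I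
            (x l.castSucc.succ - t ^ (N l + 1))) ⊔ Ideal.span {Ideal.Quotient.mk I f} =
          (Ideal.span (Set.range fun l : Fin d => x l.castSucc.succ - t ^ (N l + 1)) ⊔
            Ideal.span {f}).map (Ideal.Quotient.mk I) := by
        rw [Ideal.map_sup, Ideal.map_span, Ideal.map_span, ← Set.range_comp, Set.image_singleton]
        rfl
      rw [h2, Ideal.mem_map_iff_of_surjective _ Ideal.Quotient.mk_surjective] at h1
      obtain ⟨w, hw, hwz⟩ := h1
      have hle : Ideal.span (Set.range fun l : Fin d => x l.castSucc.succ - t ^ (N l + 1)) ⊔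
          Ideal.span {f} ≤ Ideal.span (Set.range (Fin.cons (x 0 - t ^ (K + 1))
            fun l : Fin d => x l.castSucc.succ - t ^ (N l + 1) : Fin (d + 1) → S)) ⊔
              Ideal.span {f} := by
        refine sup_le_sup_right (Ideal.span_mono ?_) _
        rw [Fin.range_cons]
        exact Set.subset_insert _ _
      rw [← sub_sub_cancel w z]
      refine sub_mem (hle hw) (Ideal.mem_sup_left ?_)
      have h3 : w - z ∈ I := Ideal.Quotient.eq.1 hwz
      refine Ideal.span_mono ?_ h3
      rw [Fin.range_cons]
      exact Set.singleton_subset_iff.2 (Set.mem_insert _ _)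

/-- A hypersurface over which `R` is dense has coordinates all but the last of which come from `R`
and form a system of parameters. -/
lemma IsRegSys.exists_coordinates {R S A : Type u} [CommRing R] [CommRing S] [IsLocalRing S]
    [IsNoetherianRing S] [CommRing A] [IsLocalRing A] [Algebra R A] [Algebra S A]
    (hR : ∀ b : A, ∃ r, b - algebraMap R A r ∈ maximalIdeal A ^ 2)
    (hπ : Function.Surjective (algebraMap S A)) {f : S}
    (hker : RingHom.ker (algebraMap S A) = Ideal.span {f}) (hf : f ≠ 0)
    (hfm : f ∈ maximalIdeal S) {d : ℕ} {x : Fin (d + 1) → S} (hx : IsRegSys x) :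
    ∃ (y : Fin (d + 1) → S) (r : Fin d → R), IsRegSys y ∧
      (∀ l, algebraMap S A (y l.castSucc) = algebraMap R A (r l)) ∧
      IsWeaklyRegular A (List.ofFn fun l => algebraMap R A (r l)) ∧
      ∃ k, maximalIdeal A ^ k ≤ Ideal.span (Set.range fun l => algebraMap R A (r l)) := by
  have h1 (i : Fin (d + 1)) : ∃ (z : S) (r : R), algebraMap S A z = algebraMap R A r ∧
      x i - z ∈ maximalIdeal S ^ 2 := by
    obtain ⟨r, hr⟩ := hR (algebraMap S A (x i))
    rw [← map_maximalIdeal_of_surjective _ hπ, ← Ideal.map_pow,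
      Ideal.mem_map_iff_of_surjective _ hπ] at hr
    obtain ⟨w, hw, hwr⟩ := hr
    refine ⟨x i - w, r, by rw [map_sub, hwr, sub_sub_cancel], by simpa using hw⟩
  choose z r hzr hz using h1
  have hzreg : IsRegSys z := by
    have hmem (i) : z i ∈ maximalIdeal S := by
      rw [← sub_sub_cancel (x i) (z i)]
      exact sub_mem (hx.mem i) (Ideal.pow_le_self two_ne_zero (hz i))
    refine hx.of_le (Submodule.le_of_le_smul_of_le_jacobson_bot
      (maximalIdeal S).fg_of_isNoetherianRing (maximalIdeal_le_jacobson _) ?_) hmem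
    rw [smul_eq_mul, ← pow_two]
    nth_rw 1 [← hx.span_eq]
    rw [Ideal.span_le]
    rintro _ ⟨i, rfl⟩
    rw [← add_sub_cancel (z i) (x i)]
    exact Ideal.add_mem _ (Ideal.mem_sup_left (Ideal.subset_span ⟨i, rfl⟩))
      (Ideal.mem_sup_right (hz i))
  obtain ⟨N, hN, k, hk⟩ := hzreg.exists_isWeaklyRegular_sub_pow hf
  set t := z (Fin.last d) with ht
  have hyr (l : Fin d) : algebraMap S A (z l.castSucc - t ^ (N l + 1)) =
      algebraMap R A (r l.castSucc - r (Fin.last d) ^ (N l + 1)) := by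
    simp only [map_sub, map_pow, hzr, ht]
  refine ⟨Fin.snoc (fun l => z l.castSucc - t ^ (N l + 1)) t,
    fun l => r l.castSucc - r (Fin.last d) ^ (N l + 1),
    hzreg.sub_mul (m := Fin.last d) (c := Fin.snoc (fun l => t ^ N l) 0) (by simp [ht]) ?_,
    fun l => by rw [Fin.snoc_castSucc, hyr], ?_, k, ?_⟩
  · intro i hi
    refine Fin.lastCases (fun h => absurd rfl h) (fun l _ => ?_) i hi
    rw [Fin.snoc_castSucc, Fin.snoc_castSucc, pow_succ']
  · have h2 := IsLocalRing.isWeaklyRegular_of_perm_of_subset_maximalIdeal hN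
      (List.perm_append_comm) (by
        intro s hs
        rw [List.mem_append, List.mem_ofFn, List.mem_singleton] at hs
        obtain ⟨l, rfl⟩ | rfl := hs
        · exact sub_mem (hzreg.mem _) (Ideal.pow_mem_of_mem _ (hzreg.mem _) _ (Nat.succ_pos _))
        · exact hfm)
    rw [List.singleton_append, isWeaklyRegular_cons_iff,
      quotSMulTop_isWeaklyRegular_iff hπ hker, List.map_ofFn] at h2
    convert h2.2 using 2
    ext l
    exact (hyr l).symm
  · rw [← map_maximalIdeal_of_surjective _ hπ, ← Ideal.map_pow]
    refine (Ideal.map_mono hk).trans ?_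
    rw [Ideal.map_sup, Ideal.map_span, Ideal.map_span, Set.image_singleton,
      ← Set.range_comp]
    have h3 : algebraMap S A f = 0 := by
      rw [← RingHom.mem_ker, hker]; exact Ideal.mem_span_singleton_self f
    rw [h3, Ideal.span_singleton_zero, sup_bot_eq]
    simp only [Function.comp_def, hyr, le_refl]

end Coordinates

/-! ### Length estimates -/

section Length

open RingTheory.Sequence
open scoped Pointwise

namespace ClData

variable {A : Type u} [CommRing A] {D : ℕ} (c : ClData A D)

lemma dif_wedge {Z : Type*} [AddCommGroup Z] [Module A Z] (l : Fin D) (z : Finset (Fin D) → Z) :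
    c.dif Z (wedge l z) + wedge l (c.dif Z z) = c.x l • z := by
  have h1 : opSum c.a wedge (wedge l z) = - wedge l (opSum c.a wedge z) := by
    simp only [opSum_apply, map_sum, wedge_smul, ← Finset.sum_neg_distrib]
    exact Finset.sum_congr rfl fun m _ => by rw [wedge_wedge, smul_neg]
  have h2 := opSum_contr_wedge c.x (Pi.single l 1) z
  have h3 : ∀ w : Finset (Fin D) → Z, opSum (Pi.single l (1 : A)) wedge w = wedge l w := by
    intro w
    rw [opSum_apply, Finset.sum_eq_single l (fun m _ hm => by simp [Pi.single_eq_of_ne hm])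
      (by simp)]
    simp
  rw [h3, h3, Finset.sum_eq_single l (fun m _ hm => by simp [Pi.single_eq_of_ne hm])
    (by simp), Pi.single_eq_same, mul_one] at h2
  rw [← h2, dif_apply, dif_apply, map_add, h1]
  abel

lemma map_mkQ_injective {Z : Type u} [AddCommGroup Z] [Module A Z] (l : Fin D)
    (hr : IsSMulRegular Z (c.x l)) :
    Function.Injective (c.map (Submodule.mkQ (c.x l • (⊤ : Submodule A Z)))) := by
  rw [← LinearMap.ker_eq_bot, Submodule.eq_bot_iff]
  intro t ht
  obtain ⟨z, hz, rfl⟩ := c.exists_rep t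
  rw [LinearMap.mem_ker, map_cls, cls_eq_zero] at ht
  obtain ⟨w, hw⟩ := ht
  choose w' hw' using fun I => Submodule.mkQ_surjective _ (w I)
  obtain rfl : Submodule.mkQ (c.x l • (⊤ : Submodule A Z)) ∘ w' = w := funext hw'
  rw [dif_map] at hw
  have h1 : ∀ I, ∃ v, c.x l • v = z I - c.dif Z w' I := fun I => by
    have := congrFun hw.symm I
    simp only [Function.comp_apply, Submodule.mkQ_apply] at this
    rw [Submodule.Quotient.eq, Submodule.mem_smul_pointwise_iff_exists] at this
    simpa using this
  choose v hv using h1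
  have hv' : c.x l • v = z - c.dif Z w' := funext hv
  have h2 : c.dif Z v = 0 := by
    have : c.x l • c.dif Z v = 0 := by rw [← map_smul, hv', map_sub, hz, dif_dif, sub_zero]
    ext I
    exact hr (by simpa using congrFun this I)
  rw [cls_eq_zero]
  refine ⟨w' + wedge l v, ?_⟩
  have h3 := c.dif_wedge l v
  rw [h2, map_zero, add_zero] at h3
  rw [map_add, h3, hv', add_sub_cancel]

lemma length_T_le {rs : List A} : ∀ {Z : Type u} [AddCommGroup Z] [Module A Z],
    (∀ r ∈ rs, ∃ l, c.x l = r) → IsWeaklyRegular Z rs →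
    Module.length A (c.T Z) ≤
      2 ^ D * Module.length A (Z ⧸ Ideal.ofList rs • (⊤ : Submodule A Z)) := by
  induction rs with
  | nil =>
    intro Z _ _ _ _
    rw [(Submodule.quotEquivOfEqBot (Ideal.ofList [] • (⊤ : Submodule A Z))
      (by rw [Ideal.ofList_nil, Submodule.bot_smul])).length_eq]
    refine (Module.length_le_of_surjective _ (Submodule.mkQ_surjective _)).trans
      ((Module.length_le_of_injective _ (Submodule.subtype_injective _)).trans ?_)
    rw [Module.length_pi_of_fintype]
    simp
  | cons r rs ih =>
    intro Z _ _ hx hr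
    obtain ⟨l, rfl⟩ := hx r (by simp)
    rw [isWeaklyRegular_cons_iff] at hr
    rw [(Submodule.quotOfListConsSMulTopEquivQuotSMulTopInner Z (c.x l) rs).length_eq]
    exact (Module.length_le_of_injective _ (c.map_mkQ_injective l hr.1)).trans
      (ih (fun r h => hx r (by simp [h])) hr.2)

end ClData

lemma HypData.length_quot_pow_succ_le {A : Type u} [CommRing A] [IsLocalRing A]
    [IsNoetherianRing A] {D : ℕ} (h : HypData A D) {n : ℕ} (hn : h.e ≤ n) :
    Module.length A (A ⧸ maximalIdeal A ^ (n + 1)) ≤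
      Module.length A (h.T ↥(maximalIdeal A ^ n)) + Module.length A (A ⧸ maximalIdeal A ^ n) := by
  classical
  let ψ : ↥(maximalIdeal A ^ n) →ₗ[A] (Finset (Fin D) → QRing h.Fbar) :=
    (LinearMap.single A (fun _ : Finset (Fin D) => QRing h.Fbar) ∅).comp (h.symb n)
  have h1 : LinearMap.range ψ ≤ LinearMap.range (h.symbT n) := by
    rintro _ ⟨z, rfl⟩
    rw [LinearMap.mem_range, h.mem_range_symbT hn]
    refine ⟨fun I => ?_, ?_⟩
    · by_cases hI : I = ∅
      · subst hI
        simpa [ψ] using h.symb_mem z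
      · simp [ψ, Pi.single_eq_of_ne hI]
    · have : ∀ l, contr l (ψ z) = 0 := contr_eq_zero_iff.2 (by simp [ψ])
      rw [opSum_apply]
      exact Finset.sum_eq_zero fun l _ => by rw [this, smul_zero]
  have h2 : ∀ z, ψ z = 0 ↔ (z : A) ∈ maximalIdeal A ^ (n + 1) := fun z => by
    rw [← h.symb_eq_zero_iff]
    simp [ψ]
  let ρ : (A ⧸ maximalIdeal A ^ (n + 1)) →ₗ[A] (A ⧸ maximalIdeal A ^ n) :=
    Submodule.factor (Ideal.pow_le_pow_right n.le_succ)
  have hρ : Function.Surjective ρ := Submodule.factor_surjective _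
  rw [Module.length_eq_add_of_exact (LinearMap.ker ρ).subtype ρ (Submodule.subtype_injective _) hρ
    (LinearMap.exact_subtype_ker_map ρ)]
  gcongr
  let τ : ↥(maximalIdeal A ^ n) →ₗ[A] LinearMap.ker ρ :=
    ((Submodule.mkQ (maximalIdeal A ^ (n + 1))).comp (Submodule.subtype _)).codRestrict _
      fun z => by
        simp only [LinearMap.comp_apply, LinearMap.mem_ker, Submodule.mkQ_apply, ρ,
          Submodule.subtype_apply]
        exact (Submodule.Quotient.mk_eq_zero _).2 z.2
  have hτ : Function.Surjective τ := by
    rintro ⟨y, hy⟩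
    obtain ⟨y, rfl⟩ := Submodule.Quotient.mk_surjective _ y
    refine ⟨⟨y, ?_⟩, rfl⟩
    rw [LinearMap.mem_ker] at hy
    exact (Submodule.Quotient.mk_eq_zero _).1 hy
  have hker : LinearMap.ker ψ ≤ LinearMap.ker τ := fun z hz => by
    rw [LinearMap.mem_ker, h2] at hz
    rw [LinearMap.mem_ker]
    exact Subtype.ext ((Submodule.Quotient.mk_eq_zero _).2 hz)
  calc Module.length A (LinearMap.ker ρ)
      ≤ Module.length A (↥(maximalIdeal A ^ n) ⧸ LinearMap.ker ψ) :=
        Module.length_le_of_surjective ((LinearMap.ker ψ).liftQ τ hker) (fun y => by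
          obtain ⟨z, rfl⟩ := hτ y
          exact ⟨Submodule.Quotient.mk z, Submodule.liftQ_apply _ _ _⟩)
    _ = Module.length A (LinearMap.range ψ) := ψ.quotKerEquivRange.length_eq
    _ ≤ Module.length A (LinearMap.range (h.symbT n)) :=
        Module.length_le_of_injective _ (Submodule.inclusion_injective h1)
    _ = Module.length A (h.T ↥(maximalIdeal A ^ n)) :=
        (LinearEquiv.ofInjective _ (h.symbT_injective (by omega))).length_eq.symm

lemma length_quot_le {A N : Type*} [CommRing A] [AddCommGroup N] [Module A N] (J : Ideal A) {μ : ℕ}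
    (p : (Fin μ → A) →ₗ[A] N) (hp : Function.Surjective p) :
    Module.length A (N ⧸ J • (⊤ : Submodule A N)) ≤ μ * Module.length A (A ⧸ J) := by
  let q : (Fin μ → A ⧸ J) →ₗ[A] (N ⧸ J • (⊤ : Submodule A N)) :=
    LinearMap.lsum A (fun _ => A ⧸ J) A fun i => Submodule.liftQ J
      ((Submodule.mkQ _).comp (p.comp (LinearMap.single A (fun _ => A) i))) (fun a ha => by
        rw [LinearMap.mem_ker, LinearMap.comp_apply, Submodule.mkQ_apply,
          Submodule.Quotient.mk_eq_zero]
        have : a = a • (1 : A) := by simp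
        rw [this, map_smul]
        exact Submodule.smul_mem_smul ha trivial)
  have hq : Function.Surjective q := by
    intro y
    obtain ⟨y, rfl⟩ := Submodule.mkQ_surjective _ y
    obtain ⟨v, rfl⟩ := hp y
    refine ⟨fun i => Submodule.Quotient.mk (v i), ?_⟩
    conv_rhs => rw [← Finset.univ_sum_single v, map_sum, map_sum]
    simp only [q, LinearMap.lsum_apply, LinearMap.sum_apply, LinearMap.comp_apply]
    exact Finset.sum_congr rfl fun i _ => rfl
  refine (Module.length_le_of_surjective q hq).trans ?_
  rw [Module.length_pi_of_fintype]
  simp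

/-- The lengths of `A/𝔪ⁿ` bound the number of generators of syzygies of `A/𝔪ⁿ`. -/
theorem HypData.length_le_of_syzygy {A : Type u} [CommRing A] [IsLocalRing A] [IsNoetherianRing A]
    {D : ℕ} (h : HypData A D) {rs : List A} (hrs : IsWeaklyRegular A rs)
    (hx : ∀ r ∈ rs, ∃ l, h.x l = r) (hD : 3 ≤ D) {n : ℕ} (hn : h.e ≤ n)
    {N : Type u} [AddCommGroup N] [Module A N]
    (hN : IsMinimalSyzygyOf A (rs.length + 1) N (A ⧸ maximalIdeal A ^ n)) {μ : ℕ}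
    (p : (Fin μ → A) →ₗ[A] N) (hp : Function.Surjective p) :
    Module.length A (A ⧸ maximalIdeal A ^ (n + 1)) ≤
      2 ^ D * (μ * Module.length A (A ⧸ Ideal.ofList rs)) +
        Module.length A (A ⧸ maximalIdeal A ^ n) := by
  obtain ⟨ε⟩ := h.T_syzygy hD hn _ hN
  have h1 := IsMinimalSyzygyOf.isWeaklyRegular hrs _ hN
  rw [List.take_of_length_le (Nat.le_succ _)] at h1
  refine (h.length_quot_pow_succ_le hn).trans ?_
  gcongr
  rw [← ε.length_eq]
  refine (h.toClData.length_T_le hx h1).trans ?_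
  gcongr
  exact length_quot_le _ p hp

end Length

/-! ### Lattices, extensions and the `h`-length -/

section Extensions

variable {Λ : Type u} [Ring Λ] {M L Y : Type u} [AddCommGroup M] [Module Λ M]
  [AddCommGroup L] [Module Λ L] [AddCommGroup Y] [Module Λ Y]

lemma Ext1Vanishes.exists_lift {π : L →ₗ[Λ] Y}
    (h : Ext1Vanishes Λ M (LinearMap.ker π)) (hπ : Function.Surjective π) (f : M →ₗ[Λ] Y) :
    ∃ f' : M →ₗ[Λ] L, π.comp f' = f := by
  let E : Submodule Λ (M × L) :=
    LinearMap.ker (f.comp (LinearMap.fst Λ M L) - π.comp (LinearMap.snd Λ M L))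
  have hE : ∀ z : M × L, z ∈ E ↔ f z.1 = π z.2 := fun z => by
    simp [E, sub_eq_zero]
  let g : E →ₗ[Λ] M := (LinearMap.fst Λ M L).comp E.subtype
  have hg : Function.Surjective g := fun m => by
    obtain ⟨l, hl⟩ := hπ (f m)
    exact ⟨⟨(m, l), (hE _).2 hl.symm⟩, rfl⟩
  let i : LinearMap.ker π →ₗ[Λ] LinearMap.ker g :=
    (((LinearMap.inr Λ M L).comp (LinearMap.ker π).subtype).codRestrict E fun z => by
      rw [hE]; exact (map_zero f).trans (LinearMap.mem_ker.1 z.2).symm).codRestrict _ fun z => rfl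
  have hi : Function.Bijective i := by
    refine ⟨fun z w hzw => ?_, ?_⟩
    · exact Subtype.ext (congrArg (fun y : LinearMap.ker g => y.1.1.2) hzw)
    · rintro ⟨⟨⟨m, l⟩, h1⟩, h2⟩
      obtain rfl : m = 0 := h2
      rw [hE] at h1
      exact ⟨⟨l, by simpa using h1.symm⟩, rfl⟩
  obtain ⟨s, hs⟩ := h E _ _ g hg ⟨(LinearEquiv.ofBijective i hi).symm⟩
  refine ⟨(LinearMap.snd Λ M L).comp (E.subtype.comp s), ?_⟩
  ext m
  have h1 := (hE _).1 (s m).2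
  have h2 : (s m).1.1 = m := LinearMap.congr_fun hs m
  rw [h2] at h1
  exact h1.symm

lemma Ext1Vanishes.exists_extend (h : Ext1Vanishes Λ M L) {F : Type u} [AddCommGroup F]
    [Module Λ F] {π : F →ₗ[Λ] M} (hπ : Function.Surjective π) (f : LinearMap.ker π →ₗ[Λ] L) :
    ∃ f' : F →ₗ[Λ] L, f'.comp (LinearMap.ker π).subtype = f := by
  let K : Submodule Λ (F × L) := LinearMap.range ((LinearMap.ker π).subtype.prod (-f))
  have hK : ∀ z : F × L, z ∈ K ↔ ∃ h : π z.1 = 0, -f ⟨z.1, h⟩ = z.2 := fun z => by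
    constructor
    · rintro ⟨w, rfl⟩
      exact ⟨w.2, rfl⟩
    · rintro ⟨h1, h2⟩
      exact ⟨⟨z.1, h1⟩, Prod.ext rfl h2⟩
  let g : ((F × L) ⧸ K) →ₗ[Λ] M := K.liftQ (π.comp (LinearMap.fst Λ F L)) fun z hz => by
    obtain ⟨h1, -⟩ := (hK z).1 hz
    simpa using h1
  have hg : Function.Surjective g := fun m => by
    obtain ⟨v, rfl⟩ := hπ m
    exact ⟨K.mkQ (v, 0), by simp [g]⟩
  let i : L →ₗ[Λ] LinearMap.ker g :=
    (K.mkQ.comp (LinearMap.inr Λ F L)).codRestrict _ fun z => by simp [g]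
  have hi : Function.Bijective i := by
    refine ⟨(injective_iff_map_eq_zero i).2 fun z hz => ?_, ?_⟩
    · have h1 : K.mkQ (0, z) = 0 := congrArg Subtype.val hz
      rw [Submodule.mkQ_apply, Submodule.Quotient.mk_eq_zero, hK] at h1
      obtain ⟨h1, h2⟩ := h1
      exact h2.symm.trans (map_zero (-f))
    · rintro ⟨z, hz⟩
      obtain ⟨⟨v, l⟩, rfl⟩ := K.mkQ_surjective z
      have hv : π v = 0 := by simpa [g] using hz
      refine ⟨l + f ⟨v, hv⟩, Subtype.ext ?_⟩
      change K.mkQ (0, l + f ⟨v, hv⟩) = K.mkQ (v, l)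
      rw [← sub_eq_zero, ← map_sub, Submodule.mkQ_apply, Submodule.Quotient.mk_eq_zero, ← neg_mem_iff,
        hK]
      exact ⟨by simpa using hv, by simp⟩
  obtain ⟨s, hs⟩ := h _ _ _ g hg ⟨(LinearEquiv.ofBijective i hi).symm⟩
  let t : F →ₗ[Λ] LinearMap.ker g := (K.mkQ.comp (LinearMap.inl Λ F L) - s.comp π).codRestrict _
    fun v => by
      have := LinearMap.congr_fun hs (π v)
      simp only [LinearMap.comp_apply, LinearMap.id_apply] at this
      rw [LinearMap.mem_ker, LinearMap.sub_apply, map_sub, LinearMap.comp_apply s, this]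
      simp [g]
  refine ⟨(LinearEquiv.ofBijective i hi).symm.toLinearMap.comp t, ?_⟩
  ext w
  rw [LinearMap.comp_apply, LinearMap.comp_apply, LinearEquiv.coe_coe, LinearEquiv.symm_apply_eq]
  refine Subtype.ext ?_
  change K.mkQ ((w : F), (0 : L)) - s (π w) = K.mkQ (0, f w)
  rw [LinearMap.mem_ker.1 w.2, map_zero, sub_zero, ← sub_eq_zero, ← map_sub, Submodule.mkQ_apply,
    Submodule.Quotient.mk_eq_zero, hK]
  exact ⟨by simp, by simp⟩

lemma Ext1Vanishes.of_exists_extend {F : Type u} [AddCommGroup F] [Module Λ F]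
    [Module.Projective Λ F] {π : F →ₗ[Λ] M} (hπ : Function.Surjective π)
    (h : ∀ f : LinearMap.ker π →ₗ[Λ] Y, ∃ f' : F →ₗ[Λ] Y, f'.comp (LinearMap.ker π).subtype = f) :
    Ext1Vanishes Λ M Y := by
  rintro E _ _ g hg ⟨ε⟩
  obtain ⟨p, hp⟩ := Module.projective_lifting_property g π hg
  have hp' : ∀ v, g (p v) = π v := LinearMap.congr_fun hp
  let f : LinearMap.ker π →ₗ[Λ] LinearMap.ker g :=
    (p.comp (LinearMap.ker π).subtype).codRestrict _ fun v => by simp [hp']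
  obtain ⟨f', hf'⟩ := h (ε.toLinearMap.comp f)
  let q : F →ₗ[Λ] E := p - (LinearMap.ker g).subtype.comp (ε.symm.toLinearMap.comp f')
  have hq : LinearMap.ker π ≤ LinearMap.ker q := fun v hv => by
    have := LinearMap.congr_fun hf' ⟨v, hv⟩
    simp only [LinearMap.comp_apply, Submodule.subtype_apply, LinearEquiv.coe_coe] at this
    simp only [q, LinearMap.mem_ker, LinearMap.sub_apply, LinearMap.comp_apply, this,
      LinearEquiv.coe_coe, LinearEquiv.symm_apply_apply]
    exact sub_self _
  refine ⟨((LinearMap.ker π).liftQ q hq).comp (π.quotKerEquivOfSurjective hπ).symm.toLinearMap, ?_⟩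
  ext m
  obtain ⟨v, rfl⟩ := hπ m
  have : (π.quotKerEquivOfSurjective hπ).symm (π v) = Submodule.Quotient.mk v := by
    rw [LinearEquiv.symm_apply_eq]; rfl
  simp [this, q, hp']

lemma Ext1Vanishes.of_surjective {F : Type u} [AddCommGroup F] [Module Λ F] [Module.Projective Λ F]
    {p : F →ₗ[Λ] M} (hp : Function.Surjective p) {π : L →ₗ[Λ] Y} (hπ : Function.Surjective π)
    (hL : Ext1Vanishes Λ M L) (hK : Ext1Vanishes Λ (LinearMap.ker p) (LinearMap.ker π)) :
    Ext1Vanishes Λ M Y := by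
  refine .of_exists_extend hp fun f => ?_
  obtain ⟨f₁, hf₁⟩ := hK.exists_lift hπ f
  obtain ⟨f₂, hf₂⟩ := hL.exists_extend hp f₁
  exact ⟨π.comp f₂, by rw [LinearMap.comp_assoc, hf₂, hf₁]⟩

end Extensions

section Lattices

open RingTheory.Sequence

variable {R : Type u} [CommRing R]

lemma projective_localizedModule_of_exact (S : Submonoid R) {K F M : Type u} [AddCommGroup K]
    [Module R K] [AddCommGroup F] [Module R F] [AddCommGroup M] [Module R M] [Module.Projective R F]
    {i : K →ₗ[R] F} {p : F →ₗ[R] M} (hi : Function.Injective i) (hp : Function.Surjective p)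
    (hip : Function.Exact i p) (hM : Module.Projective (Localization S) (LocalizedModule S M)) :
    Module.Projective (Localization S) (LocalizedModule S K) := by
  have h1 : Function.Exact (LocalizedModule.map S i) (LocalizedModule.map S p) :=
    LocalizedModule.map_exact S i p hip
  have h2 := LocalizedModule.map_surjective S p hp
  obtain ⟨l, hl⟩ := Module.projective_lifting_property (LocalizedModule.map S p) LinearMap.id h2
  obtain ⟨s, hs⟩ := ((h1.split_tfae (LocalizedModule.map_injective S i hi) h2).out 0 1 rfl rfl).1 ⟨l, hl⟩
  exact Module.Projective.of_split _ s hs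

variable [IsLocalRing R]

/-- Finite modules on which `rs` is regular and which are locally projective on the punctured
spectrum. -/
structure PreLattice (rs : List R) (N : Type u) [AddCommGroup N] [Module R N] : Prop where
  finite : Module.Finite R N
  reg : IsWeaklyRegular N rs
  proj : ∀ (p : Ideal R) [p.IsPrime], p ≠ maximalIdeal R →
    Module.Projective (Localization.AtPrime p) (LocalizedModule p.primeCompl N)

lemma PreLattice.ker [IsNoetherianRing R] {rs : List R} (hrs : IsWeaklyRegular R rs)
    {N : Type u} [AddCommGroup N] [Module R N] (hN : PreLattice rs N) {n : ℕ}
    {p : (Fin n → R) →ₗ[R] N} (hp : Function.Surjective p) :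
    PreLattice rs (LinearMap.ker p) where
  finite := inferInstance
  reg := by
    rcases List.eq_nil_or_concat rs with rfl | ⟨l, r, rfl⟩
    · exact .nil _ _
    · rw [List.concat_eq_append] at hrs hN ⊢
      exact IsWeaklyRegular.ker (LinearMap.ker p).subtype p (Submodule.subtype_injective _) hp
        (LinearMap.exact_subtype_ker_map p) (BT.IsWeaklyRegular.pi hrs n)
        ((isWeaklyRegular_append_iff _ _ _).1 hN.reg).1
  proj q _ hq := projective_localizedModule_of_exact _ (Submodule.subtype_injective _) hp
    (LinearMap.exact_subtype_ker_map p) (hN.proj q hq)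

lemma PreLattice.isLatticeC {rs : List R} (hm : ∀ r ∈ rs, r ∈ maximalIdeal R)
    (hd : (rs.length : WithBot ℕ∞) = ringKrullDim R)
    {N : Type u} [AddCommGroup N] [Module R N] [Nontrivial N] (hN : PreLattice rs N) :
    IsLatticeC R N := by
  have := hN.finite
  refine ⟨inferInstance, ⟨rs, hm, .of_isWeaklyRegular_of_mem_maximalIdeal _ hm hN.reg, hd⟩,
    fun p _ hp => ?_⟩
  have := hN.proj p hp
  have : Module.Finite (Localization.AtPrime p) (LocalizedModule p.primeCompl N) := inferInstance
  exact Module.free_of_flat_of_isLocalRing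

lemma IsMinimalSyzygyOf.preLattice [IsNoetherianRing R] {rs : List R}
    (hrs : IsWeaklyRegular R rs) (n : ℕ) {i : ℕ} (hi : rs.length ≤ i) {N : Type u} [AddCommGroup N]
    [Module R N] (hN : IsMinimalSyzygyOf R i N (R ⧸ maximalIdeal R ^ n)) : PreLattice rs N where
  finite := hN.finite
  reg := by simpa [List.take_of_length_le hi] using hN.isWeaklyRegular hrs
  proj p _ hp := by
    clear hi
    induction i generalizing N with
    | zero =>
      obtain ⟨ε⟩ := hN
      have : Subsingleton (LocalizedModule p.primeCompl N) := by
        rw [IsLocalizedModule.subsingleton_iff p.primeCompl (LocalizedModule.mkLinearMap _ _)]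
        have h1 : ¬ maximalIdeal R ≤ p := fun h =>
          hp ((le_maximalIdeal (Ideal.IsPrime.ne_top ‹_›)).antisymm h)
        obtain ⟨s, hs, hsp⟩ := SetLike.not_le_iff_exists.1 h1
        intro z
        refine ⟨s ^ n, p.primeCompl.pow_mem hsp n, ε.injective ?_⟩
        obtain ⟨y, hy⟩ := Submodule.Quotient.mk_surjective _ (ε z)
        rw [map_smul, map_zero, ← hy, ← Submodule.Quotient.mk_smul, Submodule.Quotient.mk_eq_zero]
        exact Ideal.mul_mem_right _ _ (Ideal.pow_mem_pow hs n)
      infer_instance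
    | succ i ih =>
      obtain ⟨K, _, _, hK, m, π, hπ, -, ⟨ε⟩⟩ := hN
      exact projective_localizedModule_of_exact _
        (i := (LinearMap.ker π).subtype.comp ε.toLinearMap)
        ((Submodule.subtype_injective _).comp ε.injective) hπ (fun z => by
          rw [LinearMap.exact_subtype_ker_map π z, LinearMap.coe_comp]
          exact (ε.surjective.range_comp _ ▸ Iff.rfl)) (ih hK)

lemma PreLattice.ext1Vanishes [IsNoetherianRing R] {rs : List R}
    (hrs : IsWeaklyRegular R rs) (hm : ∀ r ∈ rs, r ∈ maximalIdeal R)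
    (hd : (rs.length : WithBot ℕ∞) = ringKrullDim R) :
    ∀ (t : ℕ) {N Y : Type u} [AddCommGroup N] [Module R N] [AddCommGroup Y] [Module R Y],
    PreLattice rs N → HasLatInjResOfLengthC R t Y → Ext1Vanishes R N Y := by
  have key : ∀ {N L : Type u} [AddCommGroup N] [Module R N] [AddCommGroup L] [Module R L],
      PreLattice rs N → IsLatInjectiveC R L → Ext1Vanishes R N L := by
    intro N L _ _ _ _ hN hL
    cases subsingleton_or_nontrivial N with
    | inl _ => exact fun E _ _ g _ _ => ⟨0, LinearMap.ext fun z => Subsingleton.elim _ _⟩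
    | inr _ => exact hL.2 N _ _ (hN.isLatticeC hm hd)
  intro t
  induction t with
  | zero => exact fun hN hY => key hN hY
  | succ t ih =>
    rintro N Y _ _ _ _ hN ⟨L, _, _, π, hL, hπ, hK⟩
    have := hN.finite
    obtain ⟨n, p, hp⟩ := Module.Finite.exists_fin' R N
    exact .of_surjective hp hπ (key hN hL) (ih (hN.ker hrs hp) hK)

lemma length_residueField : Module.length R (ResidueField R) = 1 := by
  rw [Module.length_eq_one_iff]
  exact isSimpleModule_iff_quot_maximal.2 ⟨_, inferInstance, ⟨LinearEquiv.refl _ _⟩⟩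

/-- A minimal system of generators has at most as many elements as the length of `Hom(N, k)`. -/
lemma exists_minimal_generators (N : Type u) [AddCommGroup N] [Module R N] [Module.Finite R N] :
    ∃ (μ : ℕ) (p : (Fin μ → R) →ₗ[R] N), Function.Surjective p ∧
      (μ : ℕ∞) ≤ Module.length R (N →ₗ[R] ResidueField R) := by
  let b := Module.finBasis (ResidueField R) (TensorProduct R (ResidueField R) N)
  choose f hf using fun i => TensorProduct.mk_surjective R N (ResidueField R) residue_surjective (b i)
  have hs := span_eq_top_of_tmul_eq_basis f b hf
  refine ⟨_, Fintype.linearCombination R f, ?_, ?_⟩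
  · rw [← LinearMap.range_eq_top, Fintype.range_linearCombination, hs]
  · let ev : (N →ₗ[R] ResidueField R) →ₗ[R]
        (Fin (Module.finrank (ResidueField R) (TensorProduct R (ResidueField R) N)) →
          ResidueField R) :=
      LinearMap.pi fun i => LinearMap.applyₗ (f i)
    have hev : Function.Surjective ev := fun v =>
      ⟨((b.constr (ResidueField R) v).restrictScalars R).comp (TensorProduct.mk R _ N 1), by
        ext i
        change b.constr (ResidueField R) v (TensorProduct.mk R (ResidueField R) N 1 (f i)) = v i
        rw [hf, b.constr_basis]⟩
    refine le_trans (le_of_eq ?_) (Module.length_le_of_surjective ev hev)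
    rw [Module.length_pi_of_fintype]
    simp [length_residueField]

/-- The `h`-length of `N` is at least the length of `Hom(N, k)`. -/
lemma length_le_hLengthC {N G : Type u} [AddCommGroup N] [Module R N] [AddCommGroup G] [Module R G]
    {α : G →ₗ[R] ResidueField R} (hα : Function.Surjective α)
    (hext : Ext1Vanishes R N (LinearMap.ker α))
    (hN : ∀ q : N →ₗ[R] R, ¬ Function.Surjective q) :
    (Module.length R (N →ₗ[R] ResidueField R) : WithBot ℕ∞) ≤ hLengthC R N G := by
  let Ψ : (N →ₗ[R] N × G) →ₗ[R] (N →ₗ[R] ResidueField R) :=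
    LinearMap.compRight R (α.comp (LinearMap.snd R N G))
  have hΨ : projTrivial R R N (N × G) ≤ LinearMap.ker Ψ := by
    rintro _ ⟨P, _, _, hP, g, h, rfl⟩
    obtain ⟨q, hq⟩ := Module.projective_lifting_property (Algebra.linearMap R (ResidueField R))
      ((α.comp (LinearMap.snd R N G)).comp h) residue_surjective
    rw [LinearMap.mem_ker]
    change ((α.comp (LinearMap.snd R N G)).comp h).comp g = 0
    rw [← hq]
    ext z
    have h1 : q (g z) ∈ maximalIdeal R := by
      by_contra h1
      obtain ⟨v, hv⟩ := not_not.1 h1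
      refine hN (q.comp g) fun r => ⟨(r * ↑v⁻¹) • z, ?_⟩
      rw [map_smul, LinearMap.comp_apply, ← hv, smul_eq_mul, mul_assoc, Units.inv_mul, mul_one]
    exact (residue_eq_zero_iff _).2 h1
  have h1 : Function.Surjective ((projTrivial R R N (N × G)).liftQ Ψ hΨ) := fun f => by
    obtain ⟨f', hf'⟩ := hext.exists_lift hα f
    refine ⟨Submodule.Quotient.mk ((LinearMap.inr R N G).comp f'), ?_⟩
    rw [Submodule.liftQ_apply, ← hf']
    rfl
  have h2 := Module.length_le_of_surjective _ h1
  exact (WithBot.coe_le_coe.2 h2).trans_eq (Module.coe_length _ _)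

end Lattices

/-! ### Syzygies of powers of the maximal ideal -/

section Main

open TensorProduct RingTheory.Sequence

/-- A presentation of an unramified extension `A` of `R` as a hypersurface whose first coordinates
come from a regular sequence in `R`. -/
structure HypersurfaceExt {R A : Type u} [CommRing R] [IsLocalRing R] [CommRing A] [IsLocalRing A]
    [Algebra R A] {D : ℕ} (h : HypData A D) (m : Fin D) (rs : List R) : Prop where
  unramified : UnramifiedExt R A
  noeth : IsNoetherianRing A
  three_le : 3 ≤ D
  reg : IsWeaklyRegular A (rs.map (algebraMap R A))
  mem : ∀ l, l ≠ m → h.x l ∈ rs.map (algebraMap R A)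
  exists_eq : ∀ r ∈ rs.map (algebraMap R A), ∃ l, h.x l = r
  dim : (rs.length : WithBot ℕ∞) = ringKrullDim R
  exists_pow_le : ∃ k, maximalIdeal A ^ k ≤ Ideal.ofList (rs.map (algebraMap R A))

namespace HypersurfaceExt

variable {R A : Type u} [CommRing R] [IsLocalRing R] [CommRing A] [IsLocalRing A]
  [Algebra R A] {D : ℕ} {h : HypData A D} {m : Fin D} {rs : List R}

lemma mem_maximalIdeal' (H : HypersurfaceExt h m rs) :
    ∀ r ∈ rs.map (algebraMap R A), r ∈ maximalIdeal A := by
  intro r hr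
  obtain ⟨l, rfl⟩ := H.exists_eq r hr
  exact h.x_mem_maximalIdeal l

lemma mem_maximalIdeal (H : HypersurfaceExt h m rs) : ∀ r ∈ rs, r ∈ maximalIdeal R := by
  intro r hr
  have := H.unramified.isLocalHom
  have h1 := H.mem_maximalIdeal' _ (List.mem_map_of_mem hr)
  rw [IsLocalRing.mem_maximalIdeal, mem_nonunits_iff] at h1 ⊢
  exact fun h2 => h1 (h2.map _)

variable {n : ℕ} {N : Type u} [AddCommGroup N] [Module R N]

lemma isMinimalSyzygyOf_baseChange (H : HypersurfaceExt h m rs)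
    (hN : IsMinimalSyzygyOf R (rs.length + 1) N (R ⧸ maximalIdeal R ^ n)) :
    IsMinimalSyzygyOf A ((rs.map (algebraMap R A)).length + 1) (A ⊗[R] N)
      (A ⧸ maximalIdeal A ^ n) := by
  rw [List.length_map]
  exact H.unramified.isMinimalSyzygyOf (H.unramified.quotPowEquiv n) _ hN

lemma length_le (H : HypersurfaceExt h m rs) (hn : h.e ≤ n)
    (hN : IsMinimalSyzygyOf R (rs.length + 1) N (R ⧸ maximalIdeal R ^ n)) {μ : ℕ}
    (p : (Fin μ → R) →ₗ[R] N) (hp : Function.Surjective p) :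
    Module.length A (A ⧸ maximalIdeal A ^ (n + 1)) ≤
      2 ^ D * (μ * Module.length A (A ⧸ Ideal.ofList (rs.map (algebraMap R A)))) +
        Module.length A (A ⧸ maximalIdeal A ^ n) := by
  have := H.noeth
  refine h.length_le_of_syzygy H.reg H.exists_eq H.three_le hn (H.isMinimalSyzygyOf_baseChange hN)
    ((AlgebraTensorModule.lTensor A A p).comp
      (TensorProduct.piScalarRight R A A (Fin μ)).symm.toLinearMap) ?_
  exact (LinearMap.lTensor_surjective A hp).comp (LinearEquiv.surjective _)

lemma isIndecomposable [Nontrivial N] (H : HypersurfaceExt h m rs) (hn : h.e ≤ n)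
    (hN : IsMinimalSyzygyOf R (rs.length + 1) N (R ⧸ maximalIdeal R ^ n)) :
    IsIndecomposable R N := by
  have := H.noeth
  exact isIndecomposable_of_idempotent (H.unramified.idempotent
    (h.idempotent_syzygy H.reg H.mem H.mem_maximalIdeal' H.three_le hn
      (H.isMinimalSyzygyOf_baseChange hN)))

lemma length_hom_le [IsNoetherianRing R] (H : HypersurfaceExt h m rs)
    (hN : IsMinimalSyzygyOf R (rs.length + 1) N (R ⧸ maximalIdeal R ^ n))
    {G : Type u} [AddCommGroup G] [Module R G] {α : G →ₗ[R] ResidueField R}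
    (hG : IsResidueApprox R G α) :
    (Module.length R (N →ₗ[R] ResidueField R) : WithBot ℕ∞) ≤ hLengthC R N G := by
  have := H.noeth
  obtain ⟨-, hα, ⟨t, ht⟩, -⟩ := hG
  have hrs := H.unramified.isWeaklyRegular H.reg
  exact length_le_hLengthC hα
    ((hN.preLattice hrs n (Nat.le_succ _)).ext1Vanishes hrs H.mem_maximalIdeal H.dim t ht)
    (not_surjective_of_baseChange (h.not_surjective H.reg H.mem H.mem_maximalIdeal'
      (H.isMinimalSyzygyOf_baseChange hN)))

lemma length_ne_top (H : HypersurfaceExt h m rs)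
    (hfin : ∀ n, Module.length A (A ⧸ maximalIdeal A ^ n) ≠ ⊤) :
    Module.length A (A ⧸ Ideal.ofList (rs.map (algebraMap R A))) ≠ ⊤ := by
  obtain ⟨k, hk⟩ := H.exists_pow_le
  exact ne_top_of_le_ne_top (hfin k)
    (Module.length_le_of_surjective (Submodule.factor hk) (Submodule.factor_surjective hk))

lemma isLatticeC [IsNoetherianRing R] [Nontrivial N] (H : HypersurfaceExt h m rs)
    (hN : IsMinimalSyzygyOf R (rs.length + 1) N (R ⧸ maximalIdeal R ^ n)) : IsLatticeC R N :=
  (hN.preLattice (H.unramified.isWeaklyRegular H.reg) n (Nat.le_succ _)).isLatticeC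
    H.mem_maximalIdeal H.dim

/-- Growth of the Hilbert function forces the number of generators of the syzygies to grow. -/
lemma exists_bound (H : HypersurfaceExt h m rs)
    (hfin : ∀ n, Module.length A (A ⧸ maximalIdeal A ^ n) ≠ ⊤)
    (hgrow : ∀ j, Module.length A (A ⧸ maximalIdeal A ^ (h.e + 1 + j)) + (j + 1 : ℕ) ≤
      Module.length A (A ⧸ maximalIdeal A ^ (h.e + 1 + j + 1))) :
    ∃ c : ℕ, ∀ (j : ℕ) (N : Type u) [AddCommGroup N] [Module R N],
      IsMinimalSyzygyOf R (rs.length + 1) N (R ⧸ maximalIdeal R ^ (h.e + 1 + j)) →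
      ∀ (μ : ℕ) (p : (Fin μ → R) →ₗ[R] N), Function.Surjective p → j + 1 ≤ μ * c := by
  obtain ⟨c, hc⟩ := ENat.ne_top_iff_exists.1 (H.length_ne_top hfin)
  refine ⟨2 ^ D * c, fun j N _ _ hN μ p hp => ?_⟩
  have h1 := (hgrow j).trans (H.length_le (by omega) hN p hp)
  obtain ⟨l, hl⟩ := ENat.ne_top_iff_exists.1 (hfin (h.e + 1 + j))
  rw [← hc, ← hl] at h1
  norm_cast at h1
  linarith

end HypersurfaceExt

lemma HypersurfaceExt.exists_of_isRegSys {R S A : Type u} [CommRing R] [IsLocalRing R]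
    [CommRing S] [IsLocalRing S] [IsNoetherianRing S] [CommRing A] [IsLocalRing A]
    [Algebra R A] [Algebra S A] (hA : UnramifiedExt R A)
    (hR : ∀ b : A, ∃ r, b - algebraMap R A r ∈ maximalIdeal A ^ 2)
    (hπ : Function.Surjective (algebraMap S A)) {f : S}
    (hker : RingHom.ker (algebraMap S A) = Ideal.span {f}) (hf0 : f ≠ 0) {d e : ℕ}
    {x : Fin (d + 1) → S} (hx : IsRegSys x) (hd : 2 ≤ d) (hdim : ringKrullDim R = d)
    (he : 3 ≤ e) (hf : f ∈ maximalIdeal S ^ e) (hf' : f ∉ maximalIdeal S ^ (e + 1)) :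
    ∃ (h : HypData A (d + 1)) (rs : List R), h.e = e ∧ rs.length = d ∧
      HypersurfaceExt h (Fin.last d) rs := by
  obtain ⟨y, r, hy, hyr, hreg, k, hk⟩ :=
    hx.exists_coordinates hR hπ hker hf0 (Ideal.pow_le_self (by omega) hf)
  obtain ⟨h, hhe, hhx⟩ := exists_hypData (algebraMap S A) hπ hker hy he hf hf'
  have hxr (l : Fin d) : h.x l.castSucc = algebraMap R A (r l) := by rw [hhx, ← hyr]; rfl
  have hmap : (List.ofFn r).map (algebraMap R A) = List.ofFn fun l => algebraMap R A (r l) :=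
    List.map_ofFn ..
  refine ⟨h, List.ofFn r, hhe, List.length_ofFn, ?_⟩
  constructor
  · exact hA
  · exact isNoetherianRing_of_surjective S A (algebraMap S A) hπ
  · omega
  · rwa [hmap]
  · intro l hl
    obtain ⟨l, rfl⟩ := Fin.exists_castSucc_eq.2 hl
    rw [hmap, List.mem_ofFn, hxr]
    exact ⟨l, rfl⟩
  · intro a ha
    rw [hmap, List.mem_ofFn] at ha
    obtain ⟨l, rfl⟩ := ha
    exact ⟨_, hxr l⟩
  · rw [List.length_ofFn, hdim]
  · refine ⟨k, hk.trans (Ideal.span_mono ?_)⟩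
    rintro _ ⟨l, rfl⟩
    rw [Set.mem_ofPred_eq, hmap, List.mem_ofFn]
    exact ⟨l, rfl⟩

end Main

/-- Let `(R, 𝔪)` be an abstract hypersurface of dimension `d ≥ 2` (a noetherian
local ring whose `𝔪`-adic completion is `S/(f)` for a regular local ring `S`
and `f` in the square of its maximal ideal).  If the Hilbert–Samuel
multiplicity satisfies `e(R) > 2`, then for each `n > e(R)` the `(d+1)`-st
syzygy `Ω_R^{d+1}(R/𝔪ⁿ)` (in a minimal free resolution) is an indecomposable
`R`-lattice, and the `h`-lengths of these lattices are unbounded. -/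
theorem hypersurface_indecomposable_lattices_of_unbounded_hLength
    (R : Type u) [CommRing R] [IsNoetherianRing R] [IsLocalRing R]
    (d : ℕ) (hd : 2 ≤ d) (hdim : ringKrullDim R = (d : WithBot ℕ∞))
    (hhyp : ∃ (S : Type u) (_ : CommRing S) (_ : IsLocalRing S) (_ : IsNoetherianRing S),
      (∃ s : Finset S, Ideal.span (s : Set S) = maximalIdeal S ∧
        (s.card : WithBot ℕ∞) = ringKrullDim S) ∧
      ∃ f ∈ (maximalIdeal S) ^ 2,
        Nonempty (AdicCompletion (maximalIdeal R) R ≃+* S ⧸ Ideal.span {f}))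
    (e : ℕ) (he : HasMultiplicity R e) (h2 : 2 < e)
    (G : Type u) [AddCommGroup G] [Module R G]
    (αG : G →ₗ[R] ResidueField R) (hG : IsResidueApprox R G αG) :
    (∀ n : ℕ, e < n →
      ∀ (N : Type u) (_ : AddCommGroup N) (_ : Module R N),
        IsMinimalSyzygyOf R (d + 1) N (R ⧸ (maximalIdeal R ^ n)) →
          IsLatticeC R N ∧ IsIndecomposable R N) ∧
    (∀ B : ℕ, ∃ n : ℕ, e < n ∧
      ∀ (N : Type u) (_ : AddCommGroup N) (_ : Module R N),
        IsMinimalSyzygyOf R (d + 1) N (R ⧸ (maximalIdeal R ^ n)) →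
          (B : WithBot ℕ∞) < hLengthC R N G) := by
  obtain ⟨S, _, _, _, ⟨s, hs, hsd⟩, f, hf, ⟨ψ⟩⟩ := hhyp
  have hfm : Ideal.span {f} ≤ maximalIdeal S :=
    (Ideal.span_singleton_le_iff_mem _).2 (Ideal.pow_le_self two_ne_zero hf)
  have := isLocalRing_quotient hfm
  let _ : Algebra R (S ⧸ Ideal.span {f}) :=
    ((ψ : AdicCompletion (maximalIdeal R) R →+* S ⧸ Ideal.span {f}).comp
      (algebraMap R (AdicCompletion (maximalIdeal R) R))).toAlgebra
  have hψ : ∀ r, algebraMap R (S ⧸ Ideal.span {f}) r = ψ (algebraMap R _ r) := fun _ => rfl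
  have hA := unramifiedExt_of_completion ψ hψ
  have hπ : Function.Surjective (algebraMap S (S ⧸ Ideal.span {f})) := Ideal.Quotient.mk_surjective
  have hker : RingHom.ker (algebraMap S (S ⧸ Ideal.span {f})) = Ideal.span {f} := Ideal.mk_ker
  have hx : IsRegSys fun i => (s.equivFin.symm i : S) := by
    refine ⟨?_, hsd.symm⟩
    rw [← hs]
    congr 1
    ext z
    exact ⟨by rintro ⟨i, rfl⟩; exact (s.equivFin.symm i).2,
      fun hz => ⟨s.equivFin ⟨z, hz⟩, by simp⟩⟩
  generalize (fun i => (s.equivFin.symm i : S)) = x at hx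
  clear hsd
  generalize s.card = D at x hx
  obtain ⟨rfl, hf0, hfe, hfe', hfin, hgrow⟩ := he.exists_order hA hx hπ hker hf h2 hdim
  obtain ⟨h, rs, rfl, rfl, H⟩ := HypersurfaceExt.exists_of_isRegSys hA
    (exists_sub_algebraMap_mem_of_completion ψ hψ 2) hπ hker hf0 hx hd hdim h2 hfe hfe'
  obtain ⟨c, hc⟩ := H.exists_bound hfin (hgrow hd)
  refine ⟨fun n hn N _ _ hN => ?_, fun B => ⟨h.e + 1 + B * c, by omega, fun N _ _ hN => ?_⟩⟩
  · obtain ⟨j, rfl⟩ := Nat.exists_eq_add_of_le hn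
    have : Nontrivial N := by
      by_contra hN'
      rw [not_nontrivial_iff_subsingleton] at hN'
      have := hc j N hN 0 0 (Function.surjective_to_subsingleton _)
      omega
    exact ⟨H.isLatticeC hN, H.isIndecomposable hn.le hN⟩
  · have : Module.Finite R N := IsMinimalSyzygyOf.finite _ hN
    obtain ⟨μ, p, hp, hμ⟩ := exists_minimal_generators (R := R) N
    have h1 := hc _ N hN μ p hp
    have h3 : B < μ := lt_of_mul_lt_mul_right (h1 : B * c < μ * c) c.zero_le
    refine lt_of_lt_of_le ?_ ((WithBot.coe_le_coe.2 hμ).trans (H.length_hom_le hN hG))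
    exact_mod_cast h3

end BT
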